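/- arXiv:1603.07215 — 15 statements merged into one kernel-verified Lean document; each statement's English description precedes it below -/
import Mathlib

section
/- Let d ≥ 2, let (Q,+) be a finite abelian group with at least two elements, and let F be a cellular automaton on Q^{ℤ^d} that is linear, i.e. F(c ⊞ d) = F(c) ⊞ F(d) for all configurations c, d, where ⊞ denotes pointwise addition. Then F is not pre-expansive. -/
open Polynomial in
/-- Cayley-Hamilton combined with Frobenius: in characteristic `p` all powers of `A ^ p ^ k` are
combinations of boundedly many of them, with `p ^ k`-th powers as coefficients. -/
theorem Module.End.exists_pow_mul_char_pow_eq_sum {R M : Type*} [CommRing R] [AddCommGroup M]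
    [Module R M] [Module.Finite R M] (p : ℕ) [Fact p.Prime] [CharP R p] (A : Module.End R M) :
    ∃ n : ℕ, ∀ k m : ℕ, ∃ b : ℕ → R,
      A ^ (m * p ^ k) = ∑ i ∈ Finset.range n, b i ^ p ^ k • A ^ (i * p ^ k) := by
  obtain ⟨P, hP, hPA⟩ := LinearMap.exists_monic_and_aeval_eq_zero R A
  refine ⟨P.natDegree + 1, fun k m => ⟨(X ^ m %ₘ P).coeff, ?_⟩⟩
  have hrem : aeval A ((X ^ m %ₘ P) ^ p ^ k) = A ^ (m * p ^ k) := by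
    have hdiv := congrArg (aeval A) (modByMonic_add_div (X ^ m : R[X]) P)
    rw [map_add, map_mul, hPA, zero_mul, add_zero, map_pow, aeval_X] at hdiv
    rw [map_pow, hdiv, pow_mul]
  rw [← hrem]
  nth_rewrite 1 [as_sum_range_C_mul_X_pow' (X ^ m %ₘ P)
    (Nat.lt_succ_of_le (natDegree_modByMonic_le _ hP))]
  rw [sum_pow_char_pow p k, map_sum]
  refine Finset.sum_congr rfl fun i _ => ?_
  rw [mul_pow, ← C_pow, ← pow_mul, map_mul, aeval_C, aeval_X_pow,
    ← Algebra.smul_def]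

namespace AddMonoidAlgebra

theorem charP_zmod (p : ℕ) [Fact p.Prime] (G : Type*) [AddCommGroup G] :
    CharP (AddMonoidAlgebra (ZMod p) G) p :=
  charP_of_injective_ringHom (algebraMap (ZMod p) (AddMonoidAlgebra (ZMod p) G)).injective p

theorem char_pow_smul_mem {p : ℕ} [Fact p.Prime] {G M : Type*} [AddCommGroup G] [AddCommGroup M]
    [Module (AddMonoidAlgebra (ZMod p) G) M] (k : ℕ) (N : AddSubgroup M) (x : M)
    (hx : ∀ g : G, (single (p ^ k • g) 1 : AddMonoidAlgebra (ZMod p) G) • x ∈ N)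
    (b : AddMonoidAlgebra (ZMod p) G) : b ^ p ^ k • x ∈ N := by
  have := charP_zmod p G
  induction b using induction_linear with
  | zero =>
    rw [zero_pow (pow_ne_zero _ (Fact.out : p.Prime).ne_zero), zero_smul]
    exact N.zero_mem
  | add f g hf hg =>
    rw [add_pow_char_pow, add_smul]
    exact N.add_mem hf hg
  | single g a =>
    have hsingle : (single (p ^ k • g) (a ^ p ^ k) : AddMonoidAlgebra (ZMod p) G)
        = (a ^ p ^ k).val • single (p ^ k • g) 1 := by
      rw [smul_single, nsmul_one, ZMod.natCast_zmod_val]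
    rw [single_pow, hsingle, smul_assoc]
    exact N.nsmul_mem (hx g) _

theorem exists_forall_iterate_mem {p : ℕ} [Fact p.Prime] {G M : Type*} [AddCommGroup G]
    [AddCommGroup M] [Module (AddMonoidAlgebra (ZMod p) G) M]
    [Module.Finite (AddMonoidAlgebra (ZMod p) G) M]
    (A : Module.End (AddMonoidAlgebra (ZMod p) G) M) :
    ∃ n : ℕ, ∀ (k : ℕ) (N : AddSubgroup M) (x : M),
      (∀ g : G, ∀ t < n * p ^ k,
        (single (p ^ k • g) 1 : AddMonoidAlgebra (ZMod p) G) • A^[t] x ∈ N) →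
      ∀ t : ℕ, A^[t] x ∈ N := by
  have := charP_zmod p G
  obtain ⟨n, hn⟩ := A.exists_pow_mul_char_pow_eq_sum p
  refine ⟨n, fun k N x hx t => ?_⟩
  have hq : 0 < p ^ k := pow_pos (Fact.out : p.Prime).pos k
  obtain ⟨b, hb⟩ := hn k (t / p ^ k)
  have ht : A^[t] x = ∑ i ∈ Finset.range n, b i ^ p ^ k • A^[i * p ^ k + t % p ^ k] x := by
    rw [← Module.End.pow_apply, ← Nat.div_add_mod' t (p ^ k), pow_add, hb, Finset.sum_mul,
      LinearMap.sum_apply, Nat.div_add_mod']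
    refine Finset.sum_congr rfl fun i _ => ?_
    rw [smul_mul_assoc, LinearMap.smul_apply, ← pow_add, Module.End.pow_apply]
  rw [ht]
  refine N.sum_mem fun i hi => char_pow_smul_mem k N _ (fun g => hx g _ ?_) _
  calc i * p ^ k + t % p ^ k < i * p ^ k + p ^ k := by gcongr; exact Nat.mod_lt _ hq
    _ = (i + 1) * p ^ k := by ring
    _ ≤ n * p ^ k := by gcongr; exact Finset.mem_range.mp hi

end AddMonoidAlgebra

/-- Configurations of finite support with values in the `p`-torsion of `Q`. -/
def torsionConfig (G Q : Type*) [AddCommGroup Q] (p : ℕ) : AddSubgroup (G → Q) where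
  carrier := {c | (Function.support c).Finite ∧ p • c = 0}
  zero_mem' := by simp
  add_mem' {a b} ha hb := ⟨(ha.1.union hb.1).subset (Function.support_add a b), by
    rw [nsmul_add, ha.2, hb.2, add_zero]⟩
  neg_mem' {a} ha := ⟨by rw [Function.support_neg]; exact ha.1, by rw [smul_neg, ha.2, neg_zero]⟩

namespace torsionConfig

variable {G Q : Type*} [AddCommGroup G] [AddCommGroup Q] {p : ℕ}

instance zmodModule : Module (ZMod p) (torsionConfig G Q p) :=
  AddCommGroup.zmodModule fun x => Subtype.ext x.2.2

/-- Translations acting on configurations. -/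
def shift : Multiplicative G →* Module.End (ZMod p) (torsionConfig G Q p) where
  toFun g := AddMonoidHom.toZModLinearMap p
    { toFun := fun c => ⟨fun z => c.1 (z + g.toAdd),
        c.2.1.preimage (add_left_injective g.toAdd).injOn,
        funext fun z => congrFun c.2.2 (z + g.toAdd)⟩
      map_zero' := rfl
      map_add' := fun _ _ => rfl }
  map_one' := by
    ext c z
    exact congrArg c.1 (add_zero z)
  map_mul' g h := by
    ext c z
    refine congrArg c.1 ?_
    rw [toAdd_mul, add_assoc]

noncomputable instance addMonoidAlgebraModule :
    Module (AddMonoidAlgebra (ZMod p) G) (torsionConfig G Q p) :=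
  Module.compHom _ (AddMonoidAlgebra.lift (ZMod p) (Module.End (ZMod p) (torsionConfig G Q p)) G
    shift).toRingHom

theorem single_smul (g : G) (a : ZMod p) (c : torsionConfig G Q p) :
    (AddMonoidAlgebra.single g a : AddMonoidAlgebra (ZMod p) G) • c
      = a • shift (Multiplicative.ofAdd g) c := by
  change AddMonoidAlgebra.lift (ZMod p) (Module.End (ZMod p) (torsionConfig G Q p)) G shift
    (AddMonoidAlgebra.single g a) c = _
  rw [AddMonoidAlgebra.lift_single, LinearMap.smul_apply]

theorem single_one_smul_apply (g : G) (c : torsionConfig G Q p) (z : G) :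
    ((AddMonoidAlgebra.single g 1 : AddMonoidAlgebra (ZMod p) G) • c).1 z = c.1 (z + g) := by
  rw [single_smul, one_smul]
  rfl

open Classical in
instance finite [Finite Q] :
    Module.Finite (AddMonoidAlgebra (ZMod p) G) (torsionConfig G Q p) := by
  let S : Set (torsionConfig G Q p) := {c | ∃ v : Q, c.1 = Pi.single 0 v}
  have hS : S.Finite := by
    refine Set.Finite.of_finite_image (f := Subtype.val) ?_ Subtype.val_injective.injOn
    refine (Set.finite_range fun v : Q => (Pi.single 0 v : G → Q)).subset ?_
    rintro _ ⟨c, ⟨v, hv⟩, rfl⟩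
    exact ⟨v, hv.symm⟩
  refine ⟨⟨hS.toFinset, ?_⟩⟩
  rw [hS.coe_toFinset, eq_top_iff]
  intro x _
  have hmem (v : Q) (hv : p • v = 0) : (Pi.single 0 v : G → Q) ∈ torsionConfig G Q p :=
    ⟨(Set.finite_singleton 0).subset (Function.support_subset_iff'.mpr fun y hy =>
      Pi.single_eq_of_ne (M := fun _ : G => Q) (by simpa using hy) v), by rw [← Pi.single_smul, hv, Pi.single_zero]⟩
  have hx : x = ∑ z ∈ x.2.1.toFinset, (AddMonoidAlgebra.single (-z) 1 : AddMonoidAlgebra (ZMod p) G)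
      • (⟨Pi.single 0 (x.1 z), hmem _ (congrFun x.2.2 z)⟩ : torsionConfig G Q p) := by
    refine Subtype.ext (funext fun y => ?_)
    rw [AddSubgroup.val_finsetSum, Finset.sum_apply]
    simp_rw [single_one_smul_apply, Pi.single_apply, ← sub_eq_add_neg, sub_eq_zero]
    rw [Finset.sum_ite_eq]
    simp [eq_comm]
  rw [hx]
  exact Submodule.sum_mem _ fun z _ => Submodule.smul_mem _ _ (Submodule.subset_span ⟨_, rfl⟩)

end torsionConfig

theorem exists_forall_iterate_apply_eq_zero {G Q : Type*} [AddCommGroup G] [AddCommGroup Q]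
    [Finite Q] {p : ℕ} [Fact p.Prime] (Φ : (G → Q) →+ (G → Q))
    (hshift : ∀ c g z, Φ (fun y => c (y + g)) z = Φ c (z + g))
    (hfin : ∀ c, (Function.support c).Finite → (Function.support (Φ c)).Finite) :
    ∃ n : ℕ, ∀ (k : ℕ) (c : G → Q), (Function.support c).Finite → p • c = 0 → ∀ w : G,
      (∀ g : G, ∀ t < n * p ^ k, Φ^[t] c (w + p ^ k • g) = 0) → ∀ t : ℕ, Φ^[t] c w = 0 := by
  let Φ₀ : torsionConfig G Q p →+ torsionConfig G Q p :=
    (Φ.comp (torsionConfig G Q p).subtype).codRestrict (torsionConfig G Q p) fun c =>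
      ⟨hfin _ c.2.1, by
        rw [AddMonoidHom.comp_apply, ← map_nsmul, AddSubgroup.subtype_apply, c.2.2, map_zero]⟩
  let A : Module.End (AddMonoidAlgebra (ZMod p) G) (torsionConfig G Q p) :=
    { Φ₀ with
      map_smul' := fun r c => by
        change Φ₀ (r • c) = r • Φ₀ c
        induction r using AddMonoidAlgebra.induction_linear with
        | zero => rw [zero_smul, zero_smul, map_zero]
        | add f g hf hg => rw [add_smul, add_smul, map_add, hf, hg]
        | single g a =>
          rw [torsionConfig.single_smul, torsionConfig.single_smul, ZMod.map_smul]
          exact congrArg _ (Subtype.ext (funext fun z => hshift c.1 g z)) }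
  have hA (t : ℕ) (c : torsionConfig G Q p) : (A^[t] c).1 = Φ^[t] c.1 :=
    (Function.Semiconj.iterate_right (f := Subtype.val) (fun _ => rfl) t) c
  obtain ⟨n, hn⟩ := AddMonoidAlgebra.exists_forall_iterate_mem A
  refine ⟨n, fun k c hc hpc w hw t => ?_⟩
  let ev : torsionConfig G Q p →+ Q := (Pi.evalAddMonoidHom (fun _ : G => Q) w).comp (AddSubgroup.subtype _)
  have key := hn k ev.ker ⟨c, hc, hpc⟩ (fun g s hs => ?_) t
  · rw [← hA t ⟨c, hc, hpc⟩]
    exact key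
  · change ((AddMonoidAlgebra.single (p ^ k • g) 1 : AddMonoidAlgebra (ZMod p) G) •
      A^[s] ⟨c, hc, hpc⟩).1 w = 0
    rw [torsionConfig.single_one_smul_apply, hA]
    exact hw g s hs

theorem Finset.exists_forall_abs_apply_le {ι : Type*} [Fintype ι] (V : Finset (ι → ℤ)) :
    ∃ r : ℕ, ∀ v ∈ V, ∀ i, |v i| ≤ r := by
  refine ⟨V.sup fun v => Finset.univ.sup fun i => (v i).natAbs, fun v hv i => ?_⟩
  rw [Int.abs_eq_natAbs, Nat.cast_le]
  exact (Finset.le_sup (f := fun i => (v i).natAbs) (Finset.mem_univ i)).trans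
    (Finset.le_sup (f := fun v : ι → ℤ => Finset.univ.sup fun i => (v i).natAbs) hv)

theorem iterate_apply_eq_zero_of_lt_abs {ι Q : Type*} [Zero Q] {F : ((ι → ℤ) → Q) → (ι → ℤ) → Q}
    {V : Finset (ι → ℤ)} (hF : ∀ c z, (∀ v ∈ V, c (z + v) = 0) → F c z = 0)
    {r : ℕ} (hr : ∀ v ∈ V, ∀ i, |v i| ≤ r) {c : (ι → ℤ) → Q} {a : ℕ}
    (hc : ∀ z i, (a : ℤ) < |z i| → c z = 0) (t : ℕ) :
    ∀ z i, ((a + r * t : ℕ) : ℤ) < |z i| → F^[t] c z = 0 := by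
  induction t with
  | zero => simpa using hc
  | succ t ih =>
    intro z i hz
    rw [Function.iterate_succ_apply']
    refine hF _ _ fun v hv => ih _ i ?_
    have h₁ := hr v hv i
    have h₂ : |z i| ≤ |z i + v i| + |v i| := by
      simpa using abs_sub (z i + v i) (v i)
    rw [Pi.add_apply]
    push_cast at hz ⊢
    linarith

/-- A linear cellular automaton on `Q^(ℤ^d)` with `d ≥ 2` and `Q` a finite
abelian group with at least two elements is not pre-expansive. -/
theorem linear_ca_dim_ge_two_not_preexpansive
    (d : ℕ) (hd : 2 ≤ d) (Q : Type) [Fintype Q] [AddCommGroup Q]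
    (hQ : 1 < Fintype.card Q)
    (F : ((Fin d → ℤ) → Q) → (Fin d → ℤ) → Q)
    (hCA : ∃ (V : Finset (Fin d → ℤ)) (f : (V → Q) → Q),
      ∀ c z, F c z = f fun v => c (z + v.1))
    (hlin : ∀ c₁ c₂ : (Fin d → ℤ) → Q, F (c₁ + c₂) = F c₁ + F c₂) :
    ¬ ∃ W : Finset (Fin d → ℤ), ∀ c₁ c₂ : (Fin d → ℤ) → Q,
        {z | c₁ z ≠ c₂ z}.Finite → c₁ ≠ c₂ →
        ∃ t : ℕ, ∃ w ∈ W, F^[t] c₁ w ≠ F^[t] c₂ w := by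
  classical
  rintro ⟨W, hW⟩
  obtain ⟨V, f, hf⟩ := hCA
  let Φ : ((Fin d → ℤ) → Q) →+ ((Fin d → ℤ) → Q) := AddMonoidHom.mk' F hlin
  have hlocal (c : (Fin d → ℤ) → Q) (z) (h : ∀ v ∈ V, c (z + v) = 0) : F c z = 0 := by
    have h0 : F 0 z = 0 := congrFun (map_zero Φ) z
    rw [← h0, hf, hf]
    exact congrArg f (funext fun v => h v.1 v.2)
  have hshift (c : (Fin d → ℤ) → Q) (g z) : Φ (fun y => c (y + g)) z = Φ c (z + g) := by
    change F _ z = F c (z + g)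
    rw [hf, hf]
    exact congrArg f (funext fun v => by rw [add_right_comm])
  have hfin (c : (Fin d → ℤ) → Q) (hc : (Function.support c).Finite) :
      (Function.support (Φ c)).Finite := by
    refine (V.finite_toSet.biUnion fun v _ =>
      hc.preimage (add_left_injective v).injOn).subset fun z hz => ?_
    by_contra hz'
    refine hz (hlocal c z fun v hv => ?_)
    by_contra h
    exact hz' (Set.mem_biUnion hv h)
  obtain ⟨p, hp, hpQ⟩ := Nat.exists_prime_and_dvd hQ.ne'
  have : Fact p.Prime := ⟨hp⟩
  obtain ⟨n, hn⟩ := exists_forall_iterate_apply_eq_zero (p := p) Φ hshift hfin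
  obtain ⟨r, hr⟩ := V.exists_forall_abs_apply_le
  obtain ⟨s, hs⟩ := W.exists_forall_abs_apply_le
  let K : ℕ := 1 + r * n + s
  let box : Finset (Fin d → ℤ) := Fintype.piFinset fun _ => Finset.Icc (-K : ℤ) K
  obtain ⟨k, q, hq, hkq⟩ : ∃ k q, p ^ k = q ∧ n * (W.card * box.card) < q :=
    ⟨_, _, rfl, Nat.lt_pow_self hp.one_lt⟩
  have hqpos : 0 < q := Nat.zero_lt_of_lt hkq
  let B : Finset (Fin d → ℤ) := Fintype.piFinset fun _ => Finset.Ico (0 : ℤ) q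
  let T := {x : Q // p • x = 0}
  have hT : 1 < Fintype.card T := by
    obtain ⟨x, hx⟩ := exists_prime_addOrderOf_dvd_card p hpQ
    refine Fintype.one_lt_card_iff.mpr ⟨⟨0, smul_zero p⟩, ⟨x, hx ▸ addOrderOf_nsmul_eq_zero x⟩, ?_⟩
    rintro h
    have hx0 : 0 = x := congrArg Subtype.val h
    rw [← hx0, addOrderOf_zero] at hx
    exact hp.one_lt.ne hx
  let ext (u : B → T) : (Fin d → ℤ) → Q := fun z => if h : z ∈ B then (u ⟨z, h⟩).1 else 0
  have hext (u : B → T) : p • ext u = 0 := by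
    funext z
    by_cases h : z ∈ B
    · simpa [ext, h] using (u ⟨z, h⟩).2
    · simp [ext, h]
  have hextB (u : B → T) (z) (h : z ∉ B) : ext u z = 0 := dif_neg h
  let trace (u : B → T) : Fin (n * q) × W × box → T := fun x =>
    ⟨Φ^[x.1] (ext u) (x.2.1.1 + q • x.2.2.1), by
      rw [← Pi.smul_apply, ← iterate_map_nsmul, hext, iterate_map_zero, Pi.zero_apply]⟩
  have hcard : Fintype.card (Fin (n * q) × W × box → T) < Fintype.card (B → T) := by
    simp only [Fintype.card_fun, Fintype.card_prod, Fintype.card_fin, Fintype.card_coe]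
    refine Nat.pow_lt_pow_right hT ?_
    have hB : B.card = q ^ d := by simp [B]
    calc n * q * (W.card * box.card) = n * (W.card * box.card) * q := by ring
      _ < q * q := Nat.mul_lt_mul_of_pos_right hkq hqpos
      _ = q ^ 2 := by ring
      _ ≤ B.card := hB ▸ Nat.pow_le_pow_right hqpos hd
  obtain ⟨u, u', hne, htr⟩ := Fintype.exists_ne_map_eq_of_card_lt trace hcard
  have hsub (z) (h : z ∉ B) : (ext u - ext u') z = 0 := by
    rw [Pi.sub_apply, hextB u z h, hextB u' z h, sub_zero]
  have hzero (w) (hw : w ∈ W) (t : ℕ) : Φ^[t] (ext u - ext u') w = 0 := by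
    refine hn k _ (B.finite_toSet.subset (Function.support_subset_iff'.mpr hsub))
      (by rw [smul_sub, hext, hext, sub_zero]) w (fun g t ht => ?_) t
    rw [hq] at ht ⊢
    by_cases hg : g ∈ box
    · have h := congrArg Subtype.val (congrFun htr (⟨t, ht⟩, ⟨w, hw⟩, ⟨g, hg⟩))
      rw [iterate_map_sub, Pi.sub_apply, sub_eq_zero]
      exact h
    · obtain ⟨i, hi⟩ : ∃ i, (K : ℤ) < |g i| := by
        by_contra! h
        exact hg (Fintype.mem_piFinset.mpr fun i => Finset.mem_Icc.mpr (abs_le.mp (h i)))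
      refine iterate_apply_eq_zero_of_lt_abs hlocal hr (a := q) (fun z j hj => hsub z fun hz => ?_)
        t _ i ?_
      · have := Finset.mem_Ico.mp (Fintype.mem_piFinset.mp hz j)
        rw [abs_of_nonneg this.1] at hj
        exact hj.not_gt this.2
      · have hw' := hs w hw i
        have htri : |(q : ℤ) * g i| ≤ |w i + q * g i| + |w i| := by
          simpa using abs_sub (w i + q * g i) (w i)
        rw [abs_mul, Nat.abs_cast] at htri
        rw [Pi.add_apply, Pi.smul_apply, nsmul_eq_mul]
        have hq1 : (1 : ℤ) ≤ q := by exact_mod_cast hqpos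
        have htq : (r * t : ℤ) ≤ r * (n * q) := by
          gcongr
          exact_mod_cast ht.le
        have hK : (q : ℤ) * (1 + r * n + s + 1) ≤ q * |g i| := by
          gcongr
          have : ((1 + r * n + s : ℕ) : ℤ) < |g i| := hi
          push_cast at this
          linarith
        push_cast
        nlinarith [mul_nonneg (sub_nonneg.mpr hq1) (Nat.cast_nonneg (α := ℤ) s)]
  have hdiff : ext u ≠ ext u' := by
    intro h
    refine hne (funext fun z => Subtype.ext ?_)
    have hz := congrFun h z.1
    simpa [ext] using hz
  obtain ⟨t, w, hw, h⟩ := hW (ext u) (ext u')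
    (B.finite_toSet.subset fun z hz => by
      by_contra h
      exact hz (by rw [hextB u z h, hextB u' z h])) hdiff
  refine h (sub_eq_zero.mp ?_)
  have h0 := hzero w hw t
  rw [iterate_map_sub] at h0
  exact h0
end

section
/- There exist finite alphabets and one-dimensional cellular automata F₁, F₂, F₃, F₄ with the following properties: (1) F₁ is pre-expansive, bijective, and not positively expansive; (2) F₂ is pre-expansive, not injective, and not positively expansive; (3) F₃ is 1-expansive, bijective, and not pre-expansive; (4) F₄ is 1-expansive, not injective, and not pre-expansive. -/
/-- `F` is a one-dimensional cellular automaton: there is a neighborhood `[-l, r]`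
and a local rule `f` such that `F c z = f (c (z-l), …, c (z+r))`. -/
def IsCA1D {Q : Type*} (F : (ℤ → Q) → ℤ → Q) : Prop :=
  ∃ (l r : ℕ) (f : (Fin (l + r + 1) → Q) → Q),
    ∀ c z, F c z = f fun i => c (z - (l : ℤ) + (i.val : ℤ))

/-- Pre-expansivity: some finite window `[-m, m]` eventually witnesses any asymptotic
pair of distinct configurations. -/
def PreExpansive {Q : Type*} (F : (ℤ → Q) → ℤ → Q) : Prop :=
  ∃ m : ℕ, ∀ c d : ℤ → Q, {z | c z ≠ d z}.Finite → c ≠ d →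
    ∃ t : ℕ, ∃ x : ℤ, |x| ≤ (m : ℤ) ∧ F^[t] c x ≠ F^[t] d x

/-- `k`-expansivity: some finite window `[-m, m]` eventually witnesses any pair of
configurations differing in exactly `k` positions. -/
def KExpansive {Q : Type*} (k : ℕ) (F : (ℤ → Q) → ℤ → Q) : Prop :=
  ∃ m : ℕ, ∀ c d : ℤ → Q, {z | c z ≠ d z}.ncard = k →
    ∃ t : ℕ, ∃ x : ℤ, |x| ≤ (m : ℤ) ∧ F^[t] c x ≠ F^[t] d x

/-- Positive expansivity: some finite window `[-m, m]` eventually witnesses any pair of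
distinct configurations. -/
def PosExpansive {Q : Type*} (F : (ℤ → Q) → ℤ → Q) : Prop :=
  ∃ m : ℕ, ∀ c d : ℤ → Q, c ≠ d →
    ∃ t : ℕ, ∃ x : ℤ, |x| ≤ (m : ℤ) ∧ F^[t] c x ≠ F^[t] d x

open Polynomial in
/-- The binary form `X p² - (X² + X + 1) p q + X q²` is anisotropic over `𝔽₂[X]`. -/
theorem eq_zero_of_norm_eq_zero {p q : (ZMod 2)[X]}
    (h : X * (p ^ 2 + q ^ 2) = (X ^ 2 + X + 1) * (p * q)) : p = 0 ∧ q = 0 := by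
  have key : ∀ (n : ℕ) (p q : (ZMod 2)[X]), X * (p ^ 2 + q ^ 2) = (X ^ 2 + X + 1) * (p * q) →
      (X - C 1) ^ n ∣ p ∧ (X - C 1) ^ n ∣ q := by
    intro n
    induction n with
    | zero => simp
    | succ n ih =>
      intro p q h
      have h1 := congrArg (eval 1) h
      simp only [eval_mul, eval_add, eval_pow, eval_X, eval_one] at h1
      have aniso : ∀ a b : ZMod 2,
          1 * (a ^ 2 + b ^ 2) = (1 ^ 2 + 1 + 1) * (a * b) → a = 0 ∧ b = 0 := by decide
      obtain ⟨hp, hq⟩ := aniso _ _ h1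
      obtain ⟨p', rfl⟩ := dvd_iff_isRoot.mpr hp
      obtain ⟨q', rfl⟩ := dvd_iff_isRoot.mpr hq
      have hne : (X - C 1 : (ZMod 2)[X]) ^ 2 ≠ 0 := pow_ne_zero _ (X_sub_C_ne_zero 1)
      obtain ⟨hp', hq'⟩ := ih p' q' (mul_left_cancel₀ hne (by linear_combination h))
      exact ⟨by rw [pow_succ']; exact mul_dvd_mul_left _ hp',
        by rw [pow_succ']; exact mul_dvd_mul_left _ hq'⟩
  have deg : ∀ r : (ZMod 2)[X], (X - C 1) ^ (r.natDegree + 1) ∣ r → r = 0 := fun r hr =>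
    eq_zero_of_dvd_of_natDegree_lt hr (by rw [natDegree_pow, natDegree_X_sub_C]; omega)
  exact ⟨deg p (key _ p q h).1, deg q (key _ p q h).2⟩

open PowerSeries in
theorem X_pow_dvd_of_recurrence (k : ℕ) {P : ℕ → (ZMod 2)⟦X⟧}
    (h : ∀ t, X * (P (t + 2) + P t) = (X ^ 2 + X + 1) * P (t + 1)) (t : ℕ) :
    X ^ k ∣ P (t + k) := by
  induction k generalizing P t with
  | zero => simp
  | succ k ih =>
    have hX : ∀ t, ∃ q, P (t + 1) = X * q := fun t =>
      ⟨P (t + 2) + P t - (X + 1) * P (t + 1), by linear_combination -h t⟩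
    choose Q hQ using hX
    have hQrec : ∀ t, X * (Q (t + 2) + Q t) = (X ^ 2 + X + 1) * Q (t + 1) := by
      intro t
      refine mul_left_cancel₀ (X_ne_zero (R := ZMod 2)) ?_
      have := h (t + 1)
      rw [hQ t, hQ (t + 1), hQ (t + 2)] at this
      linear_combination this
    rw [← add_assoc, hQ, pow_succ']
    exact mul_dvd_mul_left _ (ih hQrec t)

open PowerSeries in
theorem norm_eq_zero_of_recurrence {P : ℕ → (ZMod 2)⟦X⟧}
    (h : ∀ t, X * (P (t + 2) + P t) = (X ^ 2 + X + 1) * P (t + 1)) :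
    X * (P 1 ^ 2 + P 0 ^ 2) = (X ^ 2 + X + 1) * (P 1 * P 0) := by
  have conserved : ∀ t, X * (P (t + 1) ^ 2 + P t ^ 2) - (X ^ 2 + X + 1) * (P (t + 1) * P t) =
      X * (P 1 ^ 2 + P 0 ^ 2) - (X ^ 2 + X + 1) * (P 1 * P 0) := by
    intro t
    induction t with
    | zero => rfl
    | succ t ih => rw [← ih]; linear_combination (P (t + 2) - P t) * h t
  rw [← sub_eq_zero]
  ext n
  have hd : ∀ t k, t ≤ k → X ^ t ∣ P k := fun t k htk => by
    simpa [Nat.sub_add_cancel htk] using X_pow_dvd_of_recurrence t h (k - t)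
  have hdvd : (X : (ZMod 2)⟦X⟧) ^ (n + 1) ∣
      X * (P 1 ^ 2 + P 0 ^ 2) - (X ^ 2 + X + 1) * (P 1 * P 0) := by
    rw [← conserved (n + 1)]
    have h0 := hd (n + 1) (n + 1) le_rfl
    have h1 := hd (n + 1) (n + 1 + 1) (by omega)
    exact dvd_sub (dvd_mul_of_dvd_right (dvd_add (dvd_pow h1 two_ne_zero)
      (dvd_pow h0 two_ne_zero)) _) (dvd_mul_of_dvd_right (dvd_mul_of_dvd_left h1 _) _)
  simpa using X_pow_dvd_iff.mp hdvd n (Nat.lt_succ_self n)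

/-- The space-time diagrams of the second-order automaton
`x (t + 2) = (u⁻¹ + ε + u) x (t + 1) + x t` over `𝔽₂`, where `u` is the shift. -/
def IsSecondOrderOrbit (ε : ZMod 2) (x : ℕ → ℤ → ZMod 2) : Prop :=
  ∀ t z, x (t + 2) z = x t z + x (t + 1) (z - 1) + ε * x (t + 1) z + x (t + 1) (z + 1)

theorem IsSecondOrderOrbit.reflect {ε : ZMod 2} {x : ℕ → ℤ → ZMod 2}
    (h : IsSecondOrderOrbit ε x) : IsSecondOrderOrbit ε fun t z => x t (-z) := by
  intro t z
  have := h t (-z)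
  simp only [show -(z - 1) = -z + 1 by ring, show -(z + 1) = -z - 1 by ring, this]
  ring

/-- A finite configuration whose orbit vanishes on the cells `0` and `1` vanishes to the
right of them. -/
theorem IsSecondOrderOrbit.eq_zero_of_nonneg {x : ℕ → ℤ → ZMod 2}
    (h : IsSecondOrderOrbit 1 x) (h0 : ∀ t, x t 0 = 0) (h1 : ∀ t, x t 1 = 0) {R : ℕ}
    (hR : ∀ z : ℤ, (R : ℤ) ≤ z → x 0 z = 0 ∧ x 1 z = 0) (z : ℤ) (hz : 0 ≤ z) :
    x 0 z = 0 ∧ x 1 z = 0 := by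
  let P : ℕ → PowerSeries (ZMod 2) := fun t => PowerSeries.mk fun n => x t n
  have hP : ∀ t, PowerSeries.X * (P (t + 2) + P t) =
      (PowerSeries.X ^ 2 + PowerSeries.X + 1) * P (t + 1) := by
    intro t
    rw [show (PowerSeries.X ^ 2 + PowerSeries.X + 1) * P (t + 1) =
      PowerSeries.X * (PowerSeries.X * P (t + 1)) + PowerSeries.X * P (t + 1) + P (t + 1) by ring]
    ext n
    rcases n with _ | _ | n
    · simp [P, h0]
    · simp [P, PowerSeries.coeff_succ_X_mul, h0, h1]
    · simp only [map_add, PowerSeries.coeff_succ_X_mul, P, PowerSeries.coeff_mk]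
      have e := h t ((n : ℤ) + 1)
      rw [show (n : ℤ) + 1 - 1 = n by ring, show (n : ℤ) + 1 + 1 = n + 2 by ring] at e
      push_cast
      rw [show (n : ℤ) + 1 + 1 = n + 2 by ring, e]
      linear_combination CharTwo.add_self_eq_zero (x t ((n : ℤ) + 1))
  have coe_trunc : ∀ t, (∀ z : ℤ, (R : ℤ) ≤ z → x t z = 0) →
      ((PowerSeries.trunc R (P t) : Polynomial (ZMod 2)) : PowerSeries (ZMod 2)) = P t := by
    intro t ht
    ext n
    rw [Polynomial.coeff_coe, PowerSeries.coeff_trunc]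
    split_ifs with hn
    · rfl
    · simp only [P, PowerSeries.coeff_mk]
      exact (ht n (by omega)).symm
  have e0 := coe_trunc 0 fun z hz => (hR z hz).1
  have e1 := coe_trunc 1 fun z hz => (hR z hz).2
  have hN := norm_eq_zero_of_recurrence hP
  rw [← e0, ← e1] at hN
  obtain ⟨p1, p0⟩ := eq_zero_of_norm_eq_zero
    (p := PowerSeries.trunc R (P 1)) (q := PowerSeries.trunc R (P 0))
    (Polynomial.coe_injective (ZMod 2) (by push_cast; exact hN))
  rw [p0] at e0
  rw [p1] at e1
  obtain ⟨n, rfl⟩ := Int.eq_ofNat_of_zero_le hz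
  exact ⟨by simpa [P] using (congrArg (PowerSeries.coeff n) e0).symm,
    by simpa [P] using (congrArg (PowerSeries.coeff n) e1).symm⟩

/-- The left end of a configuration moves left at speed one. -/
theorem IsSecondOrderOrbit.left_front {ε : ZMod 2} {x : ℕ → ℤ → ZMod 2}
    (h : IsSecondOrderOrbit ε x) {a : ℤ} (h0 : ∀ z < a, x 0 z = 0) (h1 : ∀ z < a, x 1 z = 0)
    (t : ℕ) : x (t + 1) (a - t) = x 1 a := by
  have key : (∀ z < a - t, x t z = 0 ∧ x (t + 1) z = 0) ∧ x (t + 1) (a - t) = x 1 a := by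
    induction t with
    | zero => simpa using fun z hz => ⟨h0 z hz, h1 z hz⟩
    | succ t ih =>
      obtain ⟨hz, ha⟩ := ih
      push_cast
      refine ⟨fun z hlt => ⟨(hz z (by omega)).2, ?_⟩, ?_⟩
      · rw [h t z, (hz z (by omega)).1, (hz (z - 1) (by omega)).2, (hz z (by omega)).2,
          (hz (z + 1) (by omega)).2]
        simp
      · rw [h t, (hz (a - (t + 1)) (by omega)).1, (hz (a - (t + 1) - 1) (by omega)).2,
          (hz (a - (t + 1)) (by omega)).2, show a - ((t : ℤ) + 1) + 1 = a - t by ring, ha]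
        simp
  exact key.2

theorem IsSecondOrderOrbit.exists_ne_zero_of_single {ε : ZMod 2} {x : ℕ → ℤ → ZMod 2}
    (h : IsSecondOrderOrbit ε x) {a : ℤ} (ha : 0 ≤ a)
    (h0 : ∀ z ≠ a, x 0 z = 0) (h1 : ∀ z ≠ a, x 1 z = 0) (hne : x 0 a ≠ 0 ∨ x 1 a ≠ 0) :
    ∃ t, x t 0 ≠ 0 := by
  obtain ⟨n, rfl⟩ := Int.eq_ofNat_of_zero_le ha
  by_cases hx : x 1 n = 0
  · have hx1 : ∀ z, x 1 z = 0 := fun z => by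
      by_cases hz : z = n
      · rw [hz, hx]
      · exact h1 z hz
    have hx2 : ∀ z, x 2 z = x 0 z := fun z => by simpa [hx1] using h 0 z
    have hs : IsSecondOrderOrbit ε fun t => x (t + 1) := fun t z => h (t + 1) z
    have := hs.left_front (a := n) (fun z _ => hx1 z)
      (fun z hz => (hx2 z).trans (h0 z hz.ne)) n
    refine ⟨n + 1 + 1, ?_⟩
    rw [sub_self] at this
    rw [this]
    simpa [hx2, hx] using hne
  · have := h.left_front (fun z hz => h0 z hz.ne) (fun z hz => h1 z hz.ne) n
    rw [sub_self] at this
    exact ⟨n + 1, by rwa [this]⟩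

/-- The second-order automaton over `𝔽₂`, acting on pairs `(x t, x (t + 1))`. -/
def secondOrderCA (ε : ZMod 2) : (ℤ → ZMod 2 × ZMod 2) →+ (ℤ → ZMod 2 × ZMod 2) where
  toFun c z := ((c z).2, (c z).1 + (c (z - 1)).2 + ε * (c z).2 + (c (z + 1)).2)
  map_zero' := by ext z <;> simp
  map_add' c d := by
    ext z
    · simp
    · simp only [Pi.add_apply, Prod.fst_add, Prod.snd_add]
      ring

theorem secondOrderCA_apply (ε : ZMod 2) (c : ℤ → ZMod 2 × ZMod 2) (z : ℤ) :
    secondOrderCA ε c z =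
      ((c z).2, (c z).1 + (c (z - 1)).2 + ε * (c z).2 + (c (z + 1)).2) := rfl

theorem isCA1D_secondOrderCA (ε : ZMod 2) : IsCA1D (secondOrderCA ε) := by
  refine ⟨1, 1, fun v => ((v 1).2, (v 1).1 + (v 0).2 + ε * (v 1).2 + (v 2).2), fun c z => ?_⟩
  simp [secondOrderCA_apply, show z - 1 + 2 = z + 1 by ring]

theorem bijective_secondOrderCA (ε : ZMod 2) : Function.Bijective (secondOrderCA ε) := by
  refine Function.bijective_iff_has_inverse.mpr
    ⟨fun c z => ((c z).2 - (c (z - 1)).1 - ε * (c z).1 - (c (z + 1)).1, (c z).1), ?_, ?_⟩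
  · intro c
    ext z
    · simp only [secondOrderCA_apply]
      ring
    · rfl
  · intro c
    ext z
    · rfl
    · simp only [secondOrderCA_apply]
      ring

theorem IsSecondOrderOrbit.iterate {ε : ZMod 2} {x : ℕ → ℤ → ZMod 2}
    (h : IsSecondOrderOrbit ε x) (t : ℕ) :
    (secondOrderCA ε)^[t] (fun z => (x 0 z, x 1 z)) = fun z => (x t z, x (t + 1) z) := by
  induction t with
  | zero => rfl
  | succ t ih =>
    rw [Function.iterate_succ_apply', ih]
    ext z
    · rfl
    · exact (h t z).symm

theorem iterate_secondOrderCA_snd (ε : ZMod 2) (c : ℤ → ZMod 2 × ZMod 2) (t : ℕ) (z : ℤ) :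
    ((secondOrderCA ε)^[t + 1] c z).1 = ((secondOrderCA ε)^[t] c z).2 := by
  rw [Function.iterate_succ_apply']
  rfl

theorem isSecondOrderOrbit_iterate (ε : ZMod 2) (c : ℤ → ZMod 2 × ZMod 2) :
    IsSecondOrderOrbit ε fun t z => ((secondOrderCA ε)^[t] c z).1 := by
  intro t z
  simp only [iterate_secondOrderCA_snd]
  rw [Function.iterate_succ_apply']
  rfl

theorem preExpansive_secondOrderCA_one : PreExpansive (secondOrderCA 1) := by
  refine ⟨1, fun c d hfin hne => ?_⟩
  by_contra! hcon
  set x : ℕ → ℤ → ZMod 2 := fun t z => ((secondOrderCA 1)^[t] (c - d) z).1 with hx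
  have horb : IsSecondOrderOrbit 1 x := isSecondOrderOrbit_iterate 1 (c - d)
  have hwin : ∀ t z, |z| ≤ 1 → x t z = 0 := fun t z hz => by
    simp [hx, iterate_map_sub, hcon t z hz]
  have hx0 : ∀ z, x 0 z = ((c - d) z).1 := fun z => rfl
  have hx1 : ∀ z, x 1 z = ((c - d) z).2 := fun z => rfl
  obtain ⟨R, hR⟩ : ∃ R : ℕ, ∀ z, c z ≠ d z → z.natAbs < R := by
    obtain ⟨R, hR⟩ := (hfin.image Int.natAbs).bddAbove
    exact ⟨R + 1, fun z hz => Nat.lt_succ_of_le (hR ⟨z, hz, rfl⟩)⟩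
  have hR' : ∀ z : ℤ, R ≤ z.natAbs → x 0 z = 0 ∧ x 1 z = 0 := fun z hz => by
    have : c z = d z := by
      by_contra hcd
      exact absurd (hR z hcd) (by omega)
    simp [hx0, hx1, this]
  have hzero : ∀ z, x 0 z = 0 ∧ x 1 z = 0 := by
    intro z
    rcases le_total 0 z with hz | hz
    · exact horb.eq_zero_of_nonneg (R := R) (fun t => hwin t 0 (by simp)) (fun t => hwin t 1 (by simp))
        (fun y hy => hR' y (by omega)) z hz
    · simpa using horb.reflect.eq_zero_of_nonneg (R := R) (fun t => hwin t _ (by simp))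
        (fun t => hwin t _ (by simp)) (fun y hy => hR' (-y) (by omega)) (-z) (by omega)
  refine hne (sub_eq_zero.mp (funext fun z => Prod.ext ?_ ?_))
  · exact (hzero z).1
  · exact (hzero z).2

/-- The columns of a space-time diagram vanishing on the left half-plane, solved for from left
to right. -/
def sidewaysColumn : ℕ → ℕ → ZMod 2
  | 0, _ => 0
  | 1, t => if t = 0 then 1 else 0
  | _ + 2, 0 => 0
  | n + 2, t + 1 => sidewaysColumn (n + 1) (t + 2) + sidewaysColumn (n + 1) t +
      sidewaysColumn (n + 1) (t + 1) + sidewaysColumn n (t + 1)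

theorem isSecondOrderOrbit_sidewaysColumn (m : ℤ) :
    IsSecondOrderOrbit 1 fun t z => sidewaysColumn (z - m).toNat t := by
  intro t z
  rcases lt_trichotomy z m with hz | rfl | hz
  · simp [show (z - m).toNat = 0 by omega, show (z - 1 - m).toNat = 0 by omega,
      show (z + 1 - m).toNat = 0 by omega, sidewaysColumn]
  · simp [sidewaysColumn]
  · obtain ⟨n, hn⟩ : ∃ n : ℕ, z = m + 1 + n := ⟨(z - m - 1).toNat, by omega⟩
    simp only [show (z - m).toNat = n + 1 by omega, show (z - 1 - m).toNat = n by omega,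
      show (z + 1 - m).toNat = n + 2 by omega]
    rw [sidewaysColumn]
    linear_combination -CharTwo.add_self_eq_zero (sidewaysColumn (n + 1) t) -
      CharTwo.add_self_eq_zero (sidewaysColumn (n + 1) (t + 1)) -
      CharTwo.add_self_eq_zero (sidewaysColumn n (t + 1))

theorem not_posExpansive_secondOrderCA_one : ¬ PosExpansive (secondOrderCA 1) := by
  rintro ⟨m, hm⟩
  have horb := isSecondOrderOrbit_sidewaysColumn m
  obtain ⟨t, z, hz, hne⟩ := hm
    (fun z => (sidewaysColumn (z - m).toNat 0, sidewaysColumn (z - m).toNat 1)) 0 (fun h => by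
    have := congrArg Prod.fst (congrFun h ((m : ℤ) + 1))
    simp [sidewaysColumn] at this)
  rw [horb.iterate t, iterate_map_zero] at hne
  have hzm : (z - m).toNat = 0 := by have := le_of_abs_le hz; omega
  simp [hzm, sidewaysColumn] at hne

theorem kExpansive_one_secondOrderCA (ε : ZMod 2) : KExpansive 1 (secondOrderCA ε) := by
  refine ⟨0, fun c d hcard => ?_⟩
  obtain ⟨a, ha⟩ := Set.ncard_eq_one.mp hcard
  have hiff : ∀ z, c z ≠ d z ↔ z = a := fun z => by
    simpa using Set.ext_iff.mp ha z
  have horb := isSecondOrderOrbit_iterate ε (c - d)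
  set x : ℕ → ℤ → ZMod 2 := fun t z => ((secondOrderCA ε)^[t] (c - d) z).1 with hx
  have hx0 : ∀ z, x 0 z = ((c - d) z).1 := fun z => rfl
  have hx1 : ∀ z, x 1 z = ((c - d) z).2 := fun z => rfl
  have hoff : ∀ z, z ≠ a → c z = d z := fun z hz => not_not.mp (mt (hiff z).mp hz)
  have h0 : ∀ z ≠ a, x 0 z = 0 := fun z hz => by simp [hx0, hoff z hz]
  have h1 : ∀ z ≠ a, x 1 z = 0 := fun z hz => by simp [hx1, hoff z hz]
  have hne : x 0 a ≠ 0 ∨ x 1 a ≠ 0 := by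
    by_contra! hcon
    exact (hiff a).mpr rfl (sub_eq_zero.mp (Prod.ext hcon.1 hcon.2))
  obtain ⟨t, ht⟩ : ∃ t, x t 0 ≠ 0 := by
    rcases le_total 0 a with hle | hle
    · exact horb.exists_ne_zero_of_single hle h0 h1 hne
    · simpa using horb.reflect.exists_ne_zero_of_single (a := -a) (by omega)
        (fun z hz => h0 (-z) (by omega)) (fun z hz => h1 (-z) (by omega)) (by simpa using hne)
  refine ⟨t, 0, by simp, fun heq => ht ?_⟩
  simp [hx, iterate_map_sub, heq]

theorem not_preExpansive_secondOrderCA_zero : ¬ PreExpansive (secondOrderCA 0) := by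
  rintro ⟨m, hm⟩
  have horb : IsSecondOrderOrbit 0 fun t z => if z = (m : ℤ) + 1 + t then 1 else 0 := by
    intro t z
    have e1 : z - 1 = (m : ℤ) + 1 + (t + 1 : ℕ) ↔ z = (m : ℤ) + 1 + (t + 2 : ℕ) := by omega
    have e2 : z + 1 = (m : ℤ) + 1 + (t + 1 : ℕ) ↔ z = (m : ℤ) + 1 + t := by omega
    simp only [e1, e2]
    linear_combination
      -CharTwo.add_self_eq_zero (if z = (m : ℤ) + 1 + t then (1 : ZMod 2) else 0)
  obtain ⟨t, z, hz, hne⟩ := hm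
    (fun z => (if z = (m : ℤ) + 1 + (0 : ℕ) then 1 else 0,
      if z = (m : ℤ) + 1 + (1 : ℕ) then 1 else 0)) 0
    ((Set.toFinite {(m : ℤ) + 1, (m : ℤ) + 2}).subset fun z hz => by
      by_contra hcon
      simp only [Set.mem_insert_iff, Set.mem_singleton_iff, not_or] at hcon
      refine hz (Prod.ext (if_neg ?_) (if_neg ?_)) <;> push_cast <;> omega)
    (fun h => by simpa using congrArg Prod.fst (congrFun h ((m : ℤ) + 1)))
  rw [horb.iterate t, iterate_map_zero] at hne
  have hzm := le_of_abs_le hz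
  exact hne (Prod.ext (if_neg (by omega)) (if_neg (by push_cast; omega)))

/-- The additive automaton over `𝔽₂` summing the two neighbors of each cell. -/
def neighborSumCA : (ℤ → ZMod 2) →+ (ℤ → ZMod 2) where
  toFun c z := c (z - 1) + c (z + 1)
  map_zero' := by ext z; simp
  map_add' c d := by
    ext z
    simp only [Pi.add_apply]
    ring

theorem neighborSumCA_apply (c : ℤ → ZMod 2) (z : ℤ) :
    neighborSumCA c z = c (z - 1) + c (z + 1) := rfl

theorem posExpansive_neighborSumCA : PosExpansive neighborSumCA := by
  refine ⟨1, fun c d hne => ?_⟩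
  by_contra! hcon
  have key : ∀ n : ℕ, ∀ t z, |z| ≤ (n : ℤ) + 1 → neighborSumCA^[t] (c - d) z = 0 := by
    intro n
    induction n with
    | zero =>
      intro t z hz
      simp [iterate_map_sub, hcon t z (by simpa using hz)]
    | succ n ih =>
      intro t z hz
      have step : ∀ y, neighborSumCA^[t + 1] (c - d) y =
          neighborSumCA^[t] (c - d) (y - 1) + neighborSumCA^[t] (c - d) (y + 1) := fun y => by
        rw [Function.iterate_succ_apply', neighborSumCA_apply]
      by_cases hle : |z| ≤ (n : ℤ) + 1
      · exact ih t z hle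
      rw [abs_le] at hz hle
      push_cast at hz
      rcases le_total 0 z with h0 | h0
      · have := step (z - 1)
        rw [ih (t + 1) (z - 1) (abs_le.mpr (by omega)),
          ih t (z - 1 - 1) (abs_le.mpr (by omega)), sub_add_cancel, zero_add] at this
        exact this.symm
      · have := step (z + 1)
        rw [ih (t + 1) (z + 1) (abs_le.mpr (by omega)),
          ih t (z + 1 + 1) (abs_le.mpr (by omega)), add_sub_cancel_right, add_zero] at this
        exact this.symm
  refine hne (sub_eq_zero.mp (funext fun z => ?_))
  exact key z.natAbs 0 z (by rw [Int.abs_eq_natAbs]; omega)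

theorem not_injective_neighborSumCA : ¬ Function.Injective neighborSumCA := by
  intro h
  have : (1 : ℤ → ZMod 2) = 0 := h (by
    ext z
    exact CharTwo.add_self_eq_zero 1)
  exact one_ne_zero this

/-- The product of two maps on configurations, acting on each layer separately. -/
def prodCA {Q R : Type*} (F : (ℤ → Q) → ℤ → Q) (G : (ℤ → R) → ℤ → R) :
    (ℤ → Q × R) → ℤ → Q × R :=
  fun c z => (F (fun y => (c y).1) z, G (fun y => (c y).2) z)

section prodCA

variable {Q R : Type*} {F : (ℤ → Q) → ℤ → Q} {G : (ℤ → R) → ℤ → R}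

theorem iterate_prodCA (t : ℕ) (c : ℤ → Q × R) :
    (prodCA F G)^[t] c =
      fun z => (F^[t] (fun y => (c y).1) z, G^[t] (fun y => (c y).2) z) := by
  induction t with
  | zero => rfl
  | succ t ih => simp only [Function.iterate_succ_apply', ih]; rfl

theorem isCA1D_prodCA_secondOrderCA (ε : ZMod 2) :
    IsCA1D (prodCA (secondOrderCA ε) neighborSumCA) := by
  refine ⟨1, 1, fun v => (((v 1).1.2,
    (v 1).1.1 + (v 0).1.2 + ε * (v 1).1.2 + (v 2).1.2), (v 0).2 + (v 2).2), fun c z => ?_⟩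
  simp [prodCA, secondOrderCA_apply, neighborSumCA_apply, show z - 1 + 2 = z + 1 by ring]

/-- If every pair of distinct configurations in a class is eventually witnessed, for both factors,
then the same holds for the product. -/
theorem exists_window_prodCA {p : Set ℤ → Prop}
    (hF : ∃ m : ℕ, ∀ c d : ℤ → Q, p {z | c z ≠ d z} → c ≠ d →
      ∃ t : ℕ, ∃ x : ℤ, |x| ≤ (m : ℤ) ∧ F^[t] c x ≠ F^[t] d x)
    (hG : PosExpansive G)
    (hp : ∀ s u : Set ℤ, p s → u ⊆ s → u.Nonempty → p u) :
    ∃ m : ℕ, ∀ c d : ℤ → Q × R, p {z | c z ≠ d z} → c ≠ d →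
      ∃ t : ℕ, ∃ x : ℤ, |x| ≤ (m : ℤ) ∧ (prodCA F G)^[t] c x ≠ (prodCA F G)^[t] d x := by
  obtain ⟨m, hm⟩ := hF
  obtain ⟨n, hn⟩ := hG
  refine ⟨max m n, fun c d hpcd hne => ?_⟩
  simp only [iterate_prodCA]
  by_cases h : (fun y => (c y).1) = fun y => (d y).1
  · have h2 : (fun y => (c y).2) ≠ fun y => (d y).2 := fun h2 =>
      hne (funext fun y => Prod.ext (congrFun h y) (congrFun h2 y))
    obtain ⟨t, x, hx, hx'⟩ := hn _ _ h2
    exact ⟨t, x, hx.trans (by simp), fun e => hx' (congrArg Prod.snd e)⟩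
  · obtain ⟨t, x, hx, hx'⟩ := hm _ _
      (hp _ _ hpcd (fun y hy e => hy (congrArg Prod.fst e)) (Function.ne_iff.mp h)) h
    exact ⟨t, x, hx.trans (by simp), fun e => hx' (congrArg Prod.fst e)⟩

theorem PreExpansive.prodCA (hF : PreExpansive F) (hG : PosExpansive G) :
    PreExpansive (prodCA F G) :=
  exists_window_prodCA hF hG fun _ _ hs hu _ => hs.subset hu

theorem KExpansive.prodCA (hF : KExpansive 1 F) (hG : PosExpansive G) :
    KExpansive 1 (prodCA F G) := by
  obtain ⟨m, hm⟩ := exists_window_prodCA (p := fun s => s.ncard = 1)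
    (hF.imp fun m hm c d h _ => hm c d h) hG (fun s u hs hu hne => by
      obtain ⟨a, rfl⟩ := Set.ncard_eq_one.mp hs
      exact Set.ncard_eq_one.mpr ⟨a, hne.subset_singleton_iff.mp hu⟩)
  refine ⟨m, fun c d h => hm c d h ?_⟩
  rintro rfl
  simp at h

theorem PosExpansive.of_prodCA [Nonempty R] (h : PosExpansive (_root_.prodCA F G)) :
    PosExpansive F := by
  obtain ⟨m, hm⟩ := h
  inhabit R
  refine ⟨m, fun c d hne => ?_⟩
  simpa [iterate_prodCA] using hm (fun z => (c z, default)) (fun z => (d z, default))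
    fun e => hne (funext fun z => congrArg Prod.fst (congrFun e z))

theorem PreExpansive.of_prodCA [Nonempty R] (h : PreExpansive (_root_.prodCA F G)) :
    PreExpansive F := by
  obtain ⟨m, hm⟩ := h
  inhabit R
  refine ⟨m, fun c d hfin hne => ?_⟩
  simpa [iterate_prodCA] using hm (fun z => (c z, default)) (fun z => (d z, default))
    (by simpa using hfin) fun e => hne (funext fun z => congrArg Prod.fst (congrFun e z))

theorem injective_of_prodCA [Nonempty Q] (h : Function.Injective (prodCA F G)) :
    Function.Injective G := by
  inhabit Q
  intro c d hcd
  have : (fun z => ((default : Q), c z)) = fun z => (default, d z) :=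
    h (by unfold prodCA; simp only [hcd])
  exact funext fun z => congrArg Prod.snd (congrFun this z)

end prodCA

/-- there exist 1D cellular automata that are
(1) pre-expansive, bijective, not positively expansive;
(2) pre-expansive, not injective, not positively expansive;
(3) 1-expansive, bijective, not pre-expansive;
(4) 1-expansive, not injective, not pre-expansive. -/
theorem examples_separating_preexpansivity :
    (∃ (Q : Type) (_ : Fintype Q) (F : (ℤ → Q) → ℤ → Q), IsCA1D F ∧
      PreExpansive F ∧ Function.Bijective F ∧ ¬ PosExpansive F) ∧
    (∃ (Q : Type) (_ : Fintype Q) (F : (ℤ → Q) → ℤ → Q), IsCA1D F ∧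
      PreExpansive F ∧ ¬ Function.Injective F ∧ ¬ PosExpansive F) ∧
    (∃ (Q : Type) (_ : Fintype Q) (F : (ℤ → Q) → ℤ → Q), IsCA1D F ∧
      KExpansive 1 F ∧ Function.Bijective F ∧ ¬ PreExpansive F) ∧
    (∃ (Q : Type) (_ : Fintype Q) (F : (ℤ → Q) → ℤ → Q), IsCA1D F ∧
      KExpansive 1 F ∧ ¬ Function.Injective F ∧ ¬ PreExpansive F) := by
  refine ⟨⟨ZMod 2 × ZMod 2, inferInstance, secondOrderCA 1, isCA1D_secondOrderCA 1,
      preExpansive_secondOrderCA_one, bijective_secondOrderCA 1,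
      not_posExpansive_secondOrderCA_one⟩,
    ⟨(ZMod 2 × ZMod 2) × ZMod 2, inferInstance, prodCA (secondOrderCA 1) neighborSumCA,
      isCA1D_prodCA_secondOrderCA 1,
      preExpansive_secondOrderCA_one.prodCA posExpansive_neighborSumCA,
      fun h => not_injective_neighborSumCA (injective_of_prodCA h),
      fun h => not_posExpansive_secondOrderCA_one h.of_prodCA⟩,
    ⟨ZMod 2 × ZMod 2, inferInstance, secondOrderCA 0, isCA1D_secondOrderCA 0,
      kExpansive_one_secondOrderCA 0, bijective_secondOrderCA 0,
      not_preExpansive_secondOrderCA_zero⟩,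
    ⟨(ZMod 2 × ZMod 2) × ZMod 2, inferInstance, prodCA (secondOrderCA 0) neighborSumCA,
      isCA1D_prodCA_secondOrderCA 0,
      (kExpansive_one_secondOrderCA 0).prodCA posExpansive_neighborSumCA,
      fun h => not_injective_neighborSumCA (injective_of_prodCA h),
      fun h => not_preExpansive_secondOrderCA_zero h.of_prodCA⟩⟩
end

section
/- For every k ≥ 1 there exist a finite alphabet Q and a one-dimensional cellular automaton F on Q^ℤ such that F is not surjective but F is k'-expansive for every k' with 1 ≤ k' ≤ k. -/
open Finset

/-- The additive map `c ↦ c.1 + p · c.2`, where `p` is the sparse polynomial with exponents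
`2 ^ i` for `i < N`. -/
def syndrome (N : ℕ) : (ℤ → ZMod 2 × ZMod 2) →+ (ℤ → ZMod 2) where
  toFun c z := (c z).1 + ∑ i ∈ range N, (c (z + 2 ^ i)).2
  map_zero' := by ext; simp
  map_add' c d := by ext; simp only [Pi.add_apply, Prod.fst_add, Prod.snd_add, sum_add_distrib]; ring

/-- The additive cellular automaton summing the two neighbors of each cell. -/
def neighborSum (b : ℤ → ZMod 2) (z : ℤ) : ZMod 2 := b (z - 1) + b (z + 1)

/-- The additive cellular automaton writing the neighbor sum of the syndrome into the first track
and erasing the second track. -/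
def syndromeCA (N : ℕ) : (ℤ → ZMod 2 × ZMod 2) →+ (ℤ → ZMod 2 × ZMod 2) where
  toFun c z := (neighborSum (syndrome N c) z, 0)
  map_zero' := by ext <;> simp [neighborSum]
  map_add' c d := by
    ext z
    · simp only [neighborSum, map_add, Pi.add_apply, Prod.fst_add]; ring
    · simp

theorem syndromeCA_apply (N : ℕ) (c : ℤ → ZMod 2 × ZMod 2) (z : ℤ) :
    syndromeCA N c z = (neighborSum (syndrome N c) z, 0) := rfl

theorem syndrome_apply (N : ℕ) (c : ℤ → ZMod 2 × ZMod 2) (z : ℤ) :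
    syndrome N c z = (c z).1 + ∑ i ∈ range N, (c (z + 2 ^ i)).2 := rfl

theorem isCA1D_syndromeCA (N : ℕ) : IsCA1D (syndromeCA N) := by
  refine ⟨1, 1 + 2 ^ N, fun u => (u (Fin.ofNat _ 0) |>.1, 0) + (u (Fin.ofNat _ 2) |>.1, 0) +
    ∑ i ∈ range N, (((u (Fin.ofNat _ (2 ^ i))).2, 0) + ((u (Fin.ofNat _ (2 + 2 ^ i))).2, 0)), ?_⟩
  intro c z
  have hpos : 0 < 2 ^ N := by positivity
  have hval : ∀ j < 1 + (1 + 2 ^ N) + 1, (Fin.ofNat (1 + (1 + 2 ^ N) + 1) j).val = j :=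
    fun j hj => Nat.mod_eq_of_lt hj
  rw [syndromeCA_apply]
  ext
  · simp only [Prod.fst_add, Prod.fst_sum, neighborSum, syndrome_apply, sum_add_distrib]
    rw [hval 0 (by omega), hval 2 (by omega)]
    have h1 : ∑ i ∈ range N, (c (z - 1 + 2 ^ i)).2 = ∑ i ∈ range N,
        (c (z - ((1 : ℕ) : ℤ) + ((Fin.ofNat (1 + (1 + 2 ^ N) + 1) (2 ^ i)).val : ℤ))).2 := by
      refine sum_congr rfl fun i hi => ?_
      have : 2 ^ i < 2 ^ N := Nat.pow_lt_pow_right one_lt_two (mem_range.1 hi)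
      rw [hval _ (by omega)]
      push_cast; rfl
    have h2 : ∑ i ∈ range N, (c (z + 1 + 2 ^ i)).2 = ∑ i ∈ range N,
        (c (z - ((1 : ℕ) : ℤ) + ((Fin.ofNat (1 + (1 + 2 ^ N) + 1) (2 + 2 ^ i)).val : ℤ))).2 := by
      refine sum_congr rfl fun i hi => ?_
      have : 2 ^ i < 2 ^ N := Nat.pow_lt_pow_right one_lt_two (mem_range.1 hi)
      rw [hval _ (by omega)]
      push_cast
      congr 2
      ring
    rw [h1, h2]
    have e1 : z - ((1 : ℕ) : ℤ) + ((0 : ℕ) : ℤ) = z - 1 := by push_cast; ring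
    have e2 : z - ((1 : ℕ) : ℤ) + ((2 : ℕ) : ℤ) = z + 1 := by push_cast; ring
    rw [e1, e2]
    ring
  · simp [Prod.snd_sum]

theorem not_surjective_syndromeCA (N : ℕ) : ¬ Function.Surjective (syndromeCA N) := by
  intro h
  obtain ⟨c, hc⟩ := h fun _ => (0, 1)
  simpa [syndromeCA_apply] using congrArg Prod.snd (congrFun hc 0)

/-- Powers of two form a Sidon set. -/
theorem eq_of_two_pow_sub_two_pow_eq {i j i' j' : ℕ} (hij : i ≠ j)
    (h : (2 : ℤ) ^ j - 2 ^ i = 2 ^ j' - 2 ^ i') : i = i' := by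
  have lt_of_lt : ∀ {a b : ℕ}, a < b → (2 : ℤ) ^ a < 2 ^ b := fun hab =>
    pow_lt_pow_right₀ (by norm_num) hab
  have min_le : ∀ {a b c d : ℕ}, a < b → c < d → (2 : ℤ) ^ b - 2 ^ a = 2 ^ d - 2 ^ c → c ≤ a := by
    intro a b c d hab hcd habcd
    by_contra! hac
    have hdvd : (2 : ℤ) ^ (a + 1) ∣ 2 ^ a := by
      have : (2 : ℤ) ^ a = 2 ^ b + 2 ^ c - 2 ^ d := by linarith
      rw [this]
      exact dvd_sub (dvd_add (pow_dvd_pow _ hab) (pow_dvd_pow _ hac))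
        (pow_dvd_pow _ (hac.trans hcd))
    exact absurd (Int.le_of_dvd (by positivity) hdvd) (not_le.2 (lt_of_lt a.lt_succ_self))
  have lt_iff : ∀ {a b : ℕ}, (2 : ℤ) ^ a < 2 ^ b ↔ a < b :=
    pow_lt_pow_iff_right₀ (by norm_num)
  rcases hij.lt_or_gt with hlt | hlt
  · have hlt' : i' < j' := lt_iff.1 (by linarith [lt_of_lt hlt])
    exact le_antisymm (min_le hlt' hlt h.symm) (min_le hlt hlt' h)
  · have hlt' : j' < i' := lt_iff.1 (by linarith [lt_of_lt hlt])
    have hj : j = j' :=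
      le_antisymm (min_le hlt' hlt (by linarith)) (min_le hlt hlt' (by linarith))
    subst hj
    exact Nat.pow_right_injective le_rfl (by exact_mod_cast (by linarith : (2 : ℤ) ^ i = 2 ^ i'))

/-- Nonzero configurations of small support have nonzero syndrome. -/
theorem syndrome_ne_zero {N : ℕ} {e : ℤ → ZMod 2 × ZMod 2} {T : Finset ℤ}
    (hT : ∀ z, e z ≠ 0 → z ∈ T) (hcard : 2 * #T < N) (he : e ≠ 0) : syndrome N e ≠ 0 := by
  intro hzero
  have hz : ∀ z, (e z).1 + ∑ i ∈ range N, (e (z + 2 ^ i)).2 = 0 := fun z => congrFun hzero z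
  by_cases hsnd : ∀ z, (e z).2 = 0
  · refine he (funext fun z => Prod.ext ?_ (hsnd z))
    simpa [hsnd] using hz z
  push Not at hsnd
  obtain ⟨s, hs⟩ := hsnd
  have hcase : ∀ i ∈ range N, ∃ x ∈ T.disjSum T, x = Sum.inl (s - 2 ^ i) ∨
      ∃ j, i ≠ j ∧ x = Sum.inr (s - 2 ^ i + 2 ^ j) := by
    intro i hi
    by_cases hmem : s - 2 ^ i ∈ T
    · exact ⟨_, inl_mem_disjSum.2 hmem, Or.inl rfl⟩
    have hfst : (e (s - 2 ^ i)).1 = 0 := by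
      rw [not_not.1 (mt (hT _) hmem)]; rfl
    have hsum := hz (s - 2 ^ i)
    rw [hfst, zero_add] at hsum
    have : ∃ j ∈ range N, i ≠ j ∧ (e (s - 2 ^ i + 2 ^ j)).2 ≠ 0 := by
      by_contra! hcon
      rw [sum_eq_single_of_mem i hi fun j hj hji => hcon j hj hji.symm] at hsum
      exact hs (by simpa using hsum)
    obtain ⟨j, -, hij, hj⟩ := this
    exact ⟨_, inr_mem_disjSum.2 (hT _ fun h0 => hj (by rw [h0]; rfl)), Or.inr ⟨j, hij, rfl⟩⟩
  choose! φ hφT hφ using hcase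
  have hinj : Set.InjOn φ (range N) := by
    intro i hi i' hi' heq
    rcases hφ i hi with h | ⟨j, hij, h⟩ <;> rcases hφ i' hi' with h' | ⟨j', hij', h'⟩ <;>
      rw [h, h'] at heq
    · have := Sum.inl.inj heq
      exact Nat.pow_right_injective le_rfl (by exact_mod_cast (by linarith : (2 : ℤ) ^ i = 2 ^ i'))
    · exact absurd heq (by simp)
    · exact absurd heq (by simp)
    · have := Sum.inr.inj heq
      exact eq_of_two_pow_sub_two_pow_eq hij (j' := j') (by linarith)
  have := card_le_card_of_injOn φ hφT hinj
  rw [card_range, card_disjSum] at this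
  omega

/-- The trace of `neighborSum` on two adjacent cells determines the configuration. -/
theorem eq_zero_of_trace_eq_zero {b : ℤ → ZMod 2}
    (h : ∀ t, neighborSum^[t] b 0 = 0 ∧ neighborSum^[t] b 1 = 0) : b = 0 := by
  have hstep : ∀ t z, neighborSum^[t + 1] b z =
      neighborSum^[t] b (z - 1) + neighborSum^[t] b (z + 1) := fun t z => by
    rw [Function.iterate_succ_apply']; rfl
  have hz : ∀ z t, neighborSum^[t] b z = 0 ∧ neighborSum^[t] b (z + 1) = 0 := by
    intro z
    induction z using Int.induction_on with
    | zero => simpa using h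
    | succ n ih =>
      refine fun t => ⟨(ih t).2, ?_⟩
      have := hstep t (n + 1)
      rw [(ih (t + 1)).2, add_sub_cancel_right, (ih t).1, zero_add] at this
      exact this.symm
    | pred n ih =>
      refine fun t => ⟨?_, by simpa using (ih t).1⟩
      have := hstep t (-n)
      rw [(ih (t + 1)).1, (ih t).2, add_zero] at this
      exact this.symm
  exact funext fun z => (hz z 0).1

theorem eq_zero_of_neighborSum_eq_zero {b : ℤ → ZMod 2} {B : ℤ} (hB : ∀ z, B ≤ z → b z = 0)
    (h : neighborSum b = 0) : b = 0 := by
  have key : ∀ (n : ℕ) (z : ℤ), B - n ≤ z → b z = 0 := by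
    intro n
    induction n with
    | zero => simpa using hB
    | succ n ih =>
      intro z hz
      have := congrFun h (z + 1)
      rw [neighborSum, add_sub_cancel_right, ih (z + 1 + 1) (by push_cast at hz; linarith),
        add_zero] at this
      exact this
  exact funext fun z => key (B - z).toNat z (by omega)

theorem syndromeCA_iterate_succ (N t : ℕ) (c : ℤ → ZMod 2 × ZMod 2) (z : ℤ) :
    (syndromeCA N)^[t + 1] c z = (neighborSum^[t] (neighborSum (syndrome N c)) z, 0) := by
  have hsemi : Function.Semiconj (syndrome N) (syndromeCA N) neighborSum := fun c => by
    ext z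
    simp [syndrome_apply N (syndromeCA N c), syndromeCA_apply]
  rw [Function.iterate_succ_apply', syndromeCA_apply, (hsemi.iterate_right t).eq,
    ← Function.iterate_succ_apply' neighborSum, Function.iterate_succ_apply]

theorem kExpansive_syndromeCA {N k : ℕ} (hk : 1 ≤ k) (hN : 2 * k < N) :
    KExpansive k (syndromeCA N) := by
  refine ⟨1, fun c d hcd => ?_⟩
  have hfin : {z | c z ≠ d z}.Finite := Set.finite_of_ncard_pos (by omega)
  have hT : ∀ z, (c - d) z ≠ 0 → z ∈ hfin.toFinset := fun z hz => by
    simpa [sub_eq_zero] using hz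
  have hcard : #hfin.toFinset = k := by rw [← Set.ncard_eq_toFinset_card _ hfin, hcd]
  have hne : c - d ≠ 0 := by
    intro h0
    rw [sub_eq_zero.1 h0] at hcd
    simp at hcd
    omega
  by_contra! hcon
  refine syndrome_ne_zero (N := N) hT (by omega) hne ?_
  obtain ⟨B, hB⟩ := hfin.toFinset.bddAbove
  refine eq_zero_of_neighborSum_eq_zero (B := B + 1) (fun z hz => ?_)
    (eq_zero_of_trace_eq_zero fun t => ?_)
  · have hvanish : ∀ y, z ≤ y → (c - d) y = 0 := fun y hy => by
      by_contra hy0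
      have := hB (hT y hy0)
      omega
    rw [syndrome_apply, hvanish z le_rfl, sum_eq_zero fun i _ => ?_]
    · rfl
    · rw [hvanish _ (le_add_of_nonneg_right (by positivity))]; rfl
  · have hx : ∀ x : ℤ, |x| ≤ 1 → neighborSum^[t] (neighborSum (syndrome N (c - d))) x = 0 := by
      intro x hx
      have := syndromeCA_iterate_succ N t (c - d) x
      rw [iterate_map_sub, Pi.sub_apply, hcon (t + 1) x (by simpa using hx), sub_self] at this
      exact (congrArg Prod.fst this).symm
    exact ⟨hx 0 (by simp), hx 1 (by simp)⟩

/-- for every `k ≥ 1` there is a non-surjective 1D cellular automaton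
which is `k'`-expansive for every `1 ≤ k' ≤ k`. -/
theorem exists_nonsurjective_k_expansive (k : ℕ) (hk : 1 ≤ k) :
    ∃ (Q : Type) (_ : Fintype Q) (F : (ℤ → Q) → ℤ → Q), IsCA1D F ∧
      ¬ Function.Surjective F ∧
      ∀ k' : ℕ, 1 ≤ k' → k' ≤ k → KExpansive k' F :=
  ⟨ZMod 2 × ZMod 2, inferInstance, syndromeCA (2 * k + 1), isCA1D_syndromeCA _,
    not_surjective_syndromeCA _, fun _ hk' hle => kExpansive_syndromeCA hk' (by omega)⟩
end

section
/- Let F be a one-dimensional cellular automaton on Q^ℤ with neighborhood [-l,r] and let k ≥ 1. (1) If F is k-expansive, then for every pair c ≠_k d both the left propagation and the right propagation of (c,d) under F are unbounded. (2) Conversely, if for every k' with 1 ≤ k' ≤ k and every pair c ≠_{k'} d both the left and right propagations of (c,d) under F are unbounded, then F is k-expansive with constant 2^{-max(l,r)}. -/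
/-- The left propagation of the pair `(c, d)` under `F` is unbounded. -/
def LeftUnbounded {Q : Type*} (F : (ℤ → Q) → ℤ → Q) (c d : ℤ → Q) : Prop :=
  ∀ n : ℤ, ∃ t : ℕ, ∃ z : ℤ, z ≤ n ∧ F^[t] c z ≠ F^[t] d z

/-- The right propagation of the pair `(c, d)` under `F` is unbounded. -/
def RightUnbounded {Q : Type*} (F : (ℤ → Q) → ℤ → Q) (c d : ℤ → Q) : Prop :=
  ∀ n : ℤ, ∃ t : ℕ, ∃ z : ℤ, n ≤ z ∧ F^[t] c z ≠ F^[t] d z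

/-- Iterates of a cellular automaton commute with shifts. -/
theorem iterate_shift_of_local_rule {Q : Type*} (l r : ℕ)
    (f : (Fin (l + r + 1) → Q) → Q) (F : (ℤ → Q) → ℤ → Q)
    (hF : ∀ c z, F c z = f fun i => c (z - (l : ℤ) + (i.val : ℤ)))
    (s : ℤ) (t : ℕ) (c : ℤ → Q) (z : ℤ) :
    F^[t] (fun y => c (y + s)) z = F^[t] c (z + s) := by
  induction t generalizing z with
  | zero => rfl
  | succ t ih =>
    simp only [Function.iterate_succ_apply', hF, ih]
    exact congrArg f (funext fun i => congrArg (F^[t] c) (by ring))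

/-- Shifting a pair of configurations preserves the number of positions where they differ. -/
theorem ncard_ne_shift {Q : Type*} (s : ℤ) (c d : ℤ → Q) :
    {z | c (z + s) ≠ d (z + s)}.ncard = {z | c z ≠ d z}.ncard :=
  Set.ncard_preimage_of_injective_subset_range (f := fun z : ℤ => z + s)
    (s := {z | c z ≠ d z}) (add_left_injective s)
    (fun z _ => ⟨z - s, by simp⟩)

/-- If the orbits of `c` and `d` agree on `[-M, M]` with `l, r ≤ M`, the orbit of the
configuration glued from `c` on the negative and `d` on the nonnegative positions is glued
from their orbits. -/
theorem iterate_glue {Q : Type*} (l r : ℕ)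
    (f : (Fin (l + r + 1) → Q) → Q) (F : (ℤ → Q) → ℤ → Q)
    (hF : ∀ c z, F c z = f fun i => c (z - (l : ℤ) + (i.val : ℤ)))
    (M : ℤ) (hl : (l : ℤ) ≤ M) (hr : (r : ℤ) ≤ M) (c d : ℤ → Q)
    (h : ∀ (t : ℕ) (x : ℤ), |x| ≤ M → F^[t] c x = F^[t] d x) (t : ℕ) (z : ℤ) :
    (z ≤ M → F^[t] (fun y => if y < 0 then c y else d y) z = F^[t] c z) ∧
    (-M ≤ z → F^[t] (fun y => if y < 0 then c y else d y) z = F^[t] d z) := by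
  suffices hs : (z ≤ 0 → F^[t] (fun y => if y < 0 then c y else d y) z = F^[t] c z) ∧
      (0 ≤ z → F^[t] (fun y => if y < 0 then c y else d y) z = F^[t] d z) by
    rcases le_total z 0 with hz | hz
    · exact ⟨fun _ => hs.1 hz, fun hm => (hs.1 hz).trans (h t z (abs_le.2 ⟨hm, by omega⟩))⟩
    · exact ⟨fun hm => (hs.2 hz).trans (h t z (abs_le.2 ⟨by omega, hm⟩)).symm,
        fun _ => hs.2 hz⟩
  induction t generalizing z with
  | zero =>
    refine ⟨fun hz => ?_, fun hz => if_neg (by omega)⟩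
    rcases hz.lt_or_eq with hz | rfl
    · exact if_pos hz
    · exact (h 0 0 (by simp; omega)).symm
  | succ t ih =>
    simp only [Function.iterate_succ_apply', hF] at ih ⊢
    refine ⟨fun hz => ?_, fun hz => ?_⟩ <;> congr 1 <;> funext i <;> have hi := i.isLt
    · rcases le_total (z - (l : ℤ) + (i.val : ℤ)) 0 with hy | hy
      · exact (ih _).1 hy
      · exact ((ih _).2 hy).trans (h t _ (abs_le.2 ⟨by omega, by omega⟩)).symm
    · rcases le_total (z - (l : ℤ) + (i.val : ℤ)) 0 with hy | hy
      · exact ((ih _).1 hy).trans (h t _ (abs_le.2 ⟨by omega, by omega⟩))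
      · exact (ih _).2 hy

/-- for a 1D CA with neighborhood `[-l, r]` and `k ≥ 1`:
(1) if `F` is `k`-expansive then for every pair `c ≠_k d` both propagations are unbounded;
(2) if for every `1 ≤ k' ≤ k` and every pair `c ≠_{k'} d` both propagations are unbounded,
then `F` is `k`-expansive with constant `2^{-max(l,r)}`. -/
theorem k_expansive_iff_propagation {Q : Type*} [Fintype Q] (l r : ℕ)
    (f : (Fin (l + r + 1) → Q) → Q) (F : (ℤ → Q) → ℤ → Q)
    (hF : ∀ c z, F c z = f fun i => c (z - (l : ℤ) + (i.val : ℤ)))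
    (k : ℕ) (hk : 1 ≤ k) :
    ((∃ m : ℕ, ∀ c d : ℤ → Q, {z | c z ≠ d z}.ncard = k →
        ∃ t : ℕ, ∃ x : ℤ, |x| ≤ (m : ℤ) ∧ F^[t] c x ≠ F^[t] d x) →
      ∀ c d : ℤ → Q, {z | c z ≠ d z}.ncard = k →
        LeftUnbounded F c d ∧ RightUnbounded F c d) ∧
    ((∀ k' : ℕ, 1 ≤ k' → k' ≤ k → ∀ c d : ℤ → Q, {z | c z ≠ d z}.ncard = k' →
        LeftUnbounded F c d ∧ RightUnbounded F c d) →
      ∀ c d : ℤ → Q, {z | c z ≠ d z}.ncard = k →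
        ∃ t : ℕ, ∃ x : ℤ, |x| ≤ ((max l r : ℕ) : ℤ) ∧ F^[t] c x ≠ F^[t] d x) := by
  constructor
  · rintro ⟨m, hm⟩ c d hcd
    have key : ∀ s : ℤ, ∃ t : ℕ, ∃ x : ℤ, |x| ≤ (m : ℤ) ∧
        F^[t] c (x + s) ≠ F^[t] d (x + s) := fun s => by
      obtain ⟨t, x, hx, hne⟩ :=
        hm (fun y => c (y + s)) (fun y => d (y + s)) ((ncard_ne_shift s c d).trans hcd)
      simp only [iterate_shift_of_local_rule l r f F hF] at hne
      exact ⟨t, x, hx, hne⟩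
    refine ⟨fun n => ?_, fun n => ?_⟩
    · obtain ⟨t, x, hx, hne⟩ := key (n - m)
      exact ⟨t, _, by linarith [(abs_le.1 hx).2], hne⟩
    · obtain ⟨t, x, hx, hne⟩ := key (n + m)
      exact ⟨t, _, by linarith [(abs_le.1 hx).1], hne⟩
  · intro H c d hcd
    by_contra! hcon
    have glue := iterate_glue l r f F hF ((max l r : ℕ) : ℤ) (by simp) (by simp) c d hcon
    set e : ℤ → Q := fun y => if y < 0 then c y else d y
    have hfin : {z | c z ≠ d z}.Finite := Set.finite_of_ncard_pos (by omega)
    have hprop : ∀ a b : ℤ → Q, {z | a z ≠ b z} ⊆ {z | c z ≠ d z} → a ≠ b →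
        LeftUnbounded F a b ∧ RightUnbounded F a b := fun a b hsub hab =>
      H _ ((Set.ncard_pos (hfin.subset hsub)).2 (Function.ne_iff.1 hab))
        (hcd ▸ Set.ncard_le_ncard hsub hfin) a b rfl
    by_cases hed : e = d
    · have hec : e ≠ c := by
        intro hec
        simp [← hec, hed] at hcd
        omega
      obtain ⟨t, z, hz, hne⟩ := (hprop e c (fun z hz => by
        rw [hed] at hz; exact Ne.symm hz) hec).1 ((max l r : ℕ) : ℤ)
      exact hne ((glue t z).1 hz)
    · obtain ⟨t, z, hz, hne⟩ := (hprop e d (fun z hz => by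
        by_cases h0 : z < 0 <;> simp_all [e]) hed).2 (-((max l r : ℕ) : ℤ))
      exact hne ((glue t z).2 hz)
end

section
/- A one-dimensional cellular automaton F on Q^ℤ is pre-expansive if and only if for every asymptotic pair c ≠ d both the left propagation and the right propagation of (c,d) under F are unbounded. -/
theorem IsCA1D.iterate_comp_add {Q : Type*} {F : (ℤ → Q) → ℤ → Q} (hF : IsCA1D F)
    (k : ℤ) (t : ℕ) (c : ℤ → Q) (z : ℤ) :
    F^[t] (fun x => c (x + k)) z = F^[t] c (z + k) := by
  obtain ⟨l, r, f, hf⟩ := hF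
  induction t generalizing z with
  | zero => rfl
  | succ t ih =>
    simp only [Function.iterate_succ_apply', hf, ih]
    refine congrArg f (funext fun i => congrArg (F^[t] c) ?_)
    ring

/-- If two orbits agree forever on a window wider than the neighborhood, then gluing the left half
of one to the right half of the other commutes with the dynamics. -/
theorem exists_window_iterate_glue {Q : Type*} {F : (ℤ → Q) → ℤ → Q} (hF : IsCA1D F) :
    ∃ m : ℕ, ∀ c d : ℤ → Q,
      (∀ (t : ℕ) (x : ℤ), |x| ≤ (m : ℤ) → F^[t] c x = F^[t] d x) →
      ∀ t : ℕ, F^[t] (fun z => if z ≤ 0 then d z else c z) =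
        fun z => if z ≤ 0 then F^[t] d z else F^[t] c z := by
  obtain ⟨l, r, f, hf⟩ := hF
  refine ⟨l + r, fun c d h t => ?_⟩
  induction t with
  | zero => rfl
  | succ t ih =>
    funext z
    simp only [Function.iterate_succ_apply', ih]
    split_ifs with hz <;> rw [hf, hf] <;> congr 1 <;> funext i <;>
      have hi := i.isLt <;> split_ifs with hy
    · rfl
    · exact h t _ (abs_le.2 (by push_cast; omega))
    · exact (h t _ (abs_le.2 (by push_cast; omega))).symm
    · rfl

theorem PreExpansive.exists_iterate_ne_near {Q : Type*} {F : (ℤ → Q) → ℤ → Q}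
    (hF : IsCA1D F) (hpre : PreExpansive F) :
    ∃ m : ℕ, ∀ c d : ℤ → Q, {z | c z ≠ d z}.Finite → c ≠ d →
      ∀ k : ℤ, ∃ t : ℕ, ∃ z : ℤ, |z - k| ≤ (m : ℤ) ∧ F^[t] c z ≠ F^[t] d z := by
  obtain ⟨m, hm⟩ := hpre
  refine ⟨m, fun c d hfin hne k => ?_⟩
  obtain ⟨t, x, hx, hdiff⟩ := hm (fun x => c (x + k)) (fun x => d (x + k))
    (hfin.preimage (add_left_injective k).injOn)
    (fun h => hne (funext fun z => by simpa using congrFun h (z - k)))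
  rw [hF.iterate_comp_add, hF.iterate_comp_add] at hdiff
  exact ⟨t, x + k, by simpa using hx, hdiff⟩

/-- a 1D CA is pre-expansive iff for every asymptotic pair of distinct
configurations both the left and the right propagations are unbounded. -/
theorem preexpansive_iff_propagation {Q : Type*} [Fintype Q]
    (F : (ℤ → Q) → ℤ → Q) (hCA : IsCA1D F) :
    PreExpansive F ↔
      ∀ c d : ℤ → Q, {z | c z ≠ d z}.Finite → c ≠ d →
        LeftUnbounded F c d ∧ RightUnbounded F c d := by
  constructor
  · intro hpre c d hfin hne
    obtain ⟨m, hm⟩ := hpre.exists_iterate_ne_near hCA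
    constructor
    · intro n
      obtain ⟨t, z, hz, hdiff⟩ := hm c d hfin hne (n - m)
      exact ⟨t, z, by linarith [(abs_le.1 hz).2], hdiff⟩
    · intro n
      obtain ⟨t, z, hz, hdiff⟩ := hm c d hfin hne (n + m)
      exact ⟨t, z, by linarith [(abs_le.1 hz).1], hdiff⟩
  · intro h
    obtain ⟨m, hm⟩ := exists_window_iterate_glue hCA
    refine ⟨m, fun c d hfin hne => ?_⟩
    by_contra! hagree
    have hglue := hm c d hagree
    by_cases hcg : c = fun z => if z ≤ 0 then d z else c z
    · obtain ⟨t, z, hz, hdiff⟩ := (h c d hfin hne).1 0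
      have := congrFun (hglue t) z
      rw [← hcg, if_pos hz] at this
      exact hdiff this
    · have hfin' : {z | c z ≠ if z ≤ 0 then d z else c z}.Finite :=
        hfin.subset fun z hz hcd => hz (by simp [hcd])
      obtain ⟨t, z, hz, hdiff⟩ := (h c _ hfin' hcg).2 1
      rw [hglue t] at hdiff
      exact hdiff (if_neg (by omega)).symm
end

section
/- Let Q be a finite set with at least two elements and let F be a one-dimensional cellular automaton on Q^ℤ that is pre-expansive in some direction α ∈ ℝ. Then: (1) F is sensitive to initial conditions in every direction β ∈ ℝ; (2) if moreover F is pre-expansive in some direction α' > α, then F is pre-expansive in every direction β with α ≤ β ≤ α'. -/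
/-- Pre-expansivity in direction `α`. -/
def PreExpansiveDir {Q : Type*} (F : (ℤ → Q) → ℤ → Q) (α : ℝ) : Prop :=
  ∃ m : ℕ, ∀ c d : ℤ → Q, {z | c z ≠ d z}.Finite → c ≠ d →
    ∃ t : ℕ, ∃ x : ℤ, |x| ≤ (m : ℤ) ∧
      F^[t] c (⌈α * t⌉ + x) ≠ F^[t] d (⌈α * t⌉ + x)

/-- Sensitivity to initial conditions in direction `β`. -/
def SensitiveDir {Q : Type*} (F : (ℤ → Q) → ℤ → Q) (β : ℝ) : Prop :=
  ∃ m : ℕ, ∀ c : ℤ → Q, ∀ n : ℕ, ∃ d : ℤ → Q,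
    (∀ z : ℤ, |z| ≤ (n : ℤ) → d z = c z) ∧
    ∃ t : ℕ, ∃ x : ℤ, |x| ≤ (m : ℤ) ∧
      F^[t] c (⌈β * t⌉ + x) ≠ F^[t] d (⌈β * t⌉ + x)

section CellularAutomata

variable {Q : Type*} {F : (ℤ → Q) → ℤ → Q}

/-- The value of a cellular automaton at a cell depends only on a bounded window. -/
theorem IsCA1D.exists_radius (hF : IsCA1D F) :
    ∃ R : ℕ, ∀ (c d : ℤ → Q) (z : ℤ), (∀ y, z - R ≤ y → y ≤ z + R → c y = d y) →
      F c z = F d z := by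
  obtain ⟨l, r, f, hf⟩ := hF
  refine ⟨l + r, fun c d z h => ?_⟩
  rw [hf, hf]
  congr 1
  funext i
  have := i.isLt
  exact h _ (by push_cast; omega) (by push_cast; omega)

theorem IsCA1D.iterate_shift (hF : IsCA1D F) (k : ℤ) (t : ℕ) (c : ℤ → Q) :
    F^[t] (fun z => c (z + k)) = fun z => F^[t] c (z + k) := by
  have hshift : ∀ c : ℤ → Q, F (fun z => c (z + k)) = fun z => F c (z + k) := by
    obtain ⟨l, r, f, hf⟩ := hF
    intro c
    funext z
    rw [hf, hf]
    congr 1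
    funext i
    congr 1
    ring
  induction t with
  | zero => rfl
  | succ t ih => rw [Function.iterate_succ_apply', ih, hshift, Function.iterate_succ_apply']

/-- Under pre-expansivity, the observation strip may be translated arbitrarily far: some width
works for every translate. -/
theorem PreExpansiveDir.exists_translate (hF : IsCA1D F) {α : ℝ} (hα : PreExpansiveDir F α) :
    ∃ m : ℕ, ∀ (k : ℤ) (c d : ℤ → Q), {z | c z ≠ d z}.Finite → c ≠ d →
      ∃ t : ℕ, ∃ x : ℤ, |x| ≤ (m : ℤ) ∧
        F^[t] c (⌈α * t⌉ + x + k) ≠ F^[t] d (⌈α * t⌉ + x + k) := by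
  obtain ⟨m, hm⟩ := hα
  refine ⟨m, fun k c d hfin hne => ?_⟩
  have := hm (fun z => c (z + k)) (fun z => d (z + k))
    (hfin.preimage (f := fun z => z + k) (add_left_injective k).injOn)
    (fun h => hne (funext fun z => by simpa using congrFun h (z - k)))
  simpa only [hF.iterate_shift] using this

/-- Asymptotic configurations whose differences stay to the left of a strip in direction
`β ≤ α` are equal, if `F` is pre-expansive in direction `α`. -/
theorem PreExpansiveDir.eq_of_eq_right (hF : IsCA1D F) {α β : ℝ} (hα : PreExpansiveDir F α)
    (hβ : β ≤ α) {c d : ℤ → Q} (hfin : {z | c z ≠ d z}.Finite)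
    (h : ∀ (t : ℕ) (z : ℤ), ⌈β * t⌉ ≤ z → F^[t] c z = F^[t] d z) : c = d := by
  obtain ⟨m, hm⟩ := hα.exists_translate hF
  by_contra hne
  obtain ⟨t, x, hx, hdiff⟩ := hm m c d hfin hne
  have hle : ⌈β * t⌉ ≤ ⌈α * t⌉ := Int.ceil_le_ceil (by gcongr)
  exact hdiff (h t _ (by have := abs_le.mp hx; omega))

/-- Asymptotic configurations whose differences stay to the right of a strip in direction
`β ≥ α` are equal, if `F` is pre-expansive in direction `α`. -/
theorem PreExpansiveDir.eq_of_eq_left (hF : IsCA1D F) {α β : ℝ} (hα : PreExpansiveDir F α)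
    (hβ : α ≤ β) {c d : ℤ → Q} (hfin : {z | c z ≠ d z}.Finite)
    (h : ∀ (t : ℕ) (z : ℤ), z ≤ ⌈β * t⌉ → F^[t] c z = F^[t] d z) : c = d := by
  obtain ⟨m, hm⟩ := hα.exists_translate hF
  by_contra hne
  obtain ⟨t, x, hx, hdiff⟩ := hm (-m) c d hfin hne
  have hle : ⌈α * t⌉ ≤ ⌈β * t⌉ := Int.ceil_le_ceil (by gcongr)
  exact hdiff (h t _ (by have := abs_le.mp hx; omega))

/-- A sufficiently wide strip on which two orbits agree is a barrier: a configuration glued from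
the left part of `c` and the right part of `d` evolves like `c` on the left of the strip and like
`d` on its right. -/
theorem IsCA1D.exists_barrier (hF : IsCA1D F) (β : ℝ) :
    ∃ M : ℕ, ∀ c d e : ℤ → Q,
      (∀ (t : ℕ) (x : ℤ), |x| ≤ (M : ℤ) → F^[t] c (⌈β * t⌉ + x) = F^[t] d (⌈β * t⌉ + x)) →
      (∀ z ≤ (M : ℤ), e z = c z) → (∀ z ≥ -(M : ℤ), e z = d z) →
      ∀ t : ℕ, (∀ z ≤ ⌈β * t⌉ + M, F^[t] e z = F^[t] c z) ∧
        ∀ z ≥ ⌈β * t⌉ - M, F^[t] e z = F^[t] d z := by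
  obtain ⟨R, hR⟩ := hF.exists_radius
  obtain ⟨B, hB⟩ := exists_nat_ge |β|
  refine ⟨R + B + 1, fun c d e hstrip hc hd t => ?_⟩
  induction t with
  | zero => exact ⟨fun z hz => hc z (by simpa using hz), fun z hz => hd z (by simpa using hz)⟩
  | succ t ih =>
    obtain ⟨ihc, ihd⟩ := ih
    have hβ := abs_le.mp hB
    have h₁ : ⌈β * (t + 1 : ℕ)⌉ ≤ ⌈β * t⌉ + B := by
      rw [← Int.ceil_add_natCast]
      exact Int.ceil_le_ceil (by push_cast; linarith)
    have h₂ : ⌈β * t⌉ ≤ ⌈β * (t + 1 : ℕ)⌉ + B := by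
      rw [← Int.ceil_add_natCast]
      exact Int.ceil_le_ceil (by push_cast; linarith)
    have hs : ∀ z, ⌈β * (t + 1 : ℕ)⌉ - (R + B + 1 : ℕ) ≤ z →
        z ≤ ⌈β * (t + 1 : ℕ)⌉ + (R + B + 1 : ℕ) → F^[t + 1] c z = F^[t + 1] d z := by
      intro z hz hz'
      have := hstrip (t + 1) (z - ⌈β * (t + 1 : ℕ)⌉) (abs_le.mpr ⟨by omega, by omega⟩)
      simpa using this
    simp only [Function.iterate_succ_apply'] at hs ⊢
    constructor
    · intro z hz
      by_cases hzR : z + R ≤ ⌈β * t⌉ + (R + B + 1 : ℕ)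
      · exact hR _ _ _ fun y _ hy => ihc y (hy.trans hzR)
      · rw [hs z (by push_cast at *; omega) hz]
        exact hR _ _ _ fun y hy _ => ihd y (by push_cast at *; omega)
    · intro z hz
      by_cases hzR : ⌈β * t⌉ - (R + B + 1 : ℕ) ≤ z - R
      · exact hR _ _ _ fun y hy _ => ihd y (hzR.trans hy)
      · rw [← hs z hz (by push_cast at *; omega)]
        exact hR _ _ _ fun y _ hy => ihc y (by push_cast at *; omega)

theorem PreExpansiveDir.sensitiveDir [Nontrivial Q] (hF : IsCA1D F) {α : ℝ}
    (hα : PreExpansiveDir F α) (β : ℝ) : SensitiveDir F β := by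
  obtain ⟨M, hM⟩ := hF.exists_barrier β
  refine ⟨M, fun c n => ?_⟩
  by_contra! hblock
  have hmod : ∀ k : ℤ, ∃ e : ℤ → Q, e k ≠ c k ∧ ∀ z, z ≠ k → e z = c z := by
    intro k
    obtain ⟨q, hq⟩ := exists_ne (c k)
    exact ⟨Function.update c k q, by simpa using hq, fun z hz => by simp [hz]⟩
  have hasymp : ∀ (k : ℤ) (e : ℤ → Q), (∀ z, z ≠ k → e z = c z) → {z | e z ≠ c z}.Finite :=
    fun k e he => (Set.finite_singleton k).subset fun z hz => by
      by_contra hne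
      exact hz (he z hne)
  rcases le_total β α with hβ | hβ
  · obtain ⟨e, hek, he⟩ := hmod (-(n + M + 1))
    refine hek (congrFun (hα.eq_of_eq_right hF hβ (hasymp _ e he) fun t z hz => ?_) _)
    refine (hM e c e (fun t x hx => (hblock e (fun z hz => he z ?_) t x hx).symm)
      (fun _ _ => rfl) (fun z hz => he z (by omega)) t).2 z (by omega)
    have := abs_le.mp hz
    omega
  · obtain ⟨e, hek, he⟩ := hmod (n + M + 1)
    refine hek (congrFun (hα.eq_of_eq_left hF hβ (hasymp _ e he) fun t z hz => ?_) _)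
    refine (hM c e e (fun t x hx => hblock e (fun z hz => he z ?_) t x hx)
      (fun z hz => he z (by omega)) (fun _ _ => rfl) t).1 z (by omega)
    have := abs_le.mp hz
    omega

theorem PreExpansiveDir.between (hF : IsCA1D F) {α α' β : ℝ} (hα : PreExpansiveDir F α)
    (hα' : PreExpansiveDir F α') (hβ : α ≤ β) (hβ' : β ≤ α') : PreExpansiveDir F β := by
  obtain ⟨M, hM⟩ := hF.exists_barrier β
  refine ⟨M, fun c d hfin hne => ?_⟩
  by_contra! hstrip
  have hcd : ∀ z, |z| ≤ (M : ℤ) → c z = d z := fun z hz => by simpa using hstrip 0 z hz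
  set e : ℤ → Q := fun z => if z ≤ 0 then c z else d z with he
  have hglue := hM c d e hstrip
    (fun z hz => by
      by_cases h : z ≤ 0
      · simp [he, h]
      · simpa [he, h] using (hcd z (abs_le.mpr ⟨by omega, hz⟩)).symm)
    (fun z hz => by
      by_cases h : z ≤ 0
      · simpa [he, h] using hcd z (abs_le.mpr ⟨hz, by omega⟩)
      · simp [he, h])
  have hec : e = c := by
    refine hα.eq_of_eq_left hF hβ (hfin.subset fun z hz hzc => hz ?_)
      fun t z hz => (hglue t).1 z (by omega)
    simp [he, hzc]
  have hed : e = d := by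
    refine hα'.eq_of_eq_right hF hβ' (hfin.subset fun z hz hzc => hz ?_)
      fun t z hz => (hglue t).2 z (by omega)
    simp [he, hzc]
  exact hne (hec.symm.trans hed)

end CellularAutomata

/-- if a 1D CA over an alphabet with at least two letters is pre-expansive
in some direction `α`, then (1) it is sensitive in every direction, and (2) if it is also
pre-expansive in some direction `α' > α` then it is pre-expansive in every direction
`β ∈ [α, α']`. -/
theorem directional_preexpansivity {Q : Type} [Fintype Q] (hQ : 1 < Fintype.card Q)
    (F : (ℤ → Q) → ℤ → Q) (hCA : IsCA1D F)
    (α : ℝ) (hα : PreExpansiveDir F α) :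
    (∀ β : ℝ, SensitiveDir F β) ∧
    (∀ α' : ℝ, α < α' → PreExpansiveDir F α' →
      ∀ β : ℝ, α ≤ β → β ≤ α' → PreExpansiveDir F β) := by
  have : Nontrivial Q := Fintype.one_lt_card_iff_nontrivial.mp hQ
  exact ⟨hα.sensitiveDir hCA, fun α' _ hα' β hβ hβ' => hα.between hCA hα' hβ hβ'⟩
end

section
/- Let n ≥ 2 and let F be a one-dimensional cellular automaton on (ℤ/nℤ)^ℤ that is linear, i.e. F(c ⊞ d) = F(c) ⊞ F(d) for all configurations c, d, where ⊞ is pointwise addition modulo n. Then F is 1-expansive if and only if F is positively expansive. -/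
/-- Modulo a prime `q`, an element of `ZMod n` either annihilates the `q`-torsion of `ZMod n`
or acts injectively on it. -/
theorem ZMod.mul_torsion_eq_zero_or_injective {n : ℕ} [NeZero n] {q : ℕ} (hq : q.Prime)
    (a : ZMod n) :
    (∀ y : ZMod n, (q : ZMod n) * y = 0 → a * y = 0) ∨
      (∀ y : ZMod n, (q : ZMod n) * y = 0 → a * y = 0 → y = 0) := by
  rw [← ZMod.natCast_zmod_val a]
  by_cases h : q ∣ a.val
  · left
    obtain ⟨k, hk⟩ := h
    intro y hy
    rw [hk, Nat.cast_mul, mul_right_comm, hy, zero_mul]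
  · right
    intro y hy hay
    obtain ⟨u, v, huv⟩ := Nat.isCoprime_iff_coprime.2 ((Nat.Prime.coprime_iff_not_dvd hq).2 h)
    have huv' := congrArg (Int.cast : ℤ → ZMod n) huv
    push_cast at huv'
    linear_combination u * hy + v * hay - y * huv'

/-- An additive one-dimensional cellular automaton over `ZMod n` is a linear combination of
shifts. -/
theorem IsCA1D.exists_eq_sum {n : ℕ} {F : (ℤ → ZMod n) → ℤ → ZMod n} (hCA : IsCA1D F)
    (hlin : ∀ c d : ℤ → ZMod n, F (c + d) = F c + F d) :
    ∃ (k : ℕ) (o : Fin k → ℤ) (w : Fin k → ZMod n), Function.Injective o ∧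
      ∀ c z, F c z = ∑ i, w i * c (z + o i) := by
  obtain ⟨l, r, f, hf⟩ := hCA
  let ext : (Fin (l + r + 1) → ZMod n) → ℤ → ZMod n :=
    fun u k => u (Fin.ofNat (l + r + 1) (k + l).toNat)
  have hext : ∀ u, F (ext u) 0 = f u := by
    intro u
    rw [hf]
    congr 1
    funext i
    simp [ext]
  have hadd : ∀ u v, f (u + v) = f u + f v := by
    intro u v
    rw [← hext, ← hext, ← hext, ← Pi.add_apply, ← hlin]
    rfl
  let g := (AddMonoidHom.mk' f hadd).toZModLinearMap n
  refine ⟨l + r + 1, fun i => (i.val : ℤ) - l, fun i => f (Pi.single i 1), ?_, ?_⟩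
  · intro i j hij
    apply Fin.ext
    simp only at hij
    omega
  · intro c z
    rw [hf]
    have h := LinearMap.pi_apply_eq_sum_univ g (fun i => c (z - (l : ℤ) + (i.val : ℤ)))
    refine h.trans (Finset.sum_congr rfl fun i _ => ?_)
    rw [smul_eq_mul, mul_comm]
    congr 2
    · change f _ = f _
      congr 1
      funext j
      simp [Pi.single_apply, eq_comm]
    · ring

section ShiftSums

variable {R : Type*} [CommRing R] {k : ℕ} {o : Fin k → ℤ} {w : Fin k → R}
  {F : (ℤ → R) → ℤ → R}

theorem torsion_of_eq_sum (hF : ∀ c z, F c z = ∑ i, w i * c (z + o i)) {q : R} {c : ℤ → R}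
    (hc : ∀ z, q * c z = 0) (z : ℤ) : q * F c z = 0 := by
  rw [hF, Finset.mul_sum]
  exact Finset.sum_eq_zero fun i _ => by rw [mul_left_comm, hc, mul_zero]

/-- If every coefficient on one side annihilates `q`-torsion, then zeros of a `q`-torsion
configuration on that side of a position persist. -/
theorem iterate_eq_zero_of_kills (hF : ∀ c z, F c z = ∑ i, w i * c (z + o i)) {q : R} {ε : ℤ}
    (hkill : ∀ i, 0 < ε * o i → ∀ y, q * y = 0 → w i * y = 0) {B : ℤ} (t : ℕ) :
    ∀ c : ℤ → R, (∀ z, q * c z = 0) → (∀ z, ε * z < B → c z = 0) →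
      ∀ z, ε * z < B → F^[t] c z = 0 := by
  induction t with
  | zero => exact fun c _ h => h
  | succ t ih =>
    intro c hc hz
    refine ih (F c) (torsion_of_eq_sum hF hc) fun z hzB => ?_
    rw [hF]
    refine Finset.sum_eq_zero fun i _ => ?_
    by_cases hi : 0 < ε * o i
    · exact hkill i hi _ (hc _)
    · rw [hz _ (by rw [mul_add]; omega), mul_zero]

/-- If the outermost coefficient on one side that does not annihilate `q`-torsion acts
injectively on it, then a `q`-torsion configuration whose orbit vanishes on a large window
vanishes on that side. -/
theorem eq_zero_of_orbit_eq_zero (ho : Function.Injective o)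
    (hF : ∀ c z, F c z = ∑ i, w i * c (z + o i)) {q : R} {ε : ℤ} (hε : ε = 1 ∨ ε = -1)
    {M : ℕ} (hM : ∀ i, |o i| ≤ (M : ℤ)) {p : Fin k} (hp : 0 < ε * o p)
    (hinj : ∀ y, q * y = 0 → w p * y = 0 → y = 0)
    (hkill : ∀ i, ε * o p < ε * o i → ∀ y, q * y = 0 → w i * y = 0) (N : ℕ) :
    ∀ c : ℤ → R, (∀ z, q * c z = 0) → (∀ (t : ℕ) (x : ℤ), |x| ≤ (M : ℤ) → F^[t] c x = 0) →
      c (ε * (N - M)) = 0 := by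
  induction N using Nat.strong_induction_on with
  | _ N ih =>
    intro c hc hw
    by_cases hN : N ≤ 2 * M
    · refine hw 0 _ ?_
      rcases hε with rfl | rfl <;> rw [abs_le] <;> constructor <;> omega
    have hpM := abs_le.1 (hM p)
    have hzero : ∀ x : ℤ, -M ≤ ε * x → ε * x < N - M → c x = 0 := by
      intro x h1 h2
      have := ih (ε * x + M).toNat (by omega) c hc hw
      rw [Int.toNat_of_nonneg (by omega)] at this
      convert this using 2
      rcases hε with rfl | rfl <;> ring
    have h0 : F c (ε * (N - M) - o p) = 0 := by
      have := ih (N - ε * o p).toNat (by omega) (F c) (torsion_of_eq_sum hF hc)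
        fun t x hx => hw (t + 1) x hx
      rw [Int.toNat_of_nonneg (by rcases hε with rfl | rfl <;> omega)] at this
      convert this using 2
      rcases hε with rfl | rfl <;> ring
    rw [hF, Finset.sum_eq_single p] at h0
    · rw [sub_add_cancel] at h0
      exact hinj _ (hc _) h0
    · intro i _ hip
      have hne : o i ≠ o p := fun h => hip (ho h)
      have hiM := abs_le.1 (hM i)
      by_cases hi : ε * o p < ε * o i
      · exact hkill i hi _ (hc _)
      · rw [hzero, mul_zero] <;> rcases hε with rfl | rfl <;> omega
    · simp

end ShiftSums

/-- A `q`-torsion configuration whose orbit under a `1`-expansive linear combination of shifts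
vanishes on a large window is zero. -/
theorem KExpansive.eq_zero_of_torsion {n : ℕ} [NeZero n] {k : ℕ} {o : Fin k → ℤ}
    {w : Fin k → ZMod n} {F : (ℤ → ZMod n) → ℤ → ZMod n} (h : KExpansive 1 F)
    (ho : Function.Injective o) (hF : ∀ c z, F c z = ∑ i, w i * c (z + o i)) {M : ℕ}
    (hM : ∀ i, |o i| ≤ (M : ℤ)) {q : ℕ} (hq : q.Prime) {c : ℤ → ZMod n}
    (hc : ∀ z, (q : ZMod n) * c z = 0)
    (hw : ∀ (t : ℕ) (x : ℤ), |x| ≤ (M : ℤ) → F^[t] c x = 0) : c = 0 := by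
  by_contra hne
  obtain ⟨z₀, hz₀⟩ := Function.ne_iff.1 hne
  obtain ⟨m, hm⟩ := h
  have hF0 : F 0 = 0 := by
    funext z
    simp [hF]
  have hside : ∀ ε : ℤ, (ε = 1 ∨ ε = -1) → ∀ N : ℕ, c (ε * (N - M)) = 0 := by
    intro ε hε
    have hex : ∃ i, 0 < ε * o i ∧ ¬ ∀ y : ZMod n, (q : ZMod n) * y = 0 → w i * y = 0 := by
      by_contra! hcon
      have hεε : ε * ε = 1 := by rcases hε with rfl | rfl <;> rfl
      obtain ⟨t, x, hx, hxt⟩ := hm (Pi.single (ε * (m + 1)) (c z₀)) 0 (by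
        rw [Set.ncard_eq_one]
        refine ⟨ε * (m + 1), ?_⟩
        ext z
        by_cases hz : z = ε * (m + 1)
        · subst hz
          simpa using hz₀
        · simp [hz])
      refine hxt ?_
      rw [Function.iterate_fixed hF0]
      refine iterate_eq_zero_of_kills hF (q := (q : ZMod n)) (ε := ε) (B := m + 1) hcon t _
        ?_ ?_ x ?_
      · intro z
        by_cases hz : z = ε * (m + 1)
        · subst hz
          simpa using hc z₀
        · simp [hz]
      · intro z hz
        refine Pi.single_eq_of_ne ?_ _
        rintro rfl
        rw [← mul_assoc, hεε] at hz
        omega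
      · have := abs_le.1 hx
        rcases hε with rfl | rfl <;> omega
    classical
    obtain ⟨p, hp, hmax⟩ := Finset.exists_max_image
      (Finset.univ.filter fun i => 0 < ε * o i ∧
        ¬ ∀ y : ZMod n, (q : ZMod n) * y = 0 → w i * y = 0)
      (fun i => ε * o i) (by
        obtain ⟨i, hi⟩ := hex
        exact ⟨i, by simpa using hi⟩)
    rw [Finset.mem_filter] at hp
    refine fun N => eq_zero_of_orbit_eq_zero ho hF hε hM hp.2.1
      ((ZMod.mul_torsion_eq_zero_or_injective hq (w p)).resolve_left hp.2.2) ?_ N c hc hw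
    intro i hi
    by_contra hcon
    have := hmax i (Finset.mem_filter.2 ⟨Finset.mem_univ _, hp.2.1.trans hi, hcon⟩)
    omega
  refine hz₀ ?_
  rcases le_total 0 z₀ with hz | hz
  · have := hside 1 (Or.inl rfl) (z₀ + M).toNat
    rw [Int.toNat_of_nonneg (by omega)] at this
    simpa using this
  · have := hside (-1) (Or.inr rfl) (-z₀ + M).toNat
    rw [Int.toNat_of_nonneg (by omega)] at this
    simpa using this

/-- a one-dimensional linear CA over `ℤ/nℤ` (`n ≥ 2`) is `1`-expansive
if and only if it is positively expansive. -/
theorem linear_one_expansive_iff_expansive (n : ℕ) (hn : 2 ≤ n)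
    (F : (ℤ → ZMod n) → ℤ → ZMod n) (hCA : IsCA1D F)
    (hlin : ∀ c d : ℤ → ZMod n, F (c + d) = F c + F d) :
    KExpansive 1 F ↔ PosExpansive F := by
  have : NeZero n := ⟨by omega⟩
  constructor
  · intro h
    obtain ⟨k, o, w, ho, hF⟩ := hCA.exists_eq_sum hlin
    let φ := AddMonoidHom.mk' F hlin
    obtain ⟨M, hM⟩ : ∃ M : ℕ, ∀ i, |o i| ≤ (M : ℤ) := by
      refine ⟨∑ i, (o i).natAbs, fun i => ?_⟩
      rw [Int.abs_eq_natAbs]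
      exact_mod_cast Finset.single_le_sum (f := fun i => (o i).natAbs)
        (fun _ _ => Nat.zero_le _) (Finset.mem_univ i)
    refine ⟨M, fun c d hcd => ?_⟩
    by_contra! hw
    have he : c - d ≠ 0 := sub_ne_zero.2 hcd
    have hD0 : addOrderOf (c - d) ≠ 0 := by
      have hdvd : addOrderOf (c - d) ∣ n := addOrderOf_dvd_of_nsmul_eq_zero (by
        funext z
        simp)
      exact ne_zero_of_dvd_ne_zero (NeZero.ne n) hdvd
    have hD1 : addOrderOf (c - d) ≠ 1 := by rwa [Ne, AddMonoid.addOrderOf_eq_one_iff]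
    have hq := Nat.minFac_prime hD1
    obtain ⟨s, hs⟩ := Nat.minFac_dvd (addOrderOf (c - d))
    have hspos : 0 < s := Nat.pos_of_ne_zero (by
      rintro rfl
      exact hD0 (by simpa using hs))
    have hslt : s < addOrderOf (c - d) := by
      have := hq.two_le
      nlinarith
    refine nsmul_ne_zero_of_lt_addOrderOf hspos.ne' hslt
      (h.eq_zero_of_torsion ho hF hM hq (fun z => ?_) fun t x hx => ?_)
    · rw [← nsmul_eq_mul, ← Pi.smul_apply, ← mul_nsmul', ← hs, addOrderOf_nsmul_eq_zero]
      rfl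
    · have h1 : F^[t] (s • (c - d)) = s • F^[t] (c - d) := iterate_map_nsmul φ t (c - d) s
      have h2 : F^[t] (c - d) = F^[t] c - F^[t] d := iterate_map_sub φ t c d
      rw [h1, h2, Pi.smul_apply, Pi.sub_apply, hw t x hx, sub_self, smul_zero]
  · rintro ⟨m, hm⟩
    refine ⟨m, fun c d hcd => hm c d ?_⟩
    rintro rfl
    simp at hcd
end

section
/- For every configuration e ∈ (ℤ/3ℤ × ℤ/3ℤ)^ℤ, every k ∈ ℕ, every t ∈ ℕ and every w ∈ ℤ, Ψ^{2·3^k + t}(e)(w) = Ψ^t(e)(w) + Ψ^{3^k + t}(e)(w − 3^k) + Ψ^{3^k + t}(e)(w + 3^k), where + denotes componentwise addition in ℤ/3ℤ × ℤ/3ℤ. -/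
/-- The CA `Ψ` on `(ℤ/3ℤ × ℤ/3ℤ)^ℤ`, the second-order construction applied to the
linear CA `F₃(c)(z) = c(z−1) + c(z+1)` over `ℤ/3ℤ`:
`Ψ(e)(z) = (e₂(z), e₁(z) + e₂(z−1) + e₂(z+1))`. -/
def psi : (ℤ → ZMod 3 × ZMod 3) → ℤ → ZMod 3 × ZMod 3 :=
  fun e z => ((e z).2, (e z).1 + (e (z - 1)).2 + (e (z + 1)).2)

/-- If `u` satisfies the recurrence `X² = 1 + (S + S⁻¹) X` with time step `m` and space shift `M`,
then in characteristic three it also satisfies it with time step `3 m` and space shift `3 M`. -/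
theorem dependency_triple {R : Type*} [CommRing R] (h3 : (3 : R) = 0) (u : ℕ → ℤ → R)
    (m : ℕ) (M : ℤ)
    (h : ∀ t w, u (2 * m + t) w = u t w + u (m + t) (w - M) + u (m + t) (w + M))
    (t : ℕ) (w : ℤ) :
    u (2 * (3 * m) + t) w =
      u t w + u (3 * m + t) (w - 3 * M) + u (3 * m + t) (w + 3 * M) := by
  linear_combination (norm := ring_nf)
    h (4 * m + t) w + h t w + h (2 * m + t) (w - 2 * M) + h (2 * m + t) (w + 2 * M)
      - 2 * h (3 * m + t) (w - M) - 2 * h (3 * m + t) (w + M)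
      + 2 * h (m + t) (w - M) + 2 * h (m + t) (w + M)
      - h3 * (u (4 * m + t) w - u (2 * m + t) w
        - u (5 * m + t) (w - M) - u (5 * m + t) (w + M)
        + u (3 * m + t) (w - M) + u (3 * m + t) (w + M)
        - u (m + t) (w - M) - u (m + t) (w + M)
        + u (4 * m + t) (w - 2 * M) + u (4 * m + t) (w + 2 * M)
        - u (2 * m + t) (w - 2 * M) - u (2 * m + t) (w + 2 * M))

theorem psi_psi (e : ℤ → ZMod 3 × ZMod 3) (w : ℤ) :
    psi (psi e) w = e w + psi e (w - 1) + psi e (w + 1) := by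
  ext <;> simp [psi]

/-- the dependency relation
`Ψ^{2·3^k+t}(e)(w) = Ψ^t(e)(w) + Ψ^{3^k+t}(e)(w−3^k) + Ψ^{3^k+t}(e)(w+3^k)`. -/
theorem psi_dependency (e : ℤ → ZMod 3 × ZMod 3) (k t : ℕ) (w : ℤ) :
    psi^[2 * 3 ^ k + t] e w =
      psi^[t] e w + psi^[3 ^ k + t] e (w - (3 : ℤ) ^ k)
        + psi^[3 ^ k + t] e (w + (3 : ℤ) ^ k) := by
  induction k generalizing t w with
  | zero =>
    simp only [pow_zero, mul_one, Function.iterate_add_apply]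
    exact psi_psi _ w
  | succ k ih =>
    simpa only [pow_succ'] using
      dependency_triple (by decide) (fun n => psi^[n] e) (3 ^ k) (3 ^ k) ih t w
end

section
/- For every k ≥ 2 the cellular automaton Υ is not k-expansive; consequently Υ is not pre-expansive. -/
/-- The CA `Υ` on `(ℤ/2ℤ × ℤ/2ℤ)^ℤ`, the second-order construction applied to the
linear CA `F₂(c)(z) = c(z−1) + c(z+1)` over `ℤ/2ℤ`:
`Υ(e)(z) = (e₂(z), e₁(z) + e₂(z−1) + e₂(z+1))`. -/
def ups : (ℤ → ZMod 2 × ZMod 2) → ℤ → ZMod 2 × ZMod 2 :=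
  fun e z => ((e z).2, (e z).1 + (e (z - 1)).2 + (e (z + 1)).2)

/-- The configuration whose orbit under `ups` is the signal `f` travelling to the right. -/
def travellingWave (f : ℤ → ZMod 2) : ℤ → ZMod 2 × ZMod 2 :=
  fun z => (f z, f (z - 1))

theorem ups_travellingWave (f : ℤ → ZMod 2) :
    ups (travellingWave f) = travellingWave fun z => f (z - 1) := by
  funext z
  have h : f z + f (z - 1 - 1) + f z = f (z - 1 - 1) := by
    rw [add_right_comm, CharTwo.add_self_eq_zero, zero_add]
  simp [ups, travellingWave, h]

theorem iterate_ups_travellingWave (t : ℕ) (f : ℤ → ZMod 2) :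
    ups^[t] (travellingWave f) = travellingWave fun z => f (z - t) := by
  induction t generalizing f with
  | zero => simp
  | succ t ih =>
    rw [Function.iterate_succ_apply, ups_travellingWave, ih]
    simp only [Nat.cast_succ, sub_sub]

theorem iterate_ups_zero (t : ℕ) : ups^[t] 0 = 0 :=
  Function.iterate_fixed (by funext z; simp [ups]) t

/-- For `k ≥ 2` there is a configuration with exactly `k` nonzero cells whose orbit is forever
zero on `[-m, m]`. -/
theorem exists_ncard_eq_and_iterate_ups_eq_zero (k : ℕ) (hk : 2 ≤ k) (m : ℕ) :
    ∃ c : ℤ → ZMod 2 × ZMod 2, {z | c z ≠ (0 : ℤ → ZMod 2 × ZMod 2) z}.ncard = k ∧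
      ∀ (t : ℕ) (x : ℤ), |x| ≤ (m : ℤ) → ups^[t] c x = ups^[t] 0 x := by
  let f : ℤ → ZMod 2 := fun z => if (m : ℤ) < z ∧ z < m + k then 1 else 0
  refine ⟨travellingWave f, ?_, fun t x hx => ?_⟩
  · have h : {z | travellingWave f z ≠ (0 : ℤ → ZMod 2 × ZMod 2) z}
        = (Finset.Ioc (m : ℤ) (m + k) : Set ℤ) := by
      ext z
      simp only [f, travellingWave, Set.mem_ofPred_eq, Pi.zero_apply, ne_eq, Prod.mk_eq_zero,
        ite_eq_right_iff, one_ne_zero, imp_false, Finset.coe_Ioc, Set.mem_Ioc]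
      omega
    rw [h, Set.ncard_coe_finset, Int.card_Ioc]
    omega
  · have hx' := le_of_abs_le hx
    rw [iterate_ups_travellingWave, iterate_ups_zero]
    simp only [f, travellingWave, Pi.zero_apply, Prod.mk_eq_zero, ite_eq_right_iff, one_ne_zero,
      imp_false]
    omega

/-- `Υ` is not `k`-expansive for any `k ≥ 2`, and consequently `Υ` is
not pre-expansive. -/
theorem ups_not_k_expansive (k : ℕ) (hk : 2 ≤ k) :
    (¬ ∃ m : ℕ, ∀ c d : ℤ → ZMod 2 × ZMod 2, {z | c z ≠ d z}.ncard = k →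
      ∃ t : ℕ, ∃ x : ℤ, |x| ≤ (m : ℤ) ∧ ups^[t] c x ≠ ups^[t] d x) ∧
    (¬ ∃ m : ℕ, ∀ c d : ℤ → ZMod 2 × ZMod 2, {z | c z ≠ d z}.Finite → c ≠ d →
      ∃ t : ℕ, ∃ x : ℤ, |x| ≤ (m : ℤ) ∧ ups^[t] c x ≠ ups^[t] d x) := by
  constructor
  · rintro ⟨m, h⟩
    obtain ⟨c, hc, hzero⟩ := exists_ncard_eq_and_iterate_ups_eq_zero k hk m
    obtain ⟨t, x, hx, hne⟩ := h c 0 hc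
    exact hne (hzero t x hx)
  · rintro ⟨m, h⟩
    obtain ⟨c, hc, hzero⟩ := exists_ncard_eq_and_iterate_ups_eq_zero k hk m
    have hc0 : c ≠ 0 := by
      rintro rfl
      simp at hc
      omega
    obtain ⟨t, x, hx, hne⟩ := h c 0 (Set.finite_of_ncard_pos (by omega)) hc0
    exact hne (hzero t x hx)
end

section
/- For all integers k, k' ≥ 1, F_{k,k'} ∘ F_{k',k} = σ, the shift map. Consequently F_{k,k'} is bijective, with inverse F_{k',k} ∘ σ_{-1}. -/
/-- The cellular automaton `F_{k,k'}` ("multiplication by `k` in base `m = k·k'`") on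
`({0,…,m−1})^ℤ`, defined here for any `k ∣ m`:
`F_{k,k'}(c)(i) = (k·c(i) mod m) + ⌊k·c(i+1)/m⌋` (the value is always `< m`). -/
def Fkk (k m : ℕ) (hk : 0 < k) (hkm : k ∣ m) (c : ℤ → Fin m) : ℤ → Fin m :=
  fun i =>
    ⟨k * (c i).val % m + k * (c (i + 1)).val / m, by
      have hm : 0 < m := (c i).pos
      obtain ⟨j, hj⟩ : k ∣ k * (c i).val % m := (Nat.dvd_mod_iff hkm).mpr ⟨(c i).val, rfl⟩
      have h2 : k * (c i).val % m < m := Nat.mod_lt _ hm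
      obtain ⟨k', rfl⟩ := hkm
      have hjk : j < k' := by
        rw [hj] at h2
        exact lt_of_mul_lt_mul_left h2 (Nat.zero_le k)
      have h4 : k * (c (i + 1)).val / (k * k') < k := by
        rw [Nat.div_lt_iff_lt_mul hm]
        have := (c (i + 1)).isLt
        nlinarith
      rw [hj]
      nlinarith [hjk, h4]⟩

/-- Carrying out the multiplication by `k` in base `m = k * k'` digit by digit. -/
theorem Fkk_apply_val {k k' m : ℕ} (hk : 0 < k) (hkm : k ∣ m) (hm : m = k * k')
    (c : ℤ → Fin m) (i : ℤ) :
    (Fkk k m hk hkm c i).val = k * ((c i).val % k') + (c (i + 1)).val / k' := by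
  subst hm
  simp only [Fkk, Nat.mul_mod_mul_left, Nat.mul_div_mul_left _ _ hk]

/-- Multiplying by `k'` and then by `k` in base `m = k * k'` is the shift. -/
theorem Fkk_Fkk_apply {k k' m : ℕ} (hk : 0 < k) (hk' : 0 < k') (hkm : k ∣ m) (hkm' : k' ∣ m)
    (hm : m = k * k') (c : ℤ → Fin m) (i : ℤ) :
    Fkk k m hk hkm (Fkk k' m hk' hkm' c) i = c (i + 1) := by
  have hm' : m = k' * k := hm.trans (mul_comm k k')
  have hlt (j : ℤ) : (c j).val / k < k' := Nat.div_lt_of_lt_mul (hm ▸ (c j).isLt)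
  ext
  rw [Fkk_apply_val hk hkm hm, Fkk_apply_val hk' hkm' hm', Fkk_apply_val hk' hkm' hm',
    Nat.mul_add_mod, Nat.mod_eq_of_lt (hlt _), Nat.mul_add_div hk', Nat.div_eq_of_lt (hlt _),
    add_zero, Nat.div_add_mod]

/-- `Fkk` commutes with every shift. -/
theorem Fkk_shift {k m : ℕ} (hk : 0 < k) (hkm : k ∣ m) (c : ℤ → Fin m) (z : ℤ) :
    Fkk k m hk hkm (fun x => c (z + x)) = fun x => Fkk k m hk hkm c (z + x) := by
  funext i
  simp only [Fkk, add_assoc]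

/-- `F_{k,k'} ∘ F_{k',k} = σ` (the shift `σ(c)(x) = c(1+x)`); consequently
`F_{k,k'}` is bijective with inverse `F_{k',k} ∘ σ_{-1}` (where `σ_{-1}(c)(x) = c(-1+x)`). -/
theorem Fkk_comp_eq_shift (k k' : ℕ) (hk : 0 < k) (hk' : 0 < k') :
    (∀ c : ℤ → Fin (k * k'),
      Fkk k (k * k') hk (dvd_mul_right k k') (Fkk k' (k * k') hk' (dvd_mul_left k' k) c)
        = fun x => c (1 + x)) ∧
    Function.Bijective (Fkk k (k * k') hk (dvd_mul_right k k')) ∧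
    Function.LeftInverse
      (fun c : ℤ → Fin (k * k') =>
        Fkk k' (k * k') hk' (dvd_mul_left k' k) (fun x => c (-1 + x)))
      (Fkk k (k * k') hk (dvd_mul_right k k')) ∧
    Function.RightInverse
      (fun c : ℤ → Fin (k * k') =>
        Fkk k' (k * k') hk' (dvd_mul_left k' k) (fun x => c (-1 + x)))
      (Fkk k (k * k') hk (dvd_mul_right k k')) := by
  have hleft : Function.LeftInverse
      (fun c : ℤ → Fin (k * k') =>
        Fkk k' (k * k') hk' (dvd_mul_left k' k) (fun x => c (-1 + x)))
      (Fkk k (k * k') hk (dvd_mul_right k k')) := by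
    intro c
    funext i
    simp only [Fkk_shift]
    rw [Fkk_Fkk_apply hk' hk _ _ (mul_comm k k'), neg_add_cancel_comm]
  have hright : Function.RightInverse
      (fun c : ℤ → Fin (k * k') =>
        Fkk k' (k * k') hk' (dvd_mul_left k' k) (fun x => c (-1 + x)))
      (Fkk k (k * k') hk (dvd_mul_right k k')) := by
    intro c
    funext i
    rw [Fkk_Fkk_apply hk hk' _ _ rfl, add_comm i 1, neg_add_cancel_left]
  refine ⟨fun c => ?_, ⟨hleft.injective, hright.surjective⟩, hleft, hright⟩
  funext i
  rw [Fkk_Fkk_apply hk hk' _ _ rfl, add_comm]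
end

section
/- Let k, k' ≥ 2, m = k·k', and define g : ({0,…,m−1})^ℤ → ℝ by g(c) = Σ_{i=0}^∞ c(i)·m^{−i}. Then: (1) for every configuration c, g(F_{k,k'}(c)) = k·g(c) − m·⌊k·c(0)/m⌋; (2) if c(0) = d(0), then |g(F_{k,k'}(c)) − g(F_{k,k'}(d))| = k·|g(c) − g(d)|; (3) if c ≠ d are asymptotic, i = min{z : c(z) ≠ d(z)} > 0 and j = max{z : c(z) ≠ d(z)}, then m^{−j} ≤ |g(c) − g(d)| < m^{−i+1}. -/
/-- `g(c) = Σ_{i=0}^∞ c(i)·m^{−i}`. -/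
noncomputable def gfun (m : ℕ) (c : ℤ → Fin m) : ℝ :=
  ∑' i : ℕ, ((c (i : ℤ)).val : ℝ) / (m : ℝ) ^ i

/-- A series of base-`m` digits converges. -/
lemma summable_digits {m : ℕ} (hm : 2 ≤ m) {a : ℕ → ℕ} (ha : ∀ n, a n ≤ m) :
    Summable fun n : ℕ => (a n : ℝ) / (m : ℝ) ^ n := by
  have hm' : (1 : ℝ) < m := by exact_mod_cast hm
  have hgeom : Summable fun n : ℕ => (m : ℝ) * ((m : ℝ)⁻¹) ^ n :=
    (summable_geometric_of_lt_one (by positivity) (inv_lt_one_of_one_lt₀ hm')).mul_left _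
  refine hgeom.of_nonneg_of_le (fun n => by positivity) fun n => ?_
  rw [inv_pow, ← div_eq_mul_inv]
  have : (a n : ℝ) ≤ m := by exact_mod_cast ha n
  gcongr

lemma gfun_Fkk {k m : ℕ} (hm : 2 ≤ m) (hk : 0 < k) (hkm : k ∣ m) (c : ℤ → Fin m) :
    gfun m (Fkk k m hk hkm c)
      = k * gfun m c - m * (⌊((k : ℝ) * ((c 0).val : ℝ)) / (m : ℝ)⌋ : ℝ) := by
  have hm0 : (m : ℝ) ≠ 0 := by positivity
  let q : ℕ → ℕ := fun n => k * (c n).val / m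
  have hq : ∀ n, q n ≤ m := fun n => by
    refine Nat.div_le_of_le_mul ?_
    exact Nat.mul_le_mul (Nat.le_of_dvd (by omega) hkm) (c n).isLt.le
  have hsc := summable_digits hm (a := fun n => (c n).val) fun n => (c n).isLt.le
  have hsq := summable_digits hm hq
  have hsq' := (summable_nat_add_iff 1).mpr hsq
  have hfloor : ⌊((k : ℝ) * ((c 0).val : ℝ)) / (m : ℝ)⌋ = (q 0 : ℤ) := by
    rw [← Nat.cast_mul, ← Int.natCast_floor_eq_floor (by positivity), Nat.floor_div_eq_div]
    simp [q]
  have hterm : ∀ n : ℕ, ((Fkk k m hk hkm c n).val : ℝ) / (m : ℝ) ^ n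
      = k * (((c n).val : ℝ) / (m : ℝ) ^ n) - m * ((q n : ℝ) / (m : ℝ) ^ n)
        + m * ((q (n + 1) : ℝ) / (m : ℝ) ^ (n + 1)) := fun n => by
    have hdm : ((k * (c n).val % m : ℕ) : ℝ) + m * (q n : ℝ) = k * ((c n).val : ℝ) := by
      exact_mod_cast Nat.mod_add_div (k * (c n).val) m
    have hF : ((Fkk k m hk hkm c n).val : ℝ)
        = ((k * (c n).val % m : ℕ) : ℝ) + (q (n + 1) : ℝ) := by
      simp [Fkk, q]
    rw [hF, eq_sub_of_add_eq hdm]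
    field_simp
    ring
  have hshift := hsq.tsum_eq_zero_add
  unfold gfun
  rw [tsum_congr hterm,
    ((hsc.mul_left _).sub (hsq.mul_left _)).tsum_add (hsq'.mul_left _),
    (hsc.mul_left _).tsum_sub (hsq.mul_left _), tsum_mul_left, tsum_mul_left, tsum_mul_left,
    hfloor, hshift]
  push_cast
  ring

/-- Clearing denominators in a finite base-`m` expansion. -/
lemma exists_int_sum_digits {m : ℕ} (hm : 0 < m) (e : ℕ → ℤ) (J : ℕ) :
    ∃ N : ℤ, (∑ n ∈ Finset.range J, (e n : ℝ) / (m : ℝ) ^ n) * (m : ℝ) ^ J = m * N := by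
  induction J with
  | zero => exact ⟨0, by simp⟩
  | succ J ih =>
    obtain ⟨N, hN⟩ := ih
    refine ⟨m * N + e J, ?_⟩
    rw [Finset.sum_range_succ, add_mul, pow_succ, ← mul_assoc, hN]
    push_cast
    field_simp

lemma inv_pow_le_abs_sum_digits {m : ℕ} {e : ℕ → ℤ} {J : ℕ} (he : |e J| < m) (h0 : e J ≠ 0) :
    ((m : ℝ) ^ J)⁻¹ ≤ |∑ n ∈ Finset.range (J + 1), (e n : ℝ) / (m : ℝ) ^ n| := by
  have hm : 0 < m := by
    have := abs_nonneg (e J)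
    omega
  obtain ⟨N, hN⟩ := exists_int_sum_digits hm e J
  have hpow : (0 : ℝ) < (m : ℝ) ^ J := by positivity
  have hsum : (∑ n ∈ Finset.range (J + 1), (e n : ℝ) / (m : ℝ) ^ n) * (m : ℝ) ^ J
      = ((m * N + e J : ℤ) : ℝ) := by
    rw [Finset.sum_range_succ, add_mul, hN, div_mul_cancel₀ _ hpow.ne']
    push_cast
    ring
  have hne : (m * N + e J : ℤ) ≠ 0 := fun h =>
    h0 (Int.eq_zero_of_abs_lt_dvd ⟨-N, by linarith⟩ he)
  have hone : (1 : ℝ) ≤ |((m * N + e J : ℤ) : ℝ)| := by exact_mod_cast Int.one_le_abs hne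
  rw [← hsum, abs_mul, abs_of_pos hpow] at hone
  rwa [inv_le_iff_one_le_mul₀ hpow]

lemma abs_sum_digits_le {m : ℕ} (hm : 0 < m) {e : ℕ → ℤ} (he : ∀ n, |e n| < m) {I J : ℕ}
    (hI : ∀ n < I, e n = 0) (hIJ : I ≤ J) :
    |∑ n ∈ Finset.range J, (e n : ℝ) / (m : ℝ) ^ n| ≤ m / (m : ℝ) ^ I - m / (m : ℝ) ^ J := by
  induction J, hIJ using Nat.le_induction with
  | base =>
    rw [Finset.sum_eq_zero fun n hn => by simp [hI n (Finset.mem_range.mp hn)]]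
    simp
  | succ J _ ih =>
    have heJ : |(e J : ℝ)| ≤ m - 1 := by
      have : |e J| ≤ (m : ℤ) - 1 := by linarith [Int.add_one_le_of_lt (he J)]
      exact_mod_cast this
    have hterm : |(e J : ℝ) / (m : ℝ) ^ J| ≤ (m - 1) / (m : ℝ) ^ J := by
      rw [abs_div, abs_of_pos (by positivity : (0 : ℝ) < (m : ℝ) ^ J)]
      gcongr
    have htel : (m : ℝ) / (m : ℝ) ^ (J + 1) = m / (m : ℝ) ^ J - (m - 1) / (m : ℝ) ^ J := by
      field_simp
      ring
    rw [Finset.sum_range_succ]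
    linarith [abs_add_le (∑ n ∈ Finset.range J, (e n : ℝ) / (m : ℝ) ^ n)
      ((e J : ℝ) / (m : ℝ) ^ J)]

/-- Two configurations that agree to the right of `J` have `g`-values differing by a finite
sum. -/
lemma gfun_sub_eq_sum {m : ℕ} (hm : 2 ≤ m) {c d : ℤ → Fin m} {J : ℕ}
    (h : ∀ n : ℕ, J < n → c n = d n) :
    gfun m c - gfun m d = ∑ n ∈ Finset.range (J + 1),
      ((((c n).val : ℤ) - ((d n).val : ℤ) : ℤ) : ℝ) / (m : ℝ) ^ n := by
  unfold gfun
  rw [← (summable_digits hm (a := fun n => (c n).val) fun n => (c n).isLt.le).tsum_sub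
    (summable_digits hm (a := fun n => (d n).val) fun n => (d n).isLt.le),
    tsum_eq_sum (s := Finset.range (J + 1)) fun n hn => ?_]
  · refine Finset.sum_congr rfl fun n _ => ?_
    push_cast
    ring
  · rw [h n (by rw [Finset.mem_range] at hn; omega), sub_self]

lemma gfun_sub_bounds {m : ℕ} (hm : 2 ≤ m) {c d : ℤ → Fin m} {I J : ℕ}
    (hI : ∀ n : ℕ, c n ≠ d n → I ≤ n) (hJ : ∀ n : ℕ, c n ≠ d n → n ≤ J) (hcd : c J ≠ d J) :
    ((m : ℝ) ^ J)⁻¹ ≤ |gfun m c - gfun m d| ∧ |gfun m c - gfun m d| < m / (m : ℝ) ^ I := by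
  let e : ℕ → ℤ := fun n => ((c n).val : ℤ) - ((d n).val : ℤ)
  have he : ∀ n, |e n| < m := fun n => by
    have h₁ := (c n).isLt
    have h₂ := (d n).isLt
    rw [abs_lt]
    constructor <;> simp only [e] <;> omega
  have heJ : e J ≠ 0 := fun h => hcd (Fin.ext (by simp only [e] at h; omega))
  have heI : ∀ n < I, e n = 0 := fun n hn => by
    have : c n = d n := by
      by_contra hne
      exact absurd (hI n hne) (by omega)
    simp [e, this]
  rw [gfun_sub_eq_sum hm (J := J) fun n hn => by
    by_contra hne
    exact absurd (hJ n hne) (by omega)]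
  refine ⟨inv_pow_le_abs_sum_digits (he J) heJ, ?_⟩
  refine (abs_sum_digits_le (by omega) he heI ((hI J hcd).trans (J.le_add_right 1))).trans_lt ?_
  have : (0 : ℝ) < m / (m : ℝ) ^ (J + 1) := by positivity
  linarith

/-- for `k, k' ≥ 2` and `m = k·k'`:
(1) `g(F_{k,k'}(c)) = k·g(c) − m·⌊k·c(0)/m⌋`;
(2) if `c(0) = d(0)` then `|g(F(c)) − g(F(d))| = k·|g(c) − g(d)|`;
(3) if `c ≠ d` are asymptotic with leftmost difference `i > 0` and rightmost
difference `j`, then `m^{−j} ≤ |g(c) − g(d)| < m^{−i+1}`. -/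
theorem g_of_Fkk (k k' : ℕ) (hk : 2 ≤ k) (hk' : 2 ≤ k') :
    (∀ c : ℤ → Fin (k * k'),
      gfun (k * k') (Fkk k (k * k') (by omega) (dvd_mul_right k k') c)
        = (k : ℝ) * gfun (k * k') c
          - ((k * k' : ℕ) : ℝ) * (⌊((k : ℝ) * ((c 0).val : ℝ)) / ((k * k' : ℕ) : ℝ)⌋ : ℝ)) ∧
    (∀ c d : ℤ → Fin (k * k'), c 0 = d 0 →
      |gfun (k * k') (Fkk k (k * k') (by omega) (dvd_mul_right k k') c)
          - gfun (k * k') (Fkk k (k * k') (by omega) (dvd_mul_right k k') d)|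
        = (k : ℝ) * |gfun (k * k') c - gfun (k * k') d|) ∧
    (∀ c d : ℤ → Fin (k * k'), ∀ i j : ℤ,
      {z | c z ≠ d z}.Finite → c ≠ d → 0 < i →
      (c i ≠ d i ∧ ∀ z : ℤ, c z ≠ d z → i ≤ z) →
      (c j ≠ d j ∧ ∀ z : ℤ, c z ≠ d z → z ≤ j) →
      ((k * k' : ℕ) : ℝ) ^ (-j) ≤ |gfun (k * k') c - gfun (k * k') d| ∧
        |gfun (k * k') c - gfun (k * k') d| < ((k * k' : ℕ) : ℝ) ^ (-i + 1)) := by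
  have hm : 2 ≤ k * k' := by nlinarith
  refine ⟨gfun_Fkk hm _ _, fun c d h => ?_, fun c d i j _ _ hi ⟨hci, hmin⟩ ⟨hcj, hmax⟩ => ?_⟩
  · rw [gfun_Fkk hm, gfun_Fkk hm, h, sub_sub_sub_cancel_right, ← mul_sub, abs_mul, Nat.abs_cast]
  · have hij := hmin j hcj
    lift i to ℕ using hi.le
    lift j to ℕ using by omega
    have hm0 : ((k * k' : ℕ) : ℝ) ≠ 0 := by positivity
    rw [zpow_add₀ hm0, zpow_one, zpow_neg, zpow_neg, zpow_natCast, zpow_natCast, mul_comm _⁻¹,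
      ← div_eq_mul_inv]
    exact gfun_sub_bounds hm (fun n hn => by exact_mod_cast hmin n hn)
      (fun n hn => by exact_mod_cast hmax n hn) hcj
end

section
/- Let k, k' ≥ 2, m = k·k', q = min{n ∈ {1,…,m−1} : ∃ p ∈ ℕ, k' divides k^p·n}, and p = min{n ∈ ℕ : k' divides k^n·q}. If q > 1 and k' > k^p, then for every real α with −log(k)/log(m) < α < 0, the cellular automaton F_{k,k'} is pre-expansive in direction α. -/
/-- The value `∑ aᵢ m⁻ⁱ` of a sequence of integer digits in base `m`. -/
noncomputable def baseValue (m : ℕ) (a : ℤ → ℤ) : ℝ := ∑' i : ℤ, (a i : ℝ) * (m : ℝ) ^ (-i)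

lemma finite_support_mul {a : ℤ → ℤ} (ha : a.support.Finite) (w : ℤ → ℝ) :
    (fun i => (a i : ℝ) * w i).support.Finite := by
  refine ha.subset fun i hi => ?_
  simp only [Function.mem_support] at hi ⊢
  contrapose! hi
  simp [hi]

lemma abs_sum_digits_le_s16 {m : ℕ} (hm : 0 < m) {b : ℕ → ℤ} (hb : ∀ n, |b n| ≤ (m : ℤ) - 1) (N : ℕ) :
    |∑ n ∈ Finset.range N, (b n : ℝ) * ((m : ℝ) ^ (n + 1))⁻¹| ≤ 1 - ((m : ℝ) ^ N)⁻¹ := by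
  have hm' : (0 : ℝ) < m := by exact_mod_cast hm
  induction N with
  | zero => simp
  | succ N ih =>
    rw [Finset.sum_range_succ]
    refine (abs_add_le _ _).trans ?_
    have h1 : |(b N : ℝ)| ≤ (m : ℝ) - 1 := by exact_mod_cast hb N
    have h2 : |(b N : ℝ) * ((m : ℝ) ^ (N + 1))⁻¹| ≤ ((m : ℝ) - 1) * ((m : ℝ) ^ (N + 1))⁻¹ := by
      rw [abs_mul, abs_of_pos (a := ((m : ℝ) ^ (N + 1))⁻¹) (by positivity)]
      gcongr
    have h3 : (m : ℝ) * ((m : ℝ) ^ (N + 1))⁻¹ = ((m : ℝ) ^ N)⁻¹ := by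
      field_simp
      ring
    linarith

/-- Scaled by `mⁱ`, the value of a finitely supported digit sequence is a multiple of `m` coming
from the digits left of `i`, plus the digit at `i`, plus a remainder smaller than one. -/
lemma exists_baseValue_approx {m : ℕ} (hm : 0 < m) {a : ℤ → ℤ} (ha : a.support.Finite)
    (hb : ∀ i, |a i| ≤ (m : ℤ) - 1) (i : ℤ) :
    ∃ n : ℤ, |baseValue m a * (m : ℝ) ^ i - m * n - a i| < 1 ∧ ((∀ j < i, a j = 0) → n = 0) := by
  have hm' : (0 : ℝ) < m := by exact_mod_cast hm
  have hval : baseValue m a * (m : ℝ) ^ i = ∑' j : ℤ, (a (j + i) : ℝ) * (m : ℝ) ^ (-j) := by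
    rw [baseValue, ← tsum_mul_right, ← (Equiv.addRight i).tsum_eq]
    refine tsum_congr fun j => ?_
    rw [Equiv.coe_addRight, mul_assoc, ← zpow_add₀ hm'.ne']
    congr 2
    ring
  set f : ℤ → ℝ := fun j => (a (j + i) : ℝ) * (m : ℝ) ^ (-j) with hf
  have hfin : (fun j => a (j + i)).support.Finite :=
    ha.preimage ((Equiv.addRight i).injective.injOn)
  have hffin : f.support.Finite := finite_support_mul hfin _
  obtain ⟨N, hN⟩ : ∃ N : ℕ, ∀ j : ℤ, a (j + i) ≠ 0 → |j| ≤ N := by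
    obtain ⟨B, hB⟩ := (hfin.image (fun j => |j|)).bddAbove
    refine ⟨B.toNat, fun j hj => ?_⟩
    have := hB ⟨j, hj, rfl⟩
    simp only at this
    omega
  have hneg : (fun n : ℕ => f (-(n + 1))).support.Finite :=
    hffin.preimage (fun x _ y _ h => by simpa using h)
  have hzero : ∀ j : ℤ, (N : ℤ) < |j| → f j = 0 := by
    intro j hj
    have : a (j + i) = 0 := by
      by_contra h
      exact absurd (hN j h) (by omega)
    simp [hf, this]
  have hsplit : ∑' j : ℤ, f j = f 0 + ∑ n ∈ Finset.range N, f (n + 1)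
      + ∑ n ∈ Finset.range N, f (-(n + 1)) := by
    have h0 : (fun n : ℕ => f n).support.Finite :=
      hffin.preimage (fun x _ y _ h => by simpa using h)
    rw [tsum_of_nat_of_neg_add_one (summable_of_hasFiniteSupport h0)
      (summable_of_hasFiniteSupport hneg), (summable_of_hasFiniteSupport h0).tsum_eq_zero_add]
    rw [tsum_eq_sum (s := Finset.range N) (f := fun n : ℕ => f (-(n + 1))),
      tsum_eq_sum (s := Finset.range N) (f := fun n : ℕ => f ((n + 1 : ℕ) : ℤ))]
    · simp
    · intro n hn
      exact hzero _ (lt_abs.2 (by simp at hn; omega))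
    · intro n hn
      exact hzero _ (lt_abs.2 (by simp at hn; omega))
  refine ⟨∑ n ∈ Finset.range N, a (-(n + 1) + i) * (m : ℤ) ^ n, ?_, ?_⟩
  · have h1 : ∑ n ∈ Finset.range N, f (-(n + 1))
        = m * ((∑ n ∈ Finset.range N, a (-(n + 1) + i) * (m : ℤ) ^ n : ℤ) : ℝ) := by
      push_cast
      rw [Finset.mul_sum]
      refine Finset.sum_congr rfl fun n _ => ?_
      have : (m : ℝ) ^ (-(-((n : ℤ) + 1))) = (m : ℝ) ^ (n + 1) := by
        rw [neg_neg]; exact_mod_cast zpow_natCast (m : ℝ) (n + 1)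
      simp only [hf]
      rw [this, pow_succ]
      ring
    have h2 : ∑ n ∈ Finset.range N, f (n + 1)
        = ∑ n ∈ Finset.range N, (a (n + 1 + i) : ℝ) * ((m : ℝ) ^ (n + 1))⁻¹ := by
      refine Finset.sum_congr rfl fun n _ => ?_
      simp only [hf]
      rw [zpow_neg]
      norm_cast
    have h3 : f 0 = a i := by simp [hf]
    rw [hval, hsplit, h1, h2, h3]
    have h4 := abs_sum_digits_le_s16 hm (b := fun n : ℕ => a (n + 1 + i)) (fun n => hb _) N
    have h5 : (0 : ℝ) < ((m : ℝ) ^ N)⁻¹ := by positivity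
    refine lt_of_le_of_lt (le_of_eq ?_) (lt_of_le_of_lt h4 (by linarith))
    congr 1
    ring
  · intro h
    refine Finset.sum_eq_zero fun n _ => ?_
    rw [h _ (by omega), zero_mul]

lemma baseValue_ne_zero {m : ℕ} (hm : 0 < m) {a : ℤ → ℤ} (ha : a.support.Finite)
    (hb : ∀ i, |a i| ≤ (m : ℤ) - 1) (h0 : a ≠ 0) : baseValue m a ≠ 0 := by
  obtain ⟨i, hi, hmin⟩ := Set.exists_min_image a.support id ha (Function.support_nonempty_iff.2 h0)
  obtain ⟨n, hn, hn0⟩ := exists_baseValue_approx hm ha hb i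
  have : n = 0 := hn0 fun j hj => by
    by_contra h
    exact absurd (hmin j h) (by simpa using hj)
  intro hv
  rw [hv, this] at hn
  have h1 : |a i| < 1 := by
    have : |(a i : ℝ)| < 1 := by simpa using hn
    exact_mod_cast this
  exact hi (Int.abs_lt_one_iff.1 h1)

/-- Moving carries `g` one cell to the left does not change the value. -/
lemma baseValue_carry {m : ℕ} (hm : 0 < m) (k : ℕ) {a a' g : ℤ → ℤ} (ha : a.support.Finite)
    (hg : g.support.Finite) (h : ∀ i, a' i = k * a i - m * g i + g (i + 1)) :
    baseValue m a' = k * baseValue m a := by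
  have hm' : (m : ℝ) ≠ 0 := by exact_mod_cast hm.ne'
  have s1 : Summable fun i => (a i : ℝ) * (m : ℝ) ^ (-i) :=
    summable_of_hasFiniteSupport (finite_support_mul ha fun i => (m : ℝ) ^ (-i))
  have s2 : Summable fun i => (g i : ℝ) * (m : ℝ) ^ (1 - i) :=
    summable_of_hasFiniteSupport (finite_support_mul hg fun i => (m : ℝ) ^ (1 - i))
  have s3 := (Equiv.addRight (1 : ℤ)).summable_iff.2 s2
  have e3 := (Equiv.addRight (1 : ℤ)).tsum_eq fun i => (g i : ℝ) * (m : ℝ) ^ (1 - i)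
  have : ∀ i, (a' i : ℝ) * (m : ℝ) ^ (-i) = k * ((a i : ℝ) * (m : ℝ) ^ (-i))
      - (g i : ℝ) * (m : ℝ) ^ (1 - i)
      + ((fun i => (g i : ℝ) * (m : ℝ) ^ (1 - i)) ∘ Equiv.addRight (1 : ℤ)) i := by
    intro i
    have e1 : (m : ℝ) ^ (1 - i) = m * (m : ℝ) ^ (-i) := by
      rw [sub_eq_add_neg, zpow_add₀ hm', zpow_one]
    have e2 : (1 : ℤ) - (i + 1) = -i := by ring
    simp only [Function.comp_apply, Equiv.coe_addRight, e1, e2, h i]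
    push_cast
    ring
  rw [baseValue, baseValue, tsum_congr this, ((s1.mul_left _).sub s2).tsum_add s3,
    (s1.mul_left _).tsum_sub s2, tsum_mul_left]
  simp only [Function.comp_apply] at e3 ⊢
  rw [e3]
  ring

section Difference

variable {m : ℕ}

/-- The cellwise difference of two configurations. -/
def digitDiff (c d : ℤ → Fin m) (i : ℤ) : ℤ := (c i : ℤ) - (d i : ℤ)

lemma digitDiff_ne_zero_iff {c d : ℤ → Fin m} {i : ℤ} : digitDiff c d i ≠ 0 ↔ c i ≠ d i := by
  rw [digitDiff, sub_ne_zero, Ne, Ne, Fin.ext_iff]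
  norm_cast

lemma support_digitDiff (c d : ℤ → Fin m) : (digitDiff c d).support = {z | c z ≠ d z} := by
  ext i
  exact digitDiff_ne_zero_iff

lemma abs_digitDiff_le (c d : ℤ → Fin m) (i : ℤ) : |digitDiff c d i| ≤ (m : ℤ) - 1 := by
  have h1 := (c i).isLt
  have h2 := (d i).isLt
  rw [digitDiff, abs_le]
  omega

variable {k : ℕ} (hk : 0 < k) (hkm : k ∣ m)

lemma Fkk_asymptotic {c d : ℤ → Fin m} (h : {z | c z ≠ d z}.Finite) :
    {z | Fkk k m hk hkm c z ≠ Fkk k m hk hkm d z}.Finite := by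
  refine (h.union (h.preimage ((Equiv.addRight (1 : ℤ)).injective.injOn))).subset fun i hi => ?_
  by_contra hne
  simp only [Set.mem_union, Set.mem_ofPred_eq, Set.mem_preimage, Equiv.coe_addRight, not_or,
    not_not] at hne
  exact hi (by simp [Fkk, hne.1, hne.2])

lemma baseValue_digitDiff_Fkk (hm : 0 < m) {c d : ℤ → Fin m} (h : {z | c z ≠ d z}.Finite) :
    baseValue m (digitDiff (Fkk k m hk hkm c) (Fkk k m hk hkm d))
      = k * baseValue m (digitDiff c d) := by
  refine baseValue_carry hm k (g := fun i => ((k * (c i).val / m : ℕ) : ℤ) - (k * (d i).val / m : ℕ))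
    (by rwa [support_digitDiff]) (h.subset fun i hi => ?_) fun i => ?_
  · intro hcd
    exact hi (by simp [hcd])
  · have h1 : ((k * (c i).val % m : ℕ) : ℤ) + m * (k * (c i).val / m : ℕ) = k * (c i).val := by
      exact_mod_cast Nat.mod_add_div (k * (c i).val) m
    have h2 : ((k * (d i).val % m : ℕ) : ℤ) + m * (k * (d i).val / m : ℕ) = k * (d i).val := by
      exact_mod_cast Nat.mod_add_div (k * (d i).val) m
    simp only [digitDiff, Fkk]
    rw [Nat.cast_add, Nat.cast_add]
    linear_combination h1 - h2

lemma iterate_Fkk_difference (hm : 0 < m) {c d : ℤ → Fin m} (h : {z | c z ≠ d z}.Finite) (t : ℕ) :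
    {z | (Fkk k m hk hkm)^[t] c z ≠ (Fkk k m hk hkm)^[t] d z}.Finite ∧
    baseValue m (digitDiff ((Fkk k m hk hkm)^[t] c) ((Fkk k m hk hkm)^[t] d))
      = k ^ t * baseValue m (digitDiff c d) := by
  induction t with
  | zero => simpa using h
  | succ t ih =>
    simp only [Function.iterate_succ_apply']
    refine ⟨Fkk_asymptotic hk hkm ih.1, ?_⟩
    rw [baseValue_digitDiff_Fkk hk hkm hm ih.1, ih.2]
    ring

end Difference

lemma exists_dvd_pow_of_forall_prime_dvd {a b : ℕ} (ha : a ≠ 0) (hb : b ≠ 0)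
    (h : ∀ r : ℕ, r.Prime → r ∣ a → r ∣ b) : ∃ n, a ∣ b ^ n := by
  refine ⟨a, (Nat.factorization_le_iff_dvd ha (pow_ne_zero _ hb)).1 fun r => ?_⟩
  rw [Nat.factorization_pow, Finsupp.smul_apply, smul_eq_mul]
  by_cases hr : r.Prime ∧ r ∣ a
  · have h1 : 1 ≤ b.factorization r := (hr.1.dvd_iff_one_le_factorization hb).1 (h r hr.1 hr.2)
    have h2 : a.factorization r < a := Nat.factorization_lt r ha
    nlinarith
  · have : a.factorization r = 0 := by
      rw [Nat.factorization_eq_zero_iff]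
      tauto
    omega

lemma eq_of_abs_sub_lt_inv {m k : ℕ} (hkm : k + 1 ≤ m) {z z' : ℝ} {n n' : ℤ}
    (h : |z - n| < (m : ℝ)⁻¹) (h' : |z' - n'| < (m : ℝ)⁻¹) (hz : z' = k * z) : n' = k * n := by
  have hm : (0 : ℝ) < m := by exact_mod_cast (by omega : 0 < m)
  have hkm' : (k : ℝ) + 1 ≤ m := by exact_mod_cast hkm
  have key : |(n' : ℝ) - k * n| < 1 := by
    have e : (n' : ℝ) - k * n = k * (z - n) - (z' - n') := by rw [hz]; ring
    have h1 : |(k : ℝ) * (z - n)| ≤ k * (m : ℝ)⁻¹ := by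
      rw [abs_mul, Nat.abs_cast]
      gcongr
    have h2 : ((k : ℝ) + 1) * (m : ℝ)⁻¹ ≤ 1 := by
      rw [← div_eq_mul_inv, div_le_one hm]
      exact hkm'
    rw [e]
    have := abs_sub (k * (z - n)) (z' - n')
    linarith
  have : |n' - k * n| < 1 := by exact_mod_cast key
  exact sub_eq_zero.1 (Int.abs_lt_one_iff.1 this)

lemma ceil_mul_succ {α : ℝ} (h₁ : -1 < α) (h₂ : α < 0) (t : ℕ) :
    ⌈α * (t + 1 : ℕ)⌉ = ⌈α * t⌉ ∨ ⌈α * (t + 1 : ℕ)⌉ = ⌈α * t⌉ - 1 := by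
  have h3 : ⌈α * (t + 1 : ℕ)⌉ ≤ ⌈α * t⌉ := by
    apply Int.ceil_mono
    push_cast
    linarith
  have h4 : ⌈α * t⌉ - 1 ≤ ⌈α * (t + 1 : ℕ)⌉ := by
    rw [← Int.ceil_sub_one]
    apply Int.ceil_mono
    push_cast
    linarith
  omega

/-- with `q` and `p` as in the paper, if `q > 1` and `k' > k^p`, then
`F_{k,k'}` is pre-expansive in every direction `α` with `−log k / log m < α < 0`. -/
theorem Fkk_directional_preexpansive (k k' : ℕ) (hk : 2 ≤ k) (hk' : 2 ≤ k')
    (q p : ℕ)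
    (hq : q = sInf {n : ℕ | 0 < n ∧ n < k * k' ∧ ∃ p : ℕ, k' ∣ k ^ p * n})
    (hp : p = sInf {n : ℕ | k' ∣ k ^ n * q})
    (hq1 : 1 < q) (hkp : k ^ p < k')
    (α : ℝ) (hα₁ : -(Real.log k / Real.log (k * k')) < α) (hα₂ : α < 0) :
    ∃ m₀ : ℕ, ∀ c d : ℤ → Fin (k * k'),
      {z | c z ≠ d z}.Finite → c ≠ d →
      ∃ t : ℕ, ∃ x : ℤ, |x| ≤ (m₀ : ℤ) ∧
        (Fkk k (k * k') (by omega) (dvd_mul_right k k'))^[t] c (⌈α * t⌉ + x)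
          ≠ (Fkk k (k * k') (by omega) (dvd_mul_right k k'))^[t] d (⌈α * t⌉ + x) := by
  have hm : 0 < k * k' := by positivity
  have hk0 : (0 : ℝ) < k := by exact_mod_cast (by omega : 0 < k)
  have hk'0 : (0 : ℝ) < k' := by exact_mod_cast (by omega : 0 < k')
  have hm0 : (0 : ℝ) < ((k * k' : ℕ) : ℝ) := by exact_mod_cast hm
  have hlogk : 0 < Real.log k := Real.log_pos (by exact_mod_cast hk)
  have hlogk' : 0 < Real.log k' := Real.log_pos (by exact_mod_cast hk')
  have hlog : Real.log (k * k') = Real.log k + Real.log k' := Real.log_mul hk0.ne' hk'0.ne'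
  have hα1 : -1 < α := by
    refine lt_trans ?_ hα₁
    rw [neg_lt_neg_iff, div_lt_one (by linarith)]
    linarith
  have hgrowth : 0 < Real.log k + α * Real.log (k * k') := by
    rw [← neg_div, div_lt_iff₀ (by linarith)] at hα₁
    linarith
  obtain ⟨r, hr, hrk', hrk⟩ : ∃ r : ℕ, r.Prime ∧ r ∣ k' ∧ ¬ r ∣ k := by
    by_contra! hcon
    obtain ⟨n, hn⟩ := exists_dvd_pow_of_forall_prime_dvd (by omega) (by omega) hcon
    have : q ≤ 1 := by
      rw [hq]
      exact Nat.sInf_le ⟨one_pos, by nlinarith, n, by simpa using hn⟩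
    omega
  refine ⟨0, fun c d hfin hne => ?_⟩
  by_contra! hcon
  set D := baseValue (k * k') (digitDiff c d) with hD
  have hD0 : D ≠ 0 := by
    refine baseValue_ne_zero hm (by rwa [support_digitDiff]) (abs_digitDiff_le c d) fun h0 => hne ?_
    funext i
    by_contra hi
    exact digitDiff_ne_zero_iff.2 hi (congrFun h0 i)
  set z : ℕ → ℝ := fun t => k ^ t * D * ((k * k' : ℕ) : ℝ) ^ (⌈α * t⌉ - 1) with hz
  have happrox : ∀ t, ∃ n : ℤ, |z t - n| < ((k * k' : ℕ) : ℝ)⁻¹ := by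
    intro t
    obtain ⟨hf, hv⟩ := iterate_Fkk_difference (by omega) (dvd_mul_right k k') hm hfin t
    obtain ⟨n, hn, -⟩ := exists_baseValue_approx hm (by rwa [support_digitDiff])
      (abs_digitDiff_le _ _) ⌈α * t⌉ (a := digitDiff _ _)
    have hdig := hcon t 0 (by simp)
    rw [add_zero] at hdig
    rw [hv, ← hD, not_ne_iff.1 (mt digitDiff_ne_zero_iff.1 (not_ne_iff.2 hdig)), Int.cast_zero,
      sub_zero] at hn
    refine ⟨n, ?_⟩
    have e : z t - n = (k ^ t * D * ((k * k' : ℕ) : ℝ) ^ ⌈α * t⌉ - (k * k' : ℕ) * n)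
        * ((k * k' : ℕ) : ℝ)⁻¹ := by
      simp only [hz]
      rw [zpow_sub_one₀ hm0.ne']
      field_simp
    rw [e, abs_mul, abs_of_pos (inv_pos.2 hm0)]
    exact mul_lt_of_lt_one_left (inv_pos.2 hm0) hn
  choose n hn using happrox
  have hstep : ∀ t : ℕ, ∃ u : ℕ, ∃ s : ℕ, (s : ℤ) = -⌈α * t⌉ ∧ (k' : ℤ) ^ s * n t = k ^ u * n 0 := by
    intro t
    induction t with
    | zero => exact ⟨0, 0, by simp⟩
    | succ t ih =>
      obtain ⟨u, s, hs, hus⟩ := ih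
      rcases ceil_mul_succ hα1 hα₂ t with h | h
      · have hk1 : n (t + 1) = k * n t := by
          refine eq_of_abs_sub_lt_inv (by nlinarith) (hn t) (hn (t + 1)) ?_
          simp only [hz]
          rw [h]
          ring
        refine ⟨u + 1, s, by rw [h, hs], ?_⟩
        rw [hk1, pow_succ]
        linear_combination (k : ℤ) * hus
      · have hk1 : n t = k' * n (t + 1) := by
          refine eq_of_abs_sub_lt_inv (by nlinarith) (hn (t + 1)) (hn t) ?_
          simp only [hz]
          rw [h, zpow_sub_one₀ hm0.ne' (⌈α * t⌉ - 1)]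
          push_cast
          field_simp
          ring
        refine ⟨u, s + 1, by rw [h]; push_cast; omega, ?_⟩
        rw [← hus, hk1]
        ring
  have hn0 : n 0 = 0 := by
    by_contra h0
    obtain ⟨t, ht⟩ := exists_nat_gt ((n 0).natAbs / -α)
    obtain ⟨u, s, hs, hus⟩ := hstep t
    have hdvd : r ^ s ∣ (n 0).natAbs := by
      refine ((Nat.Prime.coprime_iff_not_dvd hr).2 hrk).pow s u |>.dvd_of_dvd_mul_left ?_
      have := congrArg Int.natAbs hus
      simp only [Int.natAbs_mul, Int.natAbs_pow, Int.natAbs_natCast] at this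
      rw [← this]
      exact (pow_dvd_pow_of_dvd hrk' s).mul_right _
    have h1 : r ^ s ≤ (n 0).natAbs := Nat.le_of_dvd (Int.natAbs_pos.2 h0) hdvd
    have h2 : s < r ^ s := Nat.lt_pow_self hr.one_lt
    have h3 : (n 0).natAbs < -α * t := by
      rw [div_lt_iff₀ (by linarith)] at ht
      linarith
    have h4 : (⌈α * t⌉ : ℝ) < α * t + 1 := Int.ceil_lt_add_one _
    have h5 : (s : ℝ) = -⌈α * t⌉ := by exact_mod_cast hs
    have h6 : (s : ℝ) + 1 ≤ (n 0).natAbs := by exact_mod_cast h2.trans_le h1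
    linarith
  have hnt : ∀ t, n t = 0 := by
    intro t
    obtain ⟨u, s, -, hus⟩ := hstep t
    rw [hn0, mul_zero] at hus
    exact (mul_eq_zero.1 hus).resolve_left (pow_ne_zero _ (by omega))
  have hbound : ∀ t : ℕ, |D| * Real.exp (t * (Real.log k + α * Real.log (k * k'))) < 1 := by
    intro t
    have h1 := hn t
    rw [hnt, Int.cast_zero, sub_zero] at h1
    simp only [hz] at h1
    rw [zpow_sub_one₀ hm0.ne', ← mul_assoc, abs_mul, abs_of_pos (inv_pos.2 hm0), abs_mul, abs_mul,
      abs_of_pos (pow_pos hk0 t), abs_of_pos (zpow_pos hm0 _), mul_lt_iff_lt_one_left (inv_pos.2 hm0)]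
      at h1
    refine lt_of_le_of_lt ?_ h1
    have h2 : Real.exp (t * (α * Real.log (k * k'))) ≤ ((k * k' : ℕ) : ℝ) ^ ⌈α * t⌉ := by
      rw [← Real.rpow_intCast, Real.rpow_def_of_pos hm0]
      apply Real.exp_le_exp.2
      push_cast
      have := Int.le_ceil (α * t)
      have h3 : 0 < Real.log (k * k') := by linarith
      nlinarith
    have h3 : Real.exp (t * Real.log k) = (k : ℝ) ^ t := by
      rw [Real.exp_nat_mul, Real.exp_log hk0]
    rw [mul_add, Real.exp_add, h3, mul_comm ((k : ℝ) ^ t) |D|, mul_assoc]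
    gcongr
  obtain ⟨t, ht⟩ := exists_nat_gt (|D|⁻¹ / (Real.log k + α * Real.log (k * k')))
  rw [div_lt_iff₀ hgrowth] at ht
  have h1 := Real.add_one_le_exp (t * (Real.log k + α * Real.log (k * k')))
  have h2 := hbound t
  have h3 : |D| * |D|⁻¹ = 1 := mul_inv_cancel₀ (abs_ne_zero.2 hD0)
  have h4 : 0 < |D| := abs_pos.2 hD0
  nlinarith
end

section
/- Let n ≥ 1, let 𝔽_n be the free group on n generators, and let F be a cellular automaton on Q^{𝔽_n} whose neighborhood V is contained in the ball B_r of radius r for the word metric. Let k ≥ 1. If F is k'-expansive for every k' with 1 ≤ k' ≤ k, then F is k-expansive with expansivity constant 2^{−r}; that is, for every pair of configurations c ≠_k d there exists t ∈ ℕ with F^t(c)|_{B_r} ≠ F^t(d)|_{B_r}. -/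
namespace FreeGroup

variable {α : Type*} [DecidableEq α]

/-- If the reduced word of `x` starts with `s` and that of `y` does not, then no cancellation
occurs in `x⁻¹ * y`. -/
theorem norm_inv_mul_of_head? {s : α × Bool} {x y : FreeGroup α}
    (hx : x.toWord.head? = some s) (hy : y.toWord.head? ≠ some s) :
    norm (x⁻¹ * y) = norm x + norm y := by
  have hred : IsReduced (x⁻¹.toWord ++ y.toWord) := by
    refine List.isChain_append.mpr ⟨isReduced_toWord, isReduced_toWord, ?_⟩
    intro a ha b hb hab
    have ha' : (s.1, !s.2) = a := by
      simpa [toWord_inv, invRev, List.getLast?_reverse, List.head?_map, hx] using ha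
    have hbs : b ≠ s := by
      rintro rfl
      exact hy hb
    subst ha'
    obtain ⟨s₁, s₂⟩ := s
    obtain ⟨b₁, b₂⟩ := b
    simp only [ne_eq, Prod.mk.injEq, not_and] at hab hbs ⊢
    have := hbs hab.symm
    cases s₂ <;> cases b₂ <;> simp_all
  rw [norm, toWord_mul, hred.reduce_eq, List.length_append, ← norm, ← norm, norm_inv_eq]

theorem toWord_mk_replicate (a : α × Bool) (m : ℕ) :
    (mk (List.replicate m a)).toWord = List.replicate m a := by
  rw [toWord_mk]
  exact IsReduced.reduce_eq (List.isChain_replicate_of_rel m fun _ => rfl)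

/-- Every finite subset of a free group is avoided by some translate of the set of elements whose
reduced word starts with `s`. -/
theorem exists_forall_head?_mul_ne (s : α × Bool) (W : Finset (FreeGroup α)) :
    ∃ h : FreeGroup α, ∀ w ∈ W, (h * w).toWord.head? ≠ some s := by
  set h : FreeGroup α := mk (List.replicate (W.sup norm + 1) (s.1, !s.2))
  have hword : h.toWord = List.replicate (W.sup norm + 1) (s.1, !s.2) :=
    toWord_mk_replicate _ _
  have hhead : h.toWord.head? ≠ some s := by
    rw [hword]
    obtain ⟨a, b⟩ := s
    simp [List.replicate_succ]
  have hnorm : norm h = W.sup norm + 1 := by rw [norm, hword, List.length_replicate]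
  refine ⟨h, fun w hw hs => ?_⟩
  have hadd := norm_inv_mul_of_head? hs hhead
  have hinv : (h * w)⁻¹ * h = w⁻¹ := by group
  rw [hinv, norm_inv_eq] at hadd
  have hle : norm w ≤ W.sup norm := Finset.le_sup hw
  omega

/-- A word of length at most `r` that leads from one side of the first-letter partition to the
other one starts and ends in the ball of radius `r`. -/
theorem norm_mul_le_of_head?_ne {s : α × Bool} {x v : FreeGroup α} {r : ℕ} (hv : norm v ≤ r)
    (h : ¬(x.toWord.head? = some s ↔ (x * v).toWord.head? = some s)) :
    norm (x * v) ≤ r := by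
  by_cases hx : x.toWord.head? = some s
  · have hadd := norm_inv_mul_of_head? (y := x * v) hx (by tauto)
    rw [inv_mul_cancel_left] at hadd
    omega
  · have hadd := norm_inv_mul_of_head? (x := x * v) (y := x) (by tauto) hx
    have hinv : (x * v)⁻¹ * x = v⁻¹ := by group
    rw [hinv, norm_inv_eq] at hadd
    omega

end FreeGroup

namespace CellularAutomaton

variable {G Q : Type*} [Group G] {F : (G → Q) → G → Q} {V : Finset G} {f : (V → Q) → Q}

theorem iterate_translate (hF : ∀ c x, F c x = f fun v => c (x * v.1)) (h : G) (t : ℕ)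
    (c : G → Q) : F^[t] (fun x => c (h * x)) = fun x => F^[t] c (h * x) := by
  have hcomm : Function.Commute F fun c x => c (h * x) := fun c => by
    funext x
    simp only [hF, mul_assoc]
  exact hcomm.iterate_left t c

/-- If two orbits agree wherever the neighborhood crosses the boundary of `H`, then gluing
them along `H` yields an orbit. -/
theorem iterate_piecewise (hF : ∀ c x, F c x = f fun v => c (x * v.1)) {c d : G → Q} {H : Set G}
    [DecidablePred (· ∈ H)]
    (hagree : ∀ t : ℕ, ∀ x, ∀ v ∈ V, ¬(x ∈ H ↔ x * v ∈ H) → F^[t] c (x * v) = F^[t] d (x * v))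
    (t : ℕ) : F^[t] (H.piecewise d c) = H.piecewise (F^[t] d) (F^[t] c) := by
  induction t with
  | zero => rfl
  | succ t ih =>
    funext x
    rw [Function.iterate_succ_apply', ih, hF]
    by_cases hx : x ∈ H
    · rw [Set.piecewise_eq_of_mem _ _ _ hx, Function.iterate_succ_apply', hF]
      congr 1
      funext v
      by_cases hxv : x * v.1 ∈ H
      · rw [Set.piecewise_eq_of_mem _ _ _ hxv]
      · rw [Set.piecewise_eq_of_notMem _ _ _ hxv]
        exact hagree t x v.1 v.2 (by tauto)
    · rw [Set.piecewise_eq_of_notMem _ _ _ hx, Function.iterate_succ_apply', hF]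
      congr 1
      funext v
      by_cases hxv : x * v.1 ∈ H
      · rw [Set.piecewise_eq_of_mem _ _ _ hxv]
        exact (hagree t x v.1 v.2 (by tauto)).symm
      · rw [Set.piecewise_eq_of_notMem _ _ _ hxv]

end CellularAutomaton

/-- for a CA `F` on `Q^{𝔽_n}` whose neighborhood is contained in the ball
of radius `r` for the word metric, if `F` is `k'`-expansive for every `1 ≤ k' ≤ k`, then
`F` is `k`-expansive with expansivity constant `2^{-r}`: every pair of configurations
differing in exactly `k` positions is eventually distinguished on the ball `B_r`. -/
theorem free_group_k_expansive_constant (n : ℕ) (hn : 1 ≤ n) (Q : Type*) [Fintype Q]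
    (F : (FreeGroup (Fin n) → Q) → FreeGroup (Fin n) → Q)
    (r : ℕ) (V : Finset (FreeGroup (Fin n))) (f : (V → Q) → Q)
    (hV : ∀ v ∈ V, FreeGroup.norm v ≤ r)
    (hF : ∀ c x, F c x = f fun v => c (x * v.1))
    (k : ℕ) (hk : 1 ≤ k)
    (hexp : ∀ k' : ℕ, 1 ≤ k' → k' ≤ k →
      ∃ W : Finset (FreeGroup (Fin n)), ∀ c d : FreeGroup (Fin n) → Q,
        {x | c x ≠ d x}.ncard = k' → ∃ t : ℕ, ∃ w ∈ W, F^[t] c w ≠ F^[t] d w) :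
    ∀ c d : FreeGroup (Fin n) → Q, {x | c x ≠ d x}.ncard = k →
      ∃ t : ℕ, ∃ w : FreeGroup (Fin n), FreeGroup.norm w ≤ r ∧
        F^[t] c w ≠ F^[t] d w := by
  classical
  intro c d hcd
  by_contra! hball
  set D := {x | c x ≠ d x} with hD
  have hDfin : D.Finite := Set.finite_of_ncard_pos (by omega)
  obtain ⟨x₀, hx₀⟩ : D.Nonempty := Set.nonempty_of_ncard_ne_zero (by omega)
  obtain ⟨s, hs⟩ : ∃ s, x₀.toWord.head? = some s := by
    rw [← Option.isSome_iff_exists, List.isSome_head?, FreeGroup.toWord_eq_nil_iff.ne]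
    rintro rfl
    exact hx₀ (hball 0 1 (by simp))
  set H : Set (FreeGroup (Fin n)) := {x | x.toWord.head? = some s}
  have hglue := CellularAutomaton.iterate_piecewise hF (c := c) (d := d) (H := H)
    fun t x v hv hx => hball t _ (FreeGroup.norm_mul_le_of_head?_ne (hV v hv) hx)
  have hdiff : {x | c x ≠ H.piecewise d c x} = D ∩ H := by
    ext x
    by_cases hx : x ∈ H <;> simp [hx, hD]
  have hpos : 1 ≤ (D ∩ H).ncard :=
    (Set.ncard_pos (hDfin.inter_of_left H)).mpr ⟨x₀, hx₀, hs⟩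
  have hle : (D ∩ H).ncard ≤ k := hcd ▸ Set.ncard_le_ncard Set.inter_subset_left hDfin
  obtain ⟨W, hW⟩ := hexp _ hpos hle
  obtain ⟨h, hh⟩ := FreeGroup.exists_forall_head?_mul_ne s W
  obtain ⟨t, w, hw, hne⟩ := hW (fun x => c (h * x)) (fun x => H.piecewise d c (h * x)) (by
    rw [← hdiff]
    exact Set.ncard_preimage_of_injective_subset_range (f := fun x => h * x)
      (s := {x | c x ≠ H.piecewise d c x}) (mul_right_injective h) (by simp [(Group.mulLeft_bijective h).surjective.range_eq]))
  rw [CellularAutomaton.iterate_translate hF, CellularAutomaton.iterate_translate hF, hglue] at hne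
  exact hne (Set.piecewise_eq_of_notMem H _ _ (hh w hw)).symm
end

section
/- Let n ≥ 1 and let Λ_n be the cellular automaton on (ℤ/2ℤ)^{𝔽_n} defined by Λ_n(c)(x) = c(x) + Σ_{s∈S} c(x·s) (addition modulo 2). Then: (1) for every odd k ≥ 1 and every pair of configurations c ≠_k d there exists t ∈ ℕ with Λ_n^t(c)(e) ≠ Λ_n^t(d)(e), where e is the identity of 𝔽_n; in particular Λ_n is k-expansive for every odd k; (2) if n ≥ 2, then Λ_n is not 2-expansive: for every finite set W ⊆ 𝔽_n there exist configurations c ≠_2 d with Λ_n^t(c)|_W = Λ_n^t(d)|_W for all t ∈ ℕ. -/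
/-- The set `S` of the `n` free generators together with their inverses. -/
def genSet (n : ℕ) : Finset (FreeGroup (Fin n)) :=
  Finset.image (fun i : Fin n => FreeGroup.of i) Finset.univ ∪
    Finset.image (fun i : Fin n => (FreeGroup.of i)⁻¹) Finset.univ

/-- The CA `Λ_n` on `(ℤ/2ℤ)^{𝔽_n}`: `Λ_n(c)(x) = c(x) + Σ_{s ∈ S} c(x·s)` (mod 2). -/
def lam (n : ℕ) (c : FreeGroup (Fin n) → ZMod 2) : FreeGroup (Fin n) → ZMod 2 :=
  fun x => c x + ∑ s ∈ genSet n, c (x * s)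

theorem toWord_mk_singleton_mul {α : Type*} [DecidableEq α] (p : α × Bool) (y : FreeGroup α) :
    (FreeGroup.mk [p] * y).toWord = List.casesOn (motive := fun _ => List (α × Bool)) y.toWord [p]
      (fun hd tl => if p.1 = hd.1 ∧ p.2 = !hd.2 then tl else p :: hd :: tl) := by
  conv_lhs => rw [← FreeGroup.mk_toWord (x := y), FreeGroup.mul_mk, FreeGroup.toWord_mk]
  rw [List.singleton_append, FreeGroup.reduce.cons, FreeGroup.reduce_toWord]

theorem sum_genSet {n : ℕ} {M : Type*} [AddCommMonoid M] (f : FreeGroup (Fin n) → M) :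
    ∑ s ∈ genSet n, f s = ∑ p : Fin n × Bool, f (FreeGroup.mk [p]) := by
  have himage : genSet n =
      Finset.image (fun p : Fin n × Bool => FreeGroup.mk [p]) Finset.univ := by
    ext x
    simp only [genSet, Finset.mem_union, Finset.mem_image, Finset.mem_univ, true_and,
      Prod.exists, Bool.exists_bool, FreeGroup.of, FreeGroup.inv_mk, FreeGroup.invRev,
      List.map_cons, List.map_nil, List.reverse_cons, List.reverse_nil, List.nil_append,
      Bool.not_true]
    rw [← exists_or]
    simp only [or_comm]
  rw [himage, Finset.sum_image]
  intro p _ q _ h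
  have := congrArg FreeGroup.toWord h
  simpa [FreeGroup.toWord_mk, FreeGroup.reduce_singleton] using this

/-- The action of `lam` on the profile of a radial configuration. -/
def radialStep : (ℕ → ZMod 2) →ₗ[ZMod 2] (ℕ → ZMod 2) where
  toFun g m := match m with
    | 0 => g 0
    | m + 1 => g (m + 1) + g m + g (m + 2)
  map_add' f g := by
    funext m
    cases m <;> simp only [Pi.add_apply]
    ring
  map_smul' a g := by
    funext m
    cases m <;> simp only [Pi.smul_apply, smul_eq_mul, RingHom.id_apply]
    ring

theorem radialStep_zero (g : ℕ → ZMod 2) : radialStep g 0 = g 0 := rfl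

theorem radialStep_succ (g : ℕ → ZMod 2) (m : ℕ) :
    radialStep g (m + 1) = g (m + 1) + g m + g (m + 2) := rfl

theorem sum_norm_mul {n : ℕ} (g : ℕ → ZMod 2) (y : FreeGroup (Fin n)) :
    g y.norm + ∑ p : Fin n × Bool, g (FreeGroup.mk [p] * y).norm = radialStep g y.norm := by
  have two : (2 : ZMod 2) = 0 := rfl
  simp only [FreeGroup.norm, toWord_mk_singleton_mul]
  cases y.toWord with
  | nil => simp [radialStep_zero, two]
  | cons hd tl =>
    have hterm (p : Fin n × Bool) :
        g (if p.1 = hd.1 ∧ p.2 = !hd.2 then tl else p :: hd :: tl).length =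
          g (tl.length + 2) +
            if p = (hd.1, !hd.2) then g tl.length + g (tl.length + 2) else 0 := by
      by_cases h : p.1 = hd.1 ∧ p.2 = !hd.2
      · have hp : p = (hd.1, !hd.2) := Prod.ext h.1 h.2
        rw [if_pos h, if_pos hp]
        linear_combination -g (tl.length + 2) * two
      · rw [if_neg h, if_neg (fun h' => h (by simp [h']))]
        simp
    simp only [hterm, Finset.sum_add_distrib, Finset.sum_ite_eq', Finset.mem_univ, if_true,
      Finset.sum_const, Finset.card_univ, Fintype.card_prod, Fintype.card_fin, Fintype.card_bool,
      List.length_cons, radialStep_succ, nsmul_eq_mul, Nat.cast_mul, Nat.cast_ofNat]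
    linear_combination (n : ZMod 2) * g (tl.length + 2) * two

theorem lam_radial {n : ℕ} (g : ℕ → ZMod 2) (x : FreeGroup (Fin n)) :
    lam n (fun w => g (w⁻¹ * x).norm) = fun w => radialStep g (w⁻¹ * x).norm := by
  funext w
  rw [← sum_norm_mul]
  simp only [lam, sum_genSet (fun s => g ((w * s)⁻¹ * x).norm)]
  congr 1
  refine Fintype.sum_equiv ((Equiv.refl _).prodCongr Equiv.boolNot) _ _ fun p => ?_
  simp [FreeGroup.inv_mk, FreeGroup.invRev, mul_assoc, Prod.map]

theorem lam_iterate_single {n : ℕ} (x w : FreeGroup (Fin n)) (t : ℕ) :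
    (lam n)^[t] (Pi.single x 1) w = (radialStep ^ t) (Pi.single 0 1) (w⁻¹ * x).norm := by
  suffices h : (lam n)^[t] (Pi.single x 1) =
      fun w => (radialStep ^ t) (Pi.single 0 1) (w⁻¹ * x).norm from congrFun h w
  induction t with
  | zero =>
    funext w
    simp only [Function.iterate_zero, id, pow_zero, Module.End.one_apply, Pi.single_apply,
      FreeGroup.norm_eq_zero, inv_mul_eq_one]
  | succ t ih =>
    rw [Function.iterate_succ_apply', ih, lam_radial, pow_succ', Module.End.mul_apply]

/-- `lam n` as a linear map. -/
def lamLinear (n : ℕ) : Module.End (ZMod 2) (FreeGroup (Fin n) → ZMod 2) where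
  toFun := lam n
  map_add' c d := by
    funext x
    simp only [lam, Pi.add_apply, Finset.sum_add_distrib]
    ring
  map_smul' a c := by
    funext x
    simp only [lam, Pi.smul_apply, smul_eq_mul, RingHom.id_apply, mul_add, Finset.mul_sum]

theorem lamLinear_pow_apply (n t : ℕ) (c : FreeGroup (Fin n) → ZMod 2) :
    (lamLinear n ^ t) c = (lam n)^[t] c := by
  rw [Module.End.pow_apply]
  rfl

theorem single_mem_of_radialStep_mem (V : Submodule (ZMod 2) (ℕ → ZMod 2))
    (hV : ∀ g ∈ V, radialStep g ∈ V) (h0 : Pi.single 0 1 ∈ V) (r : ℕ) : Pi.single r 1 ∈ V := by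
  have h1 : Pi.single 1 1 ∈ V := by
    have h : (Pi.single 1 1 : ℕ → ZMod 2) = radialStep (Pi.single 0 1) - Pi.single 0 1 := by
      funext m
      rcases m with _ | m
      · simp [radialStep_zero]
      · simp [radialStep_succ, Pi.single_apply]
    exact h ▸ V.sub_mem (hV _ h0) h0
  suffices h : Pi.single r 1 ∈ V ∧ Pi.single (r + 1) 1 ∈ V from h.1
  induction r with
  | zero => exact ⟨h0, h1⟩
  | succ r ih =>
    refine ⟨ih.2, ?_⟩
    have h : (Pi.single (r + 1 + 1) 1 : ℕ → ZMod 2) =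
        radialStep (Pi.single (r + 1) 1) - Pi.single (r + 1) 1 -
          (if r = 0 then (0 : ZMod 2) else 1) • Pi.single r 1 := by
      funext m
      rcases m with _ | m
      · rcases r with _ | r <;> simp [radialStep_zero]
      · simp only [radialStep_succ, Pi.single_apply, Pi.sub_apply, Pi.smul_apply, smul_eq_mul]
        split_ifs <;> first | omega | simp
    rw [h]
    exact V.sub_mem (V.sub_mem (hV _ ih.2) ih.2) (V.smul_mem _ ih.1)

theorem even_card_of_radialStep {ι : Type*} (A : Finset ι) (ρ : ι → ℕ)
    (h : ∀ t : ℕ, ∑ z ∈ A, (radialStep ^ t) (Pi.single 0 1) (ρ z) = 0) : Even A.card := by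
  let sumAt : (ℕ → ZMod 2) →ₗ[ZMod 2] ZMod 2 := ∑ z ∈ A, LinearMap.proj (ρ z)
  have sumAt_apply (g : ℕ → ZMod 2) : sumAt g = ∑ z ∈ A, g (ρ z) := by simp [sumAt]
  let V : Submodule (ZMod 2) (ℕ → ZMod 2) := ⨅ t : ℕ, LinearMap.ker (sumAt ∘ₗ (radialStep ^ t))
  have mem_V (g : ℕ → ZMod 2) : g ∈ V ↔ ∀ t : ℕ, sumAt ((radialStep ^ t) g) = 0 := by
    simp [V, Submodule.mem_iInf]
  have hV : ∀ g ∈ V, radialStep g ∈ V := fun g hg => (mem_V _).2 fun t => by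
    simpa [pow_succ] using (mem_V g).1 hg (t + 1)
  have hsingle := single_mem_of_radialStep_mem V hV
    ((mem_V _).2 fun t => by rw [sumAt_apply]; exact h t)
  have hsum := (mem_V _).1 (V.sum_mem (t := A.image ρ) fun r _ => hsingle r) 0
  rw [pow_zero, Module.End.one_apply, sumAt_apply] at hsum
  rw [← ZMod.natCast_eq_zero_iff_even, ← hsum, Finset.card_eq_sum_ones, Nat.cast_sum]
  refine Finset.sum_congr rfl fun z hz => ?_
  rw [Finset.sum_apply, Finset.sum_pi_single, if_pos (Finset.mem_image_of_mem ρ hz), Nat.cast_one]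

theorem exists_lam_iterate_ne {n k : ℕ} (hk : Odd k) (c d : FreeGroup (Fin n) → ZMod 2)
    (hcd : {x | c x ≠ d x}.ncard = k) : ∃ t : ℕ, (lam n)^[t] c 1 ≠ (lam n)^[t] d 1 := by
  by_contra! h
  have hfin : {x | c x ≠ d x}.Finite := Set.finite_of_ncard_ne_zero (hcd ▸ hk.pos.ne')
  have hsub : c - d = ∑ z ∈ hfin.toFinset, Pi.single z 1 := by
    funext x
    rw [Finset.sum_apply, Finset.sum_pi_single, Pi.sub_apply]
    simp only [Set.Finite.mem_toFinset, Set.mem_ofPred_eq]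
    generalize c x = a
    generalize d x = b
    revert a b
    decide
  refine Nat.not_even_iff_odd.2 hk ?_
  rw [← hcd, Set.ncard_eq_toFinset_card _ hfin]
  refine even_card_of_radialStep _ FreeGroup.norm fun t => ?_
  have ht : (lamLinear n ^ t) (c - d) 1 = 0 := by
    rw [map_sub, lamLinear_pow_apply, lamLinear_pow_apply, Pi.sub_apply, h t, sub_self]
  rw [← ht, hsub, map_sum, Finset.sum_apply]
  refine Finset.sum_congr rfl fun z _ => ?_
  rw [lamLinear_pow_apply, lam_iterate_single, inv_one, one_mul]

theorem head?_toWord_pow_mul {α : Type*} [DecidableEq α] (p : α × Bool) (y : FreeGroup α) (k : ℕ) :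
    (FreeGroup.mk [p] ^ k * y).toWord.head? = some p ∨
      (FreeGroup.mk [p] ^ k * y).norm + k ≤ y.norm := by
  induction k with
  | zero => right; simp
  | succ k ih =>
    rw [pow_succ', mul_assoc]
    simp only [FreeGroup.norm, toWord_mk_singleton_mul] at ih ⊢
    cases hv : (FreeGroup.mk [p] ^ k * y).toWord with
    | nil => left; rfl
    | cons hd tl =>
      rw [hv] at ih
      by_cases hc : p.1 = hd.1 ∧ p.2 = !hd.2
      · right
        rcases ih with ih | ih
        · obtain rfl : hd = p := by simpa using ih
          simp at hc
        · simp only [if_pos hc]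
          simp only [List.length_cons] at ih
          omega
      · left
        simp [if_neg hc]

theorem norm_mk_singleton_mul {α : Type*} [DecidableEq α] {p q : α × Bool} {y : FreeGroup α}
    (hy : y.toWord.head? = some q) (hpq : p.2 = q.2) :
    (FreeGroup.mk [p] * y).norm = y.norm + 1 := by
  simp only [FreeGroup.norm, toWord_mk_singleton_mul]
  cases hv : y.toWord with
  | nil => simp [hv] at hy
  | cons hd tl =>
    obtain rfl : hd = q := by simpa [hv] using hy
    simp [hpq]

theorem exists_lam_iterate_eq {n : ℕ} (hn : 2 ≤ n) (W : Finset (FreeGroup (Fin n))) :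
    ∃ c d : FreeGroup (Fin n) → ZMod 2, {x | c x ≠ d x}.ncard = 2 ∧
      ∀ t : ℕ, ∀ w ∈ W, (lam n)^[t] c w = (lam n)^[t] d w := by
  let a : Fin n := ⟨0, by omega⟩
  let b : Fin n := ⟨1, by omega⟩
  have hab : a ≠ b := by simp [a, b]
  let k := W.sup FreeGroup.norm + 1
  let x : Fin n → FreeGroup (Fin n) := fun i => FreeGroup.of a ^ k * FreeGroup.of i
  have hx : x a ≠ x b := fun h => hab (FreeGroup.of_injective (mul_left_cancel h))
  refine ⟨Pi.single (x a) 1, Pi.single (x b) 1, ?_, fun t w hw => ?_⟩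
  · refine (congrArg Set.ncard ?_).trans (Set.ncard_pair hx)
    ext z
    simp only [Pi.single_apply, Set.mem_ofPred_eq, Set.mem_insert_iff, Set.mem_singleton_iff]
    grind
  · have hhead : (FreeGroup.mk [(a, false)] ^ k * w).toWord.head? = some (a, false) := by
      have hle : w.norm ≤ W.sup FreeGroup.norm := Finset.le_sup hw
      exact (head?_toWord_pow_mul (a, false) w k).resolve_right (by omega)
    have hnorm (i : Fin n) : (w⁻¹ * x i).norm = (FreeGroup.mk [(a, false)] ^ k * w).norm + 1 := by
      rw [← norm_mk_singleton_mul (p := (i, false)) hhead rfl, ← FreeGroup.norm_inv_eq]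
      have hinv (j : Fin n) : FreeGroup.mk [(j, false)] = (FreeGroup.of j)⁻¹ := by
        simp [FreeGroup.of, FreeGroup.inv_mk, FreeGroup.invRev]
      simp [x, hinv, mul_assoc]
    rw [lam_iterate_single, lam_iterate_single, hnorm, hnorm]

/-- (1) for every odd `k` and every pair `c ≠_k d` some iterate distinguishes `c` and `d`
at the identity; in particular `Λ_n` is `k`-expansive for every odd `k`;
(2) if `n ≥ 2`, `Λ_n` is not `2`-expansive: no finite window ever distinguishes all
pairs differing in exactly two positions. -/
theorem lam_expansivity (n : ℕ) (hn : 1 ≤ n) :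
    (∀ k : ℕ, Odd k → ∀ c d : FreeGroup (Fin n) → ZMod 2,
      {x | c x ≠ d x}.ncard = k →
      ∃ t : ℕ, (lam n)^[t] c 1 ≠ (lam n)^[t] d 1) ∧
    (∀ k : ℕ, Odd k →
      ∃ W : Finset (FreeGroup (Fin n)), ∀ c d : FreeGroup (Fin n) → ZMod 2,
        {x | c x ≠ d x}.ncard = k →
        ∃ t : ℕ, ∃ w ∈ W, (lam n)^[t] c w ≠ (lam n)^[t] d w) ∧
    (2 ≤ n → ∀ W : Finset (FreeGroup (Fin n)),
      ∃ c d : FreeGroup (Fin n) → ZMod 2, {x | c x ≠ d x}.ncard = 2 ∧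
        ∀ t : ℕ, ∀ w ∈ W, (lam n)^[t] c w = (lam n)^[t] d w) := by
  exact ⟨fun _ hk => exists_lam_iterate_ne hk,
    fun _ hk => ⟨{1}, fun c d hcd => (exists_lam_iterate_ne hk c d hcd).imp fun _ ht =>
      ⟨1, Finset.mem_singleton_self 1, ht⟩⟩,
    exists_lam_iterate_eq⟩
end

section
/- Let F be the cellular automaton on (ℤ/2ℤ)^{ℤ²} defined by F(c)(z) = c(z) + c(z+(1,0)) + c(z−(1,0)) + c(z+(0,1)) + c(z−(0,1)) (addition modulo 2, i.e. the sum over the von Neumann neighborhood). Then F is not 2-expansive: for every finite set W ⊆ ℤ² there exist configurations c ≠_2 d such that F^t(c)|_W = F^t(d)|_W for every t ∈ ℕ. -/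
/-- The CA on `(ℤ/2ℤ)^{ℤ²}` summing over the von Neumann neighborhood:
`F(c)(z) = c(z) + c(z+(1,0)) + c(z−(1,0)) + c(z+(0,1)) + c(z−(0,1))` (mod 2). -/
def vonNeumannSum (c : ℤ × ℤ → ZMod 2) : ℤ × ℤ → ZMod 2 :=
  fun z => c z + c (z + (1, 0)) + c (z - (1, 0)) + c (z + (0, 1)) + c (z - (0, 1))

theorem vonNeumannSum_apply (c : ℤ × ℤ → ZMod 2) (x y : ℤ) :
    vonNeumannSum c (x, y) = c (x, y) + c (x + 1, y) + c (x - 1, y) + c (x, y + 1) + c (x, y - 1) := by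
  simp [vonNeumannSum]

theorem vonNeumannSum_add (c d : ℤ × ℤ → ZMod 2) :
    vonNeumannSum (c + d) = vonNeumannSum c + vonNeumannSum d := by
  funext z
  simp only [vonNeumannSum, Pi.add_apply]
  ring

theorem vonNeumannSum_iterate_add (c d : ℤ × ℤ → ZMod 2) (t : ℕ) :
    vonNeumannSum^[t] (c + d) = vonNeumannSum^[t] c + vonNeumannSum^[t] d := by
  induction t generalizing c d with
  | zero => rfl
  | succ t ih => simp only [Function.iterate_succ_apply, vonNeumannSum_add, ih]

theorem vonNeumannSum_iterate_zero (t : ℕ) : vonNeumannSum^[t] 0 = 0 := by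
  have h := vonNeumannSum_iterate_add 0 0 t
  simpa using h

/-- The iterates commute with every symmetry of the lattice that the rule itself commutes with. -/
theorem vonNeumannSum_iterate_comp {σ : ℤ × ℤ → ℤ × ℤ}
    (hσ : ∀ c, vonNeumannSum (c ∘ σ) = vonNeumannSum c ∘ σ) (c : ℤ × ℤ → ZMod 2) (t : ℕ) :
    vonNeumannSum^[t] (c ∘ σ) = vonNeumannSum^[t] c ∘ σ := by
  induction t generalizing c with
  | zero => rfl
  | succ t ih => simp only [Function.iterate_succ_apply, hσ, ih]

theorem vonNeumannSum_iterate_comp_add (p : ℤ × ℤ) (c : ℤ × ℤ → ZMod 2) (t : ℕ) :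
    vonNeumannSum^[t] (c ∘ (· + p)) = vonNeumannSum^[t] c ∘ (· + p) := by
  refine vonNeumannSum_iterate_comp (fun c => ?_) c t
  funext z
  simp only [vonNeumannSum, Function.comp_apply, add_right_comm z _ p, sub_add_eq_add_sub]

/-- The antidiagonal reflection `(x, y) ↦ (-y, -x)` commutes with the iterates. -/
theorem vonNeumannSum_iterate_comp_neg_swap (c : ℤ × ℤ → ZMod 2) (t : ℕ) :
    vonNeumannSum^[t] (c ∘ fun z => -z.swap) = vonNeumannSum^[t] c ∘ fun z => -z.swap := by
  refine vonNeumannSum_iterate_comp (fun c => ?_) c t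
  funext ⟨x, y⟩
  simp only [vonNeumannSum_apply, Function.comp_apply, Prod.swap_prod_mk, Prod.neg_mk, neg_add',
    neg_sub', sub_neg_eq_add]
  ring

/-- Spread a configuration over the sublattice `2ℤ × 2ℤ`, filling the gaps with `0`. -/
def upsample (c : ℤ × ℤ → ZMod 2) : ℤ × ℤ → ZMod 2 :=
  fun z => if 2 ∣ z.1 ∧ 2 ∣ z.2 then c (z.1 / 2, z.2 / 2) else 0

theorem upsample_even (c : ℤ × ℤ → ZMod 2) (x y : ℤ) : upsample c (2 * x, 2 * y) = c (x, y) := by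
  simp [upsample]

theorem upsample_of_not_dvd_fst (c : ℤ × ℤ → ZMod 2) {x : ℤ} (hx : ¬ 2 ∣ x) (y : ℤ) :
    upsample c (x, y) = 0 := by
  simp [upsample, hx]

theorem upsample_of_not_dvd_snd (c : ℤ × ℤ → ZMod 2) (x : ℤ) {y : ℤ} (hy : ¬ 2 ∣ y) :
    upsample c (x, y) = 0 := by
  simp [upsample, hy]

theorem vonNeumannSum_vonNeumannSum (c : ℤ × ℤ → ZMod 2) (x y : ℤ) :
    vonNeumannSum (vonNeumannSum c) (x, y) =
      c (x, y) + c (x + 2, y) + c (x - 2, y) + c (x, y + 2) + c (x, y - 2) := by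
  have h2 : (2 : ZMod 2) = 0 := rfl
  have e1 (a : ℤ) : a + 1 + 1 = a + 2 := by ring
  have e2 (a : ℤ) : a - 1 - 1 = a - 2 := by ring
  simp only [vonNeumannSum_apply, e1, e2, add_sub_cancel_right, sub_add_cancel]
  linear_combination (2 * c (x, y) + c (x + 1, y) + c (x - 1, y) + c (x, y + 1) + c (x, y - 1)
    + c (x + 1, y + 1) + c (x + 1, y - 1) + c (x - 1, y + 1) + c (x - 1, y - 1)) * h2

theorem vonNeumannSum_vonNeumannSum_upsample (c : ℤ × ℤ → ZMod 2) :
    vonNeumannSum (vonNeumannSum (upsample c)) = upsample (vonNeumannSum c) := by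
  funext ⟨x, y⟩
  rw [vonNeumannSum_vonNeumannSum]
  by_cases hx : 2 ∣ x
  · by_cases hy : 2 ∣ y
    · obtain ⟨a, rfl⟩ := hx
      obtain ⟨b, rfl⟩ := hy
      have e1 (a : ℤ) : 2 * a + 2 = 2 * (a + 1) := by ring
      have e2 (a : ℤ) : 2 * a - 2 = 2 * (a - 1) := by ring
      simp only [e1, e2, upsample_even, vonNeumannSum_apply]
    · have h1 : ¬ 2 ∣ y + 2 := by omega
      have h2 : ¬ 2 ∣ y - 2 := by omega
      simp only [upsample_of_not_dvd_snd _ _ hy, upsample_of_not_dvd_snd _ _ h1,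
        upsample_of_not_dvd_snd _ _ h2, add_zero]
  · have h1 : ¬ 2 ∣ x + 2 := by omega
    have h2 : ¬ 2 ∣ x - 2 := by omega
    simp only [upsample_of_not_dvd_fst _ hx, upsample_of_not_dvd_fst _ h1,
      upsample_of_not_dvd_fst _ h2, add_zero]

theorem vonNeumannSum_iterate_two_mul_upsample (c : ℤ × ℤ → ZMod 2) (t : ℕ) :
    vonNeumannSum^[2 * t] (upsample c) = upsample (vonNeumannSum^[t] c) := by
  induction t generalizing c with
  | zero => rfl
  | succ t ih =>
    rw [Nat.mul_succ, Function.iterate_add_apply, Function.iterate_succ_apply,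
      Function.iterate_one, vonNeumannSum_vonNeumannSum_upsample, ih, Function.iterate_succ_apply]

theorem vonNeumannSum_iterate_two_mul_add_one_upsample (c : ℤ × ℤ → ZMod 2) (t : ℕ) :
    vonNeumannSum^[2 * t + 1] (upsample c) = vonNeumannSum (upsample (vonNeumannSum^[t] c)) := by
  rw [Function.iterate_succ_apply', vonNeumannSum_iterate_two_mul_upsample]

theorem vonNeumannSum_upsample_even (c : ℤ × ℤ → ZMod 2) (x y : ℤ) :
    vonNeumannSum (upsample c) (2 * x, 2 * y) = c (x, y) := by
  have h1 (a : ℤ) : ¬ 2 ∣ 2 * a + 1 := by omega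
  have h2 (a : ℤ) : ¬ 2 ∣ 2 * a - 1 := by omega
  simp only [vonNeumannSum_apply, upsample_even, upsample_of_not_dvd_fst _ (h1 _),
    upsample_of_not_dvd_fst _ (h2 _), upsample_of_not_dvd_snd _ _ (h1 _),
    upsample_of_not_dvd_snd _ _ (h2 _), add_zero]

theorem vonNeumannSum_upsample_odd (c : ℤ × ℤ → ZMod 2) {x y : ℤ} (hx : ¬ 2 ∣ x) (hy : ¬ 2 ∣ y) :
    vonNeumannSum (upsample c) (x, y) = 0 := by
  simp only [vonNeumannSum_apply, upsample_of_not_dvd_fst _ hx, upsample_of_not_dvd_snd _ _ hy,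
    add_zero]

theorem vonNeumannSum_iterate_upsample_odd (c : ℤ × ℤ → ZMod 2) (t : ℕ) {x y : ℤ}
    (hx : ¬ 2 ∣ x) (hy : ¬ 2 ∣ y) : vonNeumannSum^[t] (upsample c) (x, y) = 0 := by
  obtain ⟨s, rfl | rfl⟩ := t.even_or_odd'
  · rw [vonNeumannSum_iterate_two_mul_upsample, upsample_of_not_dvd_fst _ hx]
  · rw [vonNeumannSum_iterate_two_mul_add_one_upsample, vonNeumannSum_upsample_odd _ hx hy]

theorem vonNeumannSum_iterate_upsample_even (c : ℤ × ℤ → ZMod 2) (t : ℕ) (x y : ℤ) :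
    vonNeumannSum^[t] (upsample c) (2 * x, 2 * y) = vonNeumannSum^[t / 2] c (x, y) := by
  obtain ⟨s, rfl | rfl⟩ := t.even_or_odd'
  · rw [vonNeumannSum_iterate_two_mul_upsample, upsample_even, Nat.mul_div_cancel_left s two_pos]
  · rw [vonNeumannSum_iterate_two_mul_add_one_upsample, vonNeumannSum_upsample_even,
      show (2 * s + 1) / 2 = s by omega]

/-- The orbit of `c` vanishes on the square `[0, n]²` at all times. -/
def VanishesOnSquare (n : ℤ) (c : ℤ × ℤ → ZMod 2) : Prop :=
  ∀ t : ℕ, ∀ x y : ℤ, 0 ≤ x → x ≤ n → 0 ≤ y → y ≤ n → vonNeumannSum^[t] c (x, y) = 0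

theorem upsample_eq_zero_of_square {n : ℤ} {c : ℤ × ℤ → ZMod 2}
    (hc : ∀ x y : ℤ, 0 ≤ x → x ≤ n → 0 ≤ y → y ≤ n → c (x, y) = 0) {x y : ℤ}
    (hx : -1 ≤ x) (hxn : x ≤ 2 * n + 1) (hy : -1 ≤ y) (hyn : y ≤ 2 * n + 1) :
    upsample c (x, y) = 0 := by
  unfold upsample
  split_ifs with h
  · exact hc _ _ (by dsimp only at *; omega) (by dsimp only at *; omega)
      (by dsimp only at *; omega) (by dsimp only at *; omega)
  · rfl

theorem VanishesOnSquare.upsample {n : ℤ} {c : ℤ × ℤ → ZMod 2} (hc : VanishesOnSquare n c) :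
    VanishesOnSquare (2 * n) (upsample c) := by
  intro t x y hx hxn hy hyn
  obtain ⟨s, rfl | rfl⟩ := t.even_or_odd'
  · rw [vonNeumannSum_iterate_two_mul_upsample]
    exact upsample_eq_zero_of_square (hc s) (by omega) (by omega) (by omega) (by omega)
  · rw [vonNeumannSum_iterate_two_mul_add_one_upsample, vonNeumannSum_apply]
    have key {a b : ℤ} := @upsample_eq_zero_of_square n _ (hc s) a b
    rw [key, key, key, key, key] <;> first | omega | simp

theorem ncard_support_upsample (c : ℤ × ℤ → ZMod 2) :
    (Function.support (upsample c)).ncard = (Function.support c).ncard := by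
  have hinj : Function.Injective fun z : ℤ × ℤ => (2 * z.1, 2 * z.2) := by
    rintro ⟨a, b⟩ ⟨a', b'⟩ h
    simpa using h
  rw [← Set.ncard_image_of_injective (Function.support c) hinj]
  congr 1
  ext ⟨x, y⟩
  constructor
  · intro h
    by_cases hx : 2 ∣ x
    · by_cases hy : 2 ∣ y
      · obtain ⟨a, rfl⟩ := hx
        obtain ⟨b, rfl⟩ := hy
        exact ⟨(a, b), by simpa [upsample_even] using h, rfl⟩
      · exact absurd (upsample_of_not_dvd_snd c x hy) h
    · exact absurd (upsample_of_not_dvd_fst c hx y) h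
  · rintro ⟨⟨a, b⟩, h, h'⟩
    rw [← h', Function.mem_support, upsample_even]
    exact h

/-- The configuration whose only nonzero cell is `p`. -/
def impulse (p : ℤ × ℤ) : ℤ × ℤ → ZMod 2 := Pi.single p 1

theorem upsample_impulse_zero : upsample (impulse 0) = impulse 0 := by
  funext ⟨x, y⟩
  simp only [upsample, impulse, Pi.single_apply, Prod.mk_eq_zero]
  split_ifs <;> first | rfl | omega

theorem vonNeumannSum_iterate_impulse_odd (t : ℕ) {x y : ℤ} (hx : ¬ 2 ∣ x) (hy : ¬ 2 ∣ y) :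
    vonNeumannSum^[t] (impulse 0) (x, y) = 0 := by
  rw [← upsample_impulse_zero, vonNeumannSum_iterate_upsample_odd _ _ hx hy]

theorem vonNeumannSum_iterate_impulse_even (t : ℕ) (x y : ℤ) :
    vonNeumannSum^[t] (impulse 0) (2 * x, 2 * y) =
      vonNeumannSum^[t / 2] (impulse 0) (x, y) := by
  conv_lhs => rw [← upsample_impulse_zero]
  rw [vonNeumannSum_iterate_upsample_even]

theorem vonNeumannSum_iterate_impulse_neg_swap (t : ℕ) (x y : ℤ) :
    vonNeumannSum^[t] (impulse 0) (-y, -x) = vonNeumannSum^[t] (impulse 0) (x, y) := by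
  have h : impulse 0 ∘ (fun z => -z.swap) = impulse 0 := by
    funext ⟨x, y⟩
    simp only [Function.comp_apply, impulse, Pi.single_apply, Prod.swap_prod_mk, Prod.neg_mk,
      Prod.mk_eq_zero, neg_eq_zero, and_comm]
  conv_rhs => rw [← h, vonNeumannSum_iterate_comp_neg_swap]
  rfl

theorem vonNeumannSum_iterate_impulse (t : ℕ) (p z : ℤ × ℤ) :
    vonNeumannSum^[t] (impulse p) z = vonNeumannSum^[t] (impulse 0) (z - p) := by
  have h : impulse p = impulse 0 ∘ (· + -p) := by
    funext w
    simp only [Function.comp_apply, impulse, Pi.single_apply, add_neg_eq_zero]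
  rw [h, vonNeumannSum_iterate_comp_add, Function.comp_apply, sub_eq_add_neg]

/-- The seed pattern: two cells on the diagonal, invisible from the square `[0, 1]²`. -/
theorem vanishesOnSquare_seed :
    VanishesOnSquare 1 (impulse (2, 2) + impulse (-1, -1)) := by
  intro t x y hx hx1 hy hy1
  rw [vonNeumannSum_iterate_add, Pi.add_apply, vonNeumannSum_iterate_impulse t (2, 2),
    vonNeumannSum_iterate_impulse t (-1, -1), Prod.mk_sub_mk, Prod.mk_sub_mk]
  obtain rfl | rfl : x = 0 ∨ x = 1 := by omega
  all_goals obtain rfl | rfl : y = 0 ∨ y = 1 := by omega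
  · have h := vonNeumannSum_iterate_impulse_even t (-1) (-1)
    rw [vonNeumannSum_iterate_impulse_odd (t / 2) (x := -1) (y := -1) (by decide) (by decide)] at h
    rw [vonNeumannSum_iterate_impulse_odd t (x := 0 - -1) (by decide) (by decide), add_zero]
    exact h
  · have h := vonNeumannSum_iterate_impulse_neg_swap t 1 2
    norm_num at h ⊢
    rw [h, CharTwo.add_self_eq_zero]
  · have h := vonNeumannSum_iterate_impulse_neg_swap t 2 1
    norm_num at h ⊢
    rw [h, CharTwo.add_self_eq_zero]
  · have h := vonNeumannSum_iterate_impulse_even t 1 1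
    rw [vonNeumannSum_iterate_impulse_odd (t / 2) (x := 1) (y := 1) (by decide) (by decide)] at h
    rw [vonNeumannSum_iterate_impulse_odd t (x := 1 - 2) (by decide) (by decide), zero_add]
    exact h

theorem ncard_support_seed :
    (Function.support (impulse (2, 2) + impulse (-1, -1))).ncard = 2 := by
  rw [Set.ncard_eq_two]
  refine ⟨(2, 2), (-1, -1), by decide, ?_⟩
  ext z
  simp only [Function.mem_support, Pi.add_apply, impulse, Pi.single_apply, Set.mem_insert_iff,
    Set.mem_singleton_iff]
  by_cases h1 : z = (2, 2)
  · subst h1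
    decide
  · by_cases h2 : z = (-1, -1) <;> simp [h1, h2]

theorem exists_vanishesOnSquare (k : ℕ) :
    ∃ c, (Function.support c).ncard = 2 ∧ VanishesOnSquare (2 ^ k) c := by
  induction k with
  | zero => exact ⟨_, ncard_support_seed, by simpa using vanishesOnSquare_seed⟩
  | succ k ih =>
    obtain ⟨c, hcard, hc⟩ := ih
    exact ⟨upsample c, by rw [ncard_support_upsample, hcard], by
      rw [pow_succ']
      exact hc.upsample⟩

theorem exists_bound (W : Finset (ℤ × ℤ)) :
    ∃ M : ℕ, ∀ w ∈ W, |w.1| ≤ M ∧ |w.2| ≤ M := by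
  refine ⟨W.sup fun w => max w.1.natAbs w.2.natAbs, fun w hw => ?_⟩
  have h := Finset.le_sup (f := fun w : ℤ × ℤ => max w.1.natAbs w.2.natAbs) hw
  rw [abs_le, abs_le]
  omega

/-- the von Neumann ⊕₂ rule on `ℤ²` is not `2`-expansive: for every
finite window `W` there is a pair of configurations differing in exactly two positions
whose iterates agree on `W` at all times. -/
theorem vonNeumannSum_not_two_expansive :
    ∀ W : Finset (ℤ × ℤ), ∃ c d : ℤ × ℤ → ZMod 2,
      {z | c z ≠ d z}.ncard = 2 ∧
      ∀ t : ℕ, ∀ w ∈ W, vonNeumannSum^[t] c w = vonNeumannSum^[t] d w := by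
  intro W
  obtain ⟨M, hM⟩ := exists_bound W
  obtain ⟨c, hcard, hc⟩ := exists_vanishesOnSquare (2 * M)
  have hpow : (2 * M : ℤ) ≤ 2 ^ (2 * M) := by exact_mod_cast Nat.lt_two_pow_self.le
  refine ⟨c ∘ (· + ((M : ℤ), (M : ℤ))), 0, ?_, fun t w hw => ?_⟩
  · refine Eq.trans ?_ hcard
    rw [← Set.ncard_image_of_injective _ (add_left_injective ((M : ℤ), (M : ℤ)))]
    congr 1
    ext z
    constructor
    · rintro ⟨w, hw, rfl⟩
      exact hw
    · intro hz
      exact ⟨z - ((M : ℤ), (M : ℤ)), by simpa using hz, sub_add_cancel _ _⟩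
  · rw [vonNeumannSum_iterate_comp_add, vonNeumannSum_iterate_zero]
    obtain ⟨h1, h2⟩ := hM w hw
    rw [abs_le] at h1 h2
    exact hc t _ _ (by omega) (by omega) (by omega) (by omega)
end
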